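/- arXiv:0805.0154 — 2 statements merged into one kernel-verified Lean document; each statement's English description precedes it below -/
import Mathlib

section
/- Let q be a computable real with q > 1. For every right-computable real y ∈ (0, q^{q/(1-q)}], there exists a universal probability m such that S_q(m) = y, where S_q(m) = (1/(q-1)) ∑_{s∈{0,1}*} (m(s) - m(s)^q). -/
open Filter Topology

namespace Paper

/-- Finite binary strings. -/
abbrev Str := List Bool

/-- A computer: a partial recursive function on binary strings with prefix-free domain. -/
structure Computer where
  f : Str →. Str
  partrec : Partrec f
  prefixFree : ∀ p q : Str, (f p).Dom → (f q).Dom → p <+: q → p = q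

/-- An optimal computer (universal self-delimiting Turing machine). -/
structure OptimalComputer extends Computer where
  optimal : ∀ C : Computer, ∃ sim : ℕ, ∀ p s, s ∈ C.f p →
    ∃ p', s ∈ toComputer.f p' ∧ p'.length ≤ p.length + sim

/-- Prefix-free Kolmogorov complexity (program-size complexity) w.r.t. `U`. -/
noncomputable def Kc (U : OptimalComputer) (s : Str) : ℕ :=
  sInf {n | ∃ p : Str, p.length = n ∧ s ∈ U.f p}

/-- A semi-measure on binary strings: values in [0,1] with all finite partial sums ≤ 1. -/
def SemiMeasure (r : Str → ℝ) : Prop :=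
  (∀ s, 0 ≤ r s ∧ r s ≤ 1) ∧ ∀ F : Finset Str, ∑ s ∈ F, r s ≤ 1

/-- Lower-computability: approximability from below by a total recursive rational function. -/
def LowerComputable (r : Str → ℝ) : Prop :=
  ∃ f : ℕ → Str → ℚ, Computable₂ f ∧
    ∀ s : Str, (∀ n : ℕ, 0 ≤ f n s ∧ (f n s : ℝ) ≤ r s) ∧
      Tendsto (fun n => (f n s : ℝ)) atTop (nhds (r s))

/-- A lower-computable semi-measure. -/
def LCSemiMeasure (r : Str → ℝ) : Prop := SemiMeasure r ∧ LowerComputable r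

/-- A universal probability: a lower-computable semi-measure dominating all
lower-computable semi-measures up to a positive multiplicative constant. -/
def UniversalProb (m : Str → ℝ) : Prop :=
  LCSemiMeasure m ∧ ∀ r : Str → ℝ, LCSemiMeasure r → ∃ c : ℝ, 0 < c ∧ ∀ s, c * r s ≤ m s

/-- The first `n` bits of the base-two expansion of `T mod 1`
(the expansion with infinitely many zeros). -/
noncomputable def binPrefix (T : ℝ) (n : ℕ) : Str :=
  (List.range n).map (fun i => decide (⌊Int.fract T * 2 ^ (i + 1)⌋ % 2 = 1))

/-- A real is right-computable if it is the limit from above of a recursive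
sequence of rationals. -/
def RightComputableReal (T : ℝ) : Prop :=
  ∃ g : ℕ → ℚ, Computable g ∧ (∀ n, T ≤ (g n : ℝ)) ∧
    Tendsto (fun n => (g n : ℝ)) atTop (nhds T)

/-- A real is left-computable if its negation is right-computable. -/
def LeftComputableReal (T : ℝ) : Prop := RightComputableReal (-T)

/-- A computable real number. -/
def ComputableReal (T : ℝ) : Prop :=
  ∃ f : ℕ → ℚ, Computable f ∧ ∀ n : ℕ, |T - (f n : ℝ)| < (2 : ℝ)⁻¹ ^ n

/-- A recursively enumerable set of binary strings. -/
def REset (A : Set Str) : Prop :=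
  ∃ g : Str →. Unit, Partrec g ∧ ∀ s, (g s).Dom ↔ s ∈ A

/-- `T` is weakly Chaitin `D`-random. -/
noncomputable def WeaklyChaitinDRandom (U : OptimalComputer) (D T : ℝ) : Prop :=
  ∃ c : ℕ, ∀ n : ℕ, D * n - c ≤ Kc U (binPrefix T n)

/-- `T` is `D`-compressible. -/
noncomputable def DCompressible (U : OptimalComputer) (D T : ℝ) : Prop :=
  Filter.atTop.limsup (fun n : ℕ => (Kc U (binPrefix T n) : ℝ) / n) ≤ D


namespace TsRat
open Encodable Denumerable

def oc (r : ℚ) : ℕ := @Encodable.encode ℚ Rat.instEncodable r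

lemma oc_eq (r : ℚ) : oc r = Nat.pair (encode r.num) r.den := rfl

instance ocInf : Infinite (Set.range oc) :=
  Infinite.of_injective _
    (Equiv.ofInjective _ (@Encodable.encode_injective ℚ Rat.instEncodable)).injective

instance ocDec : DecidablePred (· ∈ Set.range oc) := @decidableRangeEncode ℚ Rat.instEncodable

lemma oc_ofNat (n : ℕ) :
    oc (Denumerable.ofNat ℚ n) = (Nat.Subtype.ofNat (Set.range oc) n : ℕ) := by
  have h : Denumerable.ofNat ℚ n
      = (@equivRangeEncode ℚ Rat.instEncodable).symm (Nat.Subtype.ofNat (Set.range oc) n) := rfl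
  have h2 := (Equiv.eq_symm_apply _).1 h
  exact congrArg Subtype.val h2

lemma exists_next (x : ℕ) : ∃ m, x + m + 1 ∈ Set.range oc := by
  have h : (Set.range oc).Infinite := Set.infinite_coe_iff.mp ocInf
  obtain ⟨y, hy, hxy⟩ := h.exists_gt x
  exact ⟨y - x - 1, by rwa [show x + (y - x - 1) + 1 = y by omega]⟩

lemma oc_succ (n : ℕ) : oc (ofNat ℚ (n + 1))
    = oc (ofNat ℚ n) + Nat.find (exists_next (oc (ofNat ℚ n))) + 1 := by
  rw [oc_ofNat (n + 1)]
  have : (Nat.Subtype.ofNat (Set.range oc) (n+1)) = Nat.Subtype.succ (Nat.Subtype.ofNat (Set.range oc) n) := rfl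
  rw [this]
  simp only [Nat.Subtype.succ]
  simp only [oc_ofNat]

def zp (z : ℕ) : ℕ := if z.bodd then 0 else z.div2
def zn (z : ℕ) : ℕ := if z.bodd then z.div2 + 1 else 0

lemma zp_encode (i : ℤ) : (i : ℤ) = zp (encode i) - zn (encode i) := by
  cases i with
  | ofNat n =>
    have : encode (Int.ofNat n) = 2 * n := rfl
    rw [this]; simp [zp, zn]
  | negSucc n =>
    have : encode (Int.negSucc n) = 2 * n + 1 := rfl
    rw [this]; simp [zp, zn, Int.negSucc_eq, Nat.div2_val]

lemma natAbs_encode (i : ℤ) : i.natAbs = zp (encode i) + zn (encode i) := by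
  have h := zp_encode i
  have : zp (encode i) = 0 ∨ zn (encode i) = 0 := by
    unfold zp zn; split_ifs <;> simp
  omega

lemma zp_prim : Primrec zp := by
  refine (Primrec.cond Primrec.nat_bodd (Primrec.const 0) Primrec.nat_div2).of_eq ?_
  intro n; unfold zp; cases n.bodd <;> simp
lemma zn_prim : Primrec zn := by
  refine (Primrec.cond Primrec.nat_bodd (Primrec.succ.comp Primrec.nat_div2) (Primrec.const 0)).of_eq ?_
  intro n; unfold zn; cases n.bodd <;> simp

lemma mem_range_oc (y : ℕ) : y ∈ Set.range oc ↔
    0 < y.unpair.2 ∧ ∀ k < y.unpair.2 + 1,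
      ¬ (1 < k ∧ (zp y.unpair.1 + zn y.unpair.1) % k = 0 ∧ y.unpair.2 % k = 0) := by
  have key : ∀ i : ℤ, ∀ d : ℕ, 0 < d → (i.natAbs.Coprime d ↔ ∀ k < d + 1,
      ¬ (1 < k ∧ (zp (encode i) + zn (encode i)) % k = 0 ∧ d % k = 0)) := by
    intro i d hd
    rw [natAbs_encode]
    constructor
    · rintro h k hk ⟨h1, h2, h3⟩
      have := Nat.dvd_gcd (Nat.dvd_of_mod_eq_zero h2) (Nat.dvd_of_mod_eq_zero h3)
      rw [h] at this
      have := Nat.le_of_dvd one_pos this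
      omega
    · intro h
      by_contra hc
      set g := Nat.gcd (zp (encode i) + zn (encode i)) d with hg
      have h0 : 0 < g := Nat.gcd_pos_of_pos_right _ hd
      refine h g (Nat.lt_succ_of_le (Nat.gcd_le_right _ hd)) ⟨?_, ?_, ?_⟩
      · have : g ≠ 1 := hc
        omega
      · exact Nat.mod_eq_zero_of_dvd (Nat.gcd_dvd_left _ _)
      · exact Nat.mod_eq_zero_of_dvd (Nat.gcd_dvd_right _ _)
  constructor
  · rintro ⟨r, rfl⟩
    rw [oc_eq]
    simp only [Nat.unpair_pair]
    exact ⟨r.den_pos, (key _ _ r.den_pos).1 r.reduced⟩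
  · rintro ⟨h1, h2⟩
    have h3 : encode (ofNat ℤ y.unpair.1) = y.unpair.1 := encode_ofNat _
    rw [← h3] at h2
    have := (key _ _ h1).2 h2
    refine ⟨⟨ofNat ℤ y.unpair.1, y.unpair.2, h1.ne', this⟩, ?_⟩
    rw [oc_eq]
    simp only [h3, Nat.pair_unpair]

lemma mem_range_prim : PrimrecPred (· ∈ Set.range oc) := by
  have h1 : PrimrecRel fun (k : ℕ) (y : ℕ) =>
      ¬ (1 < k ∧ (zp y.unpair.1 + zn y.unpair.1) % k = 0 ∧ y.unpair.2 % k = 0) := by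
    have u1 : Primrec fun p : ℕ × ℕ => p.2.unpair.1 := Primrec.fst.comp (Primrec.unpair.comp Primrec.snd)
    have u2 : Primrec fun p : ℕ × ℕ => p.2.unpair.2 := Primrec.snd.comp (Primrec.unpair.comp Primrec.snd)
    refine PrimrecPred.not (PrimrecPred.and ?_ (PrimrecPred.and ?_ ?_))
    · exact Primrec.nat_lt.comp (Primrec.const 1) Primrec.fst
    · exact Primrec.eq.comp (Primrec.nat_mod.comp (Primrec.nat_add.comp (zp_prim.comp u1) (zn_prim.comp u1)) Primrec.fst) (Primrec.const 0)
    · exact Primrec.eq.comp (Primrec.nat_mod.comp u2 Primrec.fst) (Primrec.const 0)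
  have h2 := PrimrecRel.forall_lt h1
  have u2 : Primrec fun p : ℕ => p.unpair.2 := Primrec.snd.comp (Primrec.unpair)
  have h3 := PrimrecRel.comp h2 (Primrec.succ.comp u2) Primrec.id
  have h4 : PrimrecPred fun y : ℕ => 0 < y.unpair.2 := Primrec.nat_lt.comp (Primrec.const 0) u2
  refine (h4.and h3).of_eq ?_
  intro y
  rw [mem_range_oc]; rfl

lemma oc_comp : Computable oc := by
  have hf : Computable fun x => Nat.find (exists_next x) := by
    refine Computable.find (P := fun x m => x + m + 1 ∈ Set.range oc) ?_ exists_next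
    exact (mem_range_prim.comp (Primrec.succ.comp Primrec.nat_add)).computablePred
  have h : Computable fun n => oc (ofNat ℚ n) := by
    have := Computable.nat_rec (f := fun n : ℕ => n) (g := fun _ => oc (ofNat ℚ 0))
      (h := fun _ p => p.2 + Nat.find (exists_next p.2) + 1) Computable.id (Computable.const _)
      (by
        have hs : Computable fun p : ℕ × ℕ × ℕ => p.2.2 := Computable.snd.comp Computable.snd
        exact Computable.succ.comp (Primrec.nat_add.to_comp.comp hs (hf.comp hs)))
    refine this.of_eq ?_
    intro n
    induction n with
    | zero => rfl
    | succ n ih => rw [oc_succ, ← ih]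
  have := h.comp (Computable.encode (α := ℚ))
  refine this.of_eq ?_
  intro r; rw [ofNat_encode]

def rp (r : ℚ) : ℕ := zp (oc r).unpair.1
def rn (r : ℚ) : ℕ := zn (oc r).unpair.1

lemma rp_comp : Computable rp :=
  zp_prim.to_comp.comp (Computable.fst.comp (Computable.unpair.comp oc_comp))
lemma rn_comp : Computable rn :=
  zn_prim.to_comp.comp (Computable.fst.comp (Computable.unpair.comp oc_comp))
lemma den_comp : Computable Rat.den := by
  refine (Computable.snd.comp (Computable.unpair.comp oc_comp)).of_eq ?_
  intro r; rw [oc_eq]; simp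

lemma rep (r : ℚ) : r = ((rp r : ℚ) - rn r) / r.den := by
  have h : (r.num : ℤ) = (rp r : ℤ) - rn r := by
    unfold rp rn
    rw [oc_eq]; simp only [Nat.unpair_pair]
    exact zp_encode _
  have h' : (r.num : ℚ) = (rp r : ℚ) - rn r := by exact_mod_cast h
  rw [← h', Rat.num_div_den]

lemma cite {α σ} [Primcodable α] [Primcodable σ] {c : α → Prop} [DecidablePred c] {f g : α → σ}
    (hc : Computable fun a => decide (c a)) (hf : Computable f) (hg : Computable g) :
    Computable fun a => if c a then f a else g a := by
  refine (Computable.cond hc hf hg).of_eq ?_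
  intro a; by_cases h : c a <;> simp [h]

def mkq (a b c : ℕ) : ℚ := ((a : ℚ) - b) / (c + 1)

lemma mkq_comp : Computable fun p : ℕ × ℕ × ℕ => mkq p.1 p.2.1 p.2.2 := by
  have hiff : ∀ (p : ℕ × ℕ × ℕ) (r : ℚ),
    (rp r * (p.2.2 + 1) + p.2.1 * r.den = p.1 * r.den + rn r * (p.2.2 + 1) ↔ r = mkq p.1 p.2.1 p.2.2) := by
    rintro ⟨a, b, c⟩ r
    have hd : (r.den : ℚ) ≠ 0 := by exact_mod_cast r.den_nz
    have hc : (c : ℚ) + 1 ≠ 0 := by positivity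
    have : r = mkq a b c ↔ ((rp r : ℚ) - rn r) / r.den = ((a : ℚ) - b) / (c + 1) := by
      rw [← rep]; rfl
    simp only
    rw [this, div_eq_div_iff hd hc]
    rw [← Nat.cast_inj (R := ℚ)]
    push_cast
    constructor <;> intro h <;> linarith
  have hex : ∀ p : ℕ × ℕ × ℕ, ∃ n, (fun (p : ℕ × ℕ × ℕ) (n : ℕ) => rp (ofNat ℚ n) * (p.2.2 + 1) + p.2.1 * (ofNat ℚ n).den
      = p.1 * (ofNat ℚ n).den + rn (ofNat ℚ n) * (p.2.2 + 1)) p n := by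
    intro p
    exact ⟨Denumerable.eqv ℚ (mkq p.1 p.2.1 p.2.2), (hiff _ _).2 ((Denumerable.eqv ℚ).symm_apply_apply _)⟩
  have hcomp := Computable.find (α := ℕ × ℕ × ℕ) (P := fun p n => rp (ofNat ℚ n) * (p.2.2 + 1) + p.2.1 * (ofNat ℚ n).den
      = p.1 * (ofNat ℚ n).den + rn (ofNat ℚ n) * (p.2.2 + 1)) (by
    have q : Computable fun p : (ℕ × ℕ × ℕ) × ℕ => ofNat ℚ p.2 := (Computable.ofNat ℚ).comp Computable.snd
    have a : Computable fun p : (ℕ × ℕ × ℕ) × ℕ => p.1.1 := Computable.fst.comp Computable.fst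
    have b : Computable fun p : (ℕ × ℕ × ℕ) × ℕ => p.1.2.1 := Computable.fst.comp (Computable.snd.comp Computable.fst)
    have c : Computable fun p : (ℕ × ℕ × ℕ) × ℕ => p.1.2.2 + 1 := Computable.succ.comp (Computable.snd.comp (Computable.snd.comp Computable.fst))
    have mul := Primrec.nat_mul.to_comp
    have add := Primrec.nat_add.to_comp
    exact Computable.computablePred (Primrec.eq.decide.to_comp.comp (add.comp (mul.comp (rp_comp.comp q) c) (mul.comp b (den_comp.comp q)))
      (add.comp (mul.comp a (den_comp.comp q)) (mul.comp (rn_comp.comp q) c)))) hex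
  refine ((Computable.ofNat ℚ).comp hcomp).of_eq ?_
  intro p
  exact (hiff _ _).1 (Nat.find_spec (hex p))

section ops
variable {α : Type*} [Primcodable α]

lemma nadd {f g : α → ℕ} (hf : Computable f) (hg : Computable g) : Computable fun a => f a + g a :=
  Primrec.nat_add.to_comp.comp hf hg
lemma nmul {f g : α → ℕ} (hf : Computable f) (hg : Computable g) : Computable fun a => f a * g a :=
  Primrec.nat_mul.to_comp.comp hf hg
lemma npow {f g : α → ℕ} (hf : Computable f) (hg : Computable g) : Computable fun a => f a ^ g a :=
  (Primrec₂.unpaired'.1 Nat.Primrec.pow).to_comp.comp hf hg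
lemma nlt {f g : α → ℕ} (hf : Computable f) (hg : Computable g) : Computable fun a => decide (f a < g a) :=
  Primrec.nat_lt.decide.to_comp.comp hf hg
lemma ceq {σ : Type*} [Primcodable σ] [DecidableEq σ] {f g : α → σ} (hf : Computable f) (hg : Computable g) :
    Computable fun a => decide (f a = g a) :=
  Primrec.eq.decide.to_comp.comp hf hg
lemma cand {p r : α → Prop} [DecidablePred p] [DecidablePred r] (hp : Computable fun a => decide (p a))
    (hr : Computable fun a => decide (r a)) : Computable fun a => decide (p a ∧ r a) := by
  refine (Primrec.and.to_comp.comp hp hr).of_eq ?_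
  intro a; simp
lemma cnot {p : α → Prop} [DecidablePred p] (hp : Computable fun a => decide (p a)) :
    Computable fun a => decide (¬ p a) := by
  refine (Primrec.not.to_comp.comp hp).of_eq ?_
  intro a; simp

lemma qdiv {f g h : α → ℕ} (hf : Computable f) (hg : Computable g) (hh : Computable h) :
    Computable fun a => ((f a : ℚ) - g a) / h a := by
  have h1 : Computable fun a => mkq (f a) (g a) (h a).pred :=
    Computable.comp (f := fun p : ℕ × ℕ × ℕ => mkq p.1 p.2.1 p.2.2)
      (g := fun a => (f a, g a, (h a).pred)) mkq_comp
      (Computable.pair hf (Computable.pair hg (Computable.comp (f := Nat.pred) Computable.pred hh)))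
  refine (cite (c := fun a => h a = 0) (ceq hh (Computable.const 0)) (Computable.const (0 : ℚ)) h1).of_eq ?_
  intro a
  by_cases h0 : h a = 0
  · simp [h0]
  · simp only [h0, if_false, mkq]
    have : (((h a).pred : ℕ) : ℚ) + 1 = h a := by
      rw [Nat.pred_eq_sub_one]
      have : 1 ≤ h a := by omega
      rw [Nat.cast_sub this]; simp
    rw [this]

lemma qneg {f : α → ℚ} (hf : Computable f) : Computable fun a => - f a := by
  refine (qdiv (rn_comp.comp hf) (rp_comp.comp hf) (den_comp.comp hf)).of_eq ?_
  intro a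
  conv_rhs => rw [rep (f a)]
  ring

lemma qadd {f g : α → ℚ} (hf : Computable f) (hg : Computable g) : Computable fun a => f a + g a := by
  have a1 := rp_comp.comp hf
  have a2 := rn_comp.comp hf
  have a3 := den_comp.comp hf
  have b1 := rp_comp.comp hg
  have b2 := rn_comp.comp hg
  have b3 := den_comp.comp hg
  refine (qdiv (nadd (nmul a1 b3) (nmul b1 a3)) (nadd (nmul a2 b3) (nmul b2 a3)) (nmul a3 b3)).of_eq ?_
  intro a
  have h1 : ((f a).den : ℚ) ≠ 0 := by exact_mod_cast (f a).den_nz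
  have h2 : ((g a).den : ℚ) ≠ 0 := by exact_mod_cast (g a).den_nz
  conv_rhs => rw [rep (f a), rep (g a)]
  push_cast
  field_simp
  ring

lemma qsub {f g : α → ℚ} (hf : Computable f) (hg : Computable g) : Computable fun a => f a - g a :=
  (qadd hf (qneg hg)).of_eq fun a => by ring

lemma qmul {f g : α → ℚ} (hf : Computable f) (hg : Computable g) : Computable fun a => f a * g a := by
  have a1 := rp_comp.comp hf
  have a2 := rn_comp.comp hf
  have a3 := den_comp.comp hf
  have b1 := rp_comp.comp hg
  have b2 := rn_comp.comp hg
  have b3 := den_comp.comp hg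
  refine (qdiv (nadd (nmul a1 b1) (nmul a2 b2)) (nadd (nmul a2 b1) (nmul a1 b2)) (nmul a3 b3)).of_eq ?_
  intro a
  have h1 : ((f a).den : ℚ) ≠ 0 := by exact_mod_cast (f a).den_nz
  have h2 : ((g a).den : ℚ) ≠ 0 := by exact_mod_cast (g a).den_nz
  conv_rhs => rw [rep (f a), rep (g a)]
  push_cast
  field_simp
  ring

lemma qlt {f g : α → ℚ} (hf : Computable f) (hg : Computable g) :
    Computable fun a => decide (f a < g a) := by
  have a1 := rp_comp.comp hf
  have a2 := rn_comp.comp hf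
  have a3 := den_comp.comp hf
  have b1 := rp_comp.comp hg
  have b2 := rn_comp.comp hg
  have b3 := den_comp.comp hg
  refine (nlt (nadd (nmul a1 b3) (nmul b2 a3)) (nadd (nmul b1 a3) (nmul a2 b3))).of_eq ?_
  intro a
  have h1 : (0 : ℚ) < ((f a).den : ℚ) := by exact_mod_cast (f a).den_pos
  have h2 : (0 : ℚ) < ((g a).den : ℚ) := by exact_mod_cast (g a).den_pos
  rw [decide_eq_decide]
  conv_rhs => rw [rep (f a), rep (g a)]
  rw [div_lt_div_iff₀ h1 h2, ← Nat.cast_lt (α := ℚ)]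
  push_cast
  constructor <;> intro h <;> linarith

lemma qle {f g : α → ℚ} (hf : Computable f) (hg : Computable g) :
    Computable fun a => decide (f a ≤ g a) :=
  (cnot (qlt hg hf)).of_eq fun a => by simp

lemma qpow {f : α → ℚ} {g : α → ℕ} (hf : Computable f) (hg : Computable g) :
    Computable fun a => f a ^ g a := by
  have := Computable.nat_rec (f := g) (g := fun _ : α => (1 : ℚ)) (h := fun a p => p.2 * f a) hg
    (Computable.const 1) (qmul (Computable.snd.comp Computable.snd) (hf.comp Computable.fst))
  refine this.of_eq ?_
  intro a
  induction g a with
  | zero => simp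
  | succ n ih => rw [pow_succ, ← ih]

lemma qsum {f : α → ℕ → ℚ} {g : α → ℕ} (hf : Computable₂ f) (hg : Computable g) :
    Computable fun a => ∑ i ∈ Finset.range (g a), f a i := by
  have := Computable.nat_rec (f := g) (g := fun _ : α => (0 : ℚ)) (h := fun a p => p.2 + f a p.1) hg
    (Computable.const 0) (qadd (Computable.snd.comp Computable.snd)
      (hf.comp Computable.fst (Computable.fst.comp Computable.snd)))
  refine this.of_eq ?_
  intro a
  induction g a with
  | zero => simp
  | succ n ih => rw [Finset.sum_range_succ, ← ih]

lemma qnat {f : α → ℕ} (hf : Computable f) : Computable fun a => (f a : ℚ) :=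
  (qdiv hf (Computable.const 0) (Computable.const 1)).of_eq fun a => by simp

/-- `2^(-k)` as a rational. -/
def hp (k : ℕ) : ℚ := (1 / 2 : ℚ) ^ k

lemma hp_comp {f : α → ℕ} (hf : Computable f) : Computable fun a => hp (f a) :=
  qpow (Computable.const _) hf

lemma qmax {f g : α → ℚ} (hf : Computable f) (hg : Computable g) :
    Computable fun a => max (f a) (g a) :=
  (cite (qle hf hg) hg hf).of_eq fun a => by rw [max_def]

end ops
end TsRat

namespace TsRat
open Encodable Denumerable

/-- Uniformly lower-semicomputable real functions. -/
def LSC {α : Type*} [Primcodable α] (φ : α → ℝ) : Prop :=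
  ∃ f : α → ℕ → ℚ, Computable₂ f ∧ (∀ a n, (f a n : ℝ) ≤ φ a) ∧
    ∀ a r, r < φ a → ∃ n, r < (f a n : ℝ)

section lsc
variable {α β : Type*} [Primcodable α] [Primcodable β]

/-- Running maximum. -/
def rmax (f : ℕ → ℚ) (n : ℕ) : ℚ := Nat.rec (f 0) (fun k IH => max IH (f (k + 1))) n

lemma rmax_succ (f : ℕ → ℚ) (n : ℕ) : rmax f (n + 1) = max (rmax f n) (f (n + 1)) := rfl

lemma rmax_mono (f : ℕ → ℚ) : Monotone (rmax f) :=
  monotone_nat_of_le_succ fun n => by rw [rmax_succ]; exact le_max_left _ _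

lemma le_rmax (f : ℕ → ℚ) (n : ℕ) : f n ≤ rmax f n := by
  cases n with
  | zero => exact le_rfl
  | succ n => rw [rmax_succ]; exact le_max_right _ _

lemma rmax_le (f : ℕ → ℚ) (b : ℝ) (h : ∀ n, (f n : ℝ) ≤ b) (n : ℕ) : (rmax f n : ℝ) ≤ b := by
  induction n with
  | zero => exact h 0
  | succ n ih => rw [rmax_succ]; push_cast; exact max_le ih (h _)

lemma rmax_comp {f : α → ℕ → ℚ} (hf : Computable₂ f) : Computable₂ fun a n => rmax (f a) n := by
  have := Computable.nat_rec (α := α × ℕ) (f := fun p => p.2) (g := fun p => f p.1 0)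
    (h := fun p z => max z.2 (f p.1 (z.1 + 1))) Computable.snd
    (hf.comp Computable.fst (Computable.const 0))
    (qmax (Computable.snd.comp Computable.snd)
      (hf.comp (Computable.fst.comp Computable.fst)
        (Computable.succ.comp (Computable.fst.comp Computable.snd))))
  exact this

lemma tendsto_of_mono {u : ℕ → ℝ} {b : ℝ} (hm : Monotone u) (hb : ∀ n, u n ≤ b)
    (hs : ∀ r < b, ∃ n, r < u n) : Tendsto u atTop (𝓝 b) := by
  apply tendsto_atTop_isLUB hm
  constructor
  · rintro _ ⟨n, rfl⟩; exact hb n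
  · intro c hc
    by_contra h
    push Not at h
    obtain ⟨n, hn⟩ := hs c h
    exact absurd (hc ⟨n, rfl⟩) (not_le.2 hn)

lemma LSC.mono {φ : α → ℝ} (h : LSC φ) : ∃ f : α → ℕ → ℚ, Computable₂ f ∧
    (∀ a, Monotone (f a)) ∧ (∀ a n, (f a n : ℝ) ≤ φ a) ∧
    ∀ a, Tendsto (fun n => (f a n : ℝ)) atTop (𝓝 (φ a)) := by
  obtain ⟨f, hf, hle, hex⟩ := h
  refine ⟨fun a n => rmax (f a) n, rmax_comp hf, fun a => rmax_mono _,
    fun a n => rmax_le _ _ (hle a) n, fun a => ?_⟩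
  refine tendsto_of_mono (fun m n hmn => ?_) (fun n => rmax_le _ _ (hle a) n) ?_
  · exact_mod_cast rmax_mono (f a) hmn
  · intro r hr
    obtain ⟨n, hn⟩ := hex a r hr
    exact ⟨n, hn.trans_le (by exact_mod_cast le_rmax (f a) n)⟩

lemma LSC.of_tendsto {φ : α → ℝ} (f : α → ℕ → ℚ) (hf : Computable₂ f)
    (hle : ∀ a n, (f a n : ℝ) ≤ φ a)
    (ht : ∀ a, Tendsto (fun n => (f a n : ℝ)) atTop (𝓝 (φ a))) : LSC φ :=
  ⟨f, hf, hle, fun a _ hr => ((ht a).eventually (lt_mem_nhds hr)).exists⟩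

lemma LSC.rat {f : α → ℚ} (hf : Computable f) : LSC fun a => (f a : ℝ) :=
  LSC.of_tendsto (fun a _ => f a) (hf.comp Computable.fst) (fun _ _ => le_rfl)
    fun _ => tendsto_const_nhds

lemma LSC.comp {φ : β → ℝ} (h : LSC φ) {g : α → β} (hg : Computable g) :
    LSC fun a => φ (g a) := by
  obtain ⟨f, hf, hle, hex⟩ := h
  exact ⟨fun a n => f (g a) n, hf.comp (hg.comp Computable.fst) Computable.snd,
    fun a n => hle _ _, fun a r hr => hex _ _ hr⟩

lemma LSC.add {φ ψ : α → ℝ} (h : LSC φ) (h' : LSC ψ) : LSC fun a => φ a + ψ a := by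
  obtain ⟨f, hf, -, hle, ht⟩ := h.mono
  obtain ⟨f', hf', -, hle', ht'⟩ := h'.mono
  refine LSC.of_tendsto (fun a n => f a n + f' a n) (qadd hf hf') ?_ ?_
  · intro a n; push_cast; exact add_le_add (hle a n) (hle' a n)
  · intro a; push_cast; exact (ht a).add (ht' a)

lemma LSC.mulRat {φ : α → ℝ} (h : LSC φ) {g : α → ℚ} (hg : Computable g) (h0 : ∀ a, 0 ≤ g a) :
    LSC fun a => (g a : ℝ) * φ a := by
  obtain ⟨f, hf, -, hle, ht⟩ := h.mono
  refine LSC.of_tendsto (fun a n => g a * f a n) (qmul (hg.comp Computable.fst) hf) ?_ ?_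
  · intro a n; push_cast
    exact mul_le_mul_of_nonneg_left (hle a n) (by exact_mod_cast h0 a)
  · intro a; push_cast; exact (ht a).const_mul _

lemma LSC.sum {φ : α × ℕ → ℝ} (h : LSC φ) :
    LSC fun p : α × ℕ => ∑ i ∈ Finset.range p.2, φ (p.1, i) := by
  obtain ⟨f, hf, -, hle, ht⟩ := h.mono
  refine LSC.of_tendsto (fun p n => ∑ i ∈ Finset.range p.2, f (p.1, i) n) ?_ ?_ ?_
  · refine qsum (α := (α × ℕ) × ℕ) (f := fun p i => f (p.1.1, i) p.2) (g := fun p => p.1.2) ?_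
      (Computable.snd.comp Computable.fst)
    exact hf.comp (Computable.pair (Computable.fst.comp (Computable.fst.comp Computable.fst)) Computable.snd)
      (Computable.snd.comp Computable.fst)
  · intro a n; push_cast; exact Finset.sum_le_sum fun i _ => hle _ _
  · intro a; push_cast; exact tendsto_finsetSum _ fun i _ => ht _

lemma LSC.sup {φ : α × ℕ → ℝ} (h : LSC φ) {ψ : α → ℝ} (hle : ∀ a n, φ (a, n) ≤ ψ a)
    (hs : ∀ a r, r < ψ a → ∃ n, r < φ (a, n)) : LSC ψ := by
  obtain ⟨f, hf, hfle, hex⟩ := h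
  refine ⟨fun a n => f (a, n.unpair.1) n.unpair.2, ?_, fun a n => (hfle _ _).trans (hle _ _), ?_⟩
  · exact hf.comp (Computable.pair Computable.fst (Computable.fst.comp (Computable.unpair.comp Computable.snd)))
      (Computable.snd.comp (Computable.unpair.comp Computable.snd))
  · intro a r hr
    obtain ⟨n, hn⟩ := hs a r hr
    obtain ⟨k, hk⟩ := hex _ _ hn
    exact ⟨Nat.pair n k, by simpa using hk⟩

lemma LSC.ite {c : α → Prop} [DecidablePred c] (hc : Computable fun a => decide (c a))
    {φ ψ : α → ℝ} (h : LSC φ) (h' : LSC ψ) : LSC fun a => if c a then φ a else ψ a := by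
  obtain ⟨f, hf, hle, hex⟩ := h
  obtain ⟨f', hf', hle', hex'⟩ := h'
  refine ⟨fun a n => if c a then f a n else f' a n, ?_, ?_, ?_⟩
  · exact cite (c := fun p : α × ℕ => c p.1) (hc.comp Computable.fst) hf hf'
  · intro a n; by_cases h : c a <;> simp [h, hle, hle']
  · intro a r; by_cases h : c a <;> simp only [h, if_true, if_false]
    · exact hex a r
    · exact hex' a r

lemma LSC.of_eq {φ ψ : α → ℝ} (h : LSC φ) (he : ∀ a, φ a = ψ a) : LSC ψ := by
  have : φ = ψ := funext he
  rwa [← this]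

end lsc
end TsRat

namespace TsRat
open Encodable Denumerable
open Encodable Denumerable
open Nat.Partrec (Code)
open Nat.Partrec.Code

def W (e n c k : ℕ) : Prop := (evaln n (ofNat Code e) (Nat.pair c k)).isSome = true

instance (e n c k : ℕ) : Decidable (W e n c k) := by unfold W; infer_instance

lemma W_mono {e n n' c k : ℕ} (h : n ≤ n') (hw : W e n c k) : W e n' c k := by
  unfold W at *
  obtain ⟨x, hx⟩ := Option.isSome_iff_exists.1 hw
  exact Option.isSome_iff_exists.2 ⟨x, evaln_mono h hx⟩

lemma W_lt {e n c k : ℕ} (hw : W e n c k) : c < n ∧ k < n := by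
  obtain ⟨x, hx⟩ := Option.isSome_iff_exists.1 hw
  have := evaln_bound hx
  exact ⟨(Nat.left_le_pair _ _).trans_lt this, (Nat.right_le_pair _ _).trans_lt this⟩

def mass (e n : ℕ) : ℚ :=
  ∑ c ∈ Finset.range n, ∑ k ∈ Finset.range n, if W e n c k then hp k else 0

lemma hp_pos (k : ℕ) : 0 < hp k := by unfold hp; positivity

def W' (e c k : ℕ) : Prop := ∃ n, mass e n ≤ 1 ∧ W e n c k

open Classical in
noncomputable def ind (e c k : ℕ) : ℝ := if W' e c k then (hp k : ℝ) else 0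

lemma ind_nonneg (e c k : ℕ) : 0 ≤ ind e c k := by
  unfold ind; split_ifs
  · exact_mod_cast (hp_pos k).le
  · exact le_rfl

lemma ind_mass (e : ℕ) (F : Finset ℕ) (K : ℕ) :
    ∑ c ∈ F, ∑ k ∈ Finset.range K, ind e c k ≤ 1 := by
  classical
  rw [← Finset.sum_product']
  set G := (F ×ˢ Finset.range K).filter fun p => W' e p.1 p.2 with hG
  have h1 : ∑ p ∈ F ×ˢ Finset.range K, ind e p.1 p.2 = ∑ p ∈ G, (hp p.2 : ℝ) := by
    rw [hG, Finset.sum_filter]; rfl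
  rw [h1]
  rcases G.eq_empty_or_nonempty with h0 | h0
  · rw [h0]; simp
  have hw : ∀ p : ℕ × ℕ, ∃ n, p ∈ G → mass e n ≤ 1 ∧ W e n p.1 p.2 := by
    intro p
    by_cases hp : p ∈ G
    · obtain ⟨n, hn⟩ := (Finset.mem_filter.1 hp).2
      exact ⟨n, fun _ => hn⟩
    · exact ⟨0, fun h => absurd h hp⟩
  choose N hN using hw
  obtain ⟨p₀, hp₀, hmax⟩ := Finset.exists_max_image G N h0
  have hm : mass e (N p₀) ≤ 1 := (hN p₀ hp₀).1
  have hall : ∀ p ∈ G, W e (N p₀) p.1 p.2 := fun p hp => W_mono (hmax p hp) (hN p hp).2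
  have : ∑ p ∈ G, hp p.2 ≤ mass e (N p₀) := by
    unfold mass
    rw [← Finset.sum_product' (f := fun c k => if W e (N p₀) c k then hp k else 0)]
    calc ∑ p ∈ G, hp p.2 = ∑ p ∈ G, if W e (N p₀) p.1 p.2 then hp p.2 else 0 :=
          Finset.sum_congr rfl fun p hp => by rw [if_pos (hall p hp)]
      _ ≤ _ := by
          refine Finset.sum_le_sum_of_subset_of_nonneg ?_ ?_
          · intro p hp
            have := W_lt (hall p hp)
            simp [this.1, this.2]
          · intro p _ _
            split_ifs
            · exact (hp_pos _).le
            · exact le_rfl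
  exact_mod_cast this.trans hm

lemma W_comp {α : Type*} [Primcodable α] {e n c k : α → ℕ} (he : Computable e) (hn : Computable n)
    (hc : Computable c) (hk : Computable k) :
    Computable fun a => decide (W (e a) (n a) (c a) (k a)) := by
  have h1 : Computable fun a => evaln (n a) (ofNat Code (e a)) (Nat.pair (c a) (k a)) :=
    primrec_evaln.to_comp.comp (Computable.pair (Computable.pair hn ((Computable.ofNat Code).comp he))
      (Primrec₂.natPair.to_comp.comp hc hk))
  refine (Primrec.option_isSome.to_comp.comp h1).of_eq ?_
  intro a
  rw [Bool.eq_iff_iff, decide_eq_true_iff]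
  exact Iff.rfl

lemma mass_comp : Computable fun p : ℕ × ℕ => mass p.1 p.2 := by
  unfold mass
  refine qsum (α := ℕ × ℕ) (f := fun p c => ∑ k ∈ Finset.range p.2, if W p.1 p.2 c k then hp k else 0)
    ?_ Computable.snd
  refine qsum (α := (ℕ × ℕ) × ℕ) (f := fun q k => if W q.1.1 q.1.2 q.2 k then hp k else 0)
    (g := fun q => q.1.2) ?_ (Computable.snd.comp Computable.fst)
  refine cite (α := ((ℕ × ℕ) × ℕ) × ℕ) (c := fun q => W q.1.1.1 q.1.1.2 q.1.2 q.2)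
    (W_comp ?_ ?_ ?_ ?_) (hp_comp Computable.snd) (Computable.const 0)
  · exact Computable.fst.comp (Computable.fst.comp Computable.fst)
  · exact Computable.snd.comp (Computable.fst.comp Computable.fst)
  · exact Computable.snd.comp Computable.fst
  · exact Computable.snd

/-- `ind` is lower semicomputable. -/
lemma ind_lsc : LSC fun p : ℕ × ℕ × ℕ => ind p.1 p.2.1 p.2.2 := by
  have h : LSC fun q : (ℕ × ℕ × ℕ) × ℕ =>
      (((if mass q.1.1 q.2 ≤ 1 ∧ W q.1.1 q.2 q.1.2.1 q.1.2.2 then hp q.1.2.2 else 0 : ℚ)) : ℝ) := by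
    apply LSC.rat
    have e : Computable fun q : (ℕ × ℕ × ℕ) × ℕ => q.1.1 := Computable.fst.comp Computable.fst
    have c : Computable fun q : (ℕ × ℕ × ℕ) × ℕ => q.1.2.1 := Computable.fst.comp (Computable.snd.comp Computable.fst)
    have k : Computable fun q : (ℕ × ℕ × ℕ) × ℕ => q.1.2.2 := Computable.snd.comp (Computable.snd.comp Computable.fst)
    have n : Computable fun q : (ℕ × ℕ × ℕ) × ℕ => q.2 := Computable.snd
    refine cite (cand (qle ?_ (Computable.const 1)) (W_comp e n c k)) (hp_comp k) (Computable.const 0)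
    exact Computable.comp (f := fun p : ℕ × ℕ => mass p.1 p.2) (g := fun q : (ℕ × ℕ × ℕ) × ℕ => (q.1.1, q.2)) mass_comp (Computable.pair e n)
  refine h.sup ?_ ?_
  · rintro ⟨e, c, k⟩ n
    simp only [ind]
    split_ifs with h1 h2 h2
    · exact le_rfl
    · exact absurd ⟨n, h1⟩ h2
    · push_cast; exact_mod_cast (hp_pos k).le
    · simp
  · rintro ⟨e, c, k⟩ r hr
    simp only [ind] at hr
    split_ifs at hr with h1
    · obtain ⟨n, hn⟩ := h1
      exact ⟨n, by simp only [hn, and_self, if_true]; exact hr⟩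
    · refine ⟨0, hr.trans_le ?_⟩
      split_ifs
      · exact_mod_cast (hp_pos k).le
      · simp

noncomputable def B (c K : ℕ) : ℝ :=
  ∑ e ∈ Finset.range K, (hp (e + 1) : ℝ) * ∑ k ∈ Finset.range K, ind e c k

lemma B_mono (c : ℕ) : Monotone (B c) := by
  intro K L h
  unfold B
  have hsub : Finset.range K ⊆ Finset.range L := Finset.range_mono h
  have hpn : ∀ e, (0 : ℝ) ≤ (hp (e + 1) : ℝ) := fun e => by exact_mod_cast (hp_pos _).le
  calc _ ≤ ∑ e ∈ Finset.range K, (hp (e + 1) : ℝ) * ∑ k ∈ Finset.range L, ind e c k := by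
        refine Finset.sum_le_sum fun e _ => mul_le_mul_of_nonneg_left ?_ (hpn e)
        exact Finset.sum_le_sum_of_subset_of_nonneg hsub fun _ _ _ => ind_nonneg _ _ _
    _ ≤ _ := Finset.sum_le_sum_of_subset_of_nonneg hsub fun e _ _ =>
        mul_nonneg (hpn e) (Finset.sum_nonneg fun _ _ => ind_nonneg _ _ _)

lemma hp_sum (K : ℕ) : ∑ e ∈ Finset.range K, (hp (e + 1) : ℝ) = 1 - hp K := by
  induction K with
  | zero => simp [hp]
  | succ K ih => rw [Finset.sum_range_succ, ih]; unfold hp; push_cast; ring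

lemma B_sum (F : Finset ℕ) (K : ℕ) : ∑ c ∈ F, B c K ≤ 1 := by
  unfold B
  rw [Finset.sum_comm]
  calc _ ≤ ∑ e ∈ Finset.range K, (hp (e + 1) : ℝ) := by
        refine Finset.sum_le_sum fun e _ => ?_
        rw [← Finset.mul_sum]
        have h0 : (0 : ℝ) ≤ (hp (e + 1) : ℝ) := by exact_mod_cast (hp_pos _).le
        nlinarith [ind_mass e F K]
    _ ≤ 1 := by
        rw [hp_sum]
        have : (0 : ℝ) ≤ (hp K : ℝ) := by exact_mod_cast (hp_pos _).le
        linarith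

noncomputable def mu (c : ℕ) : ℝ := ⨆ K, B c K

lemma B_bdd (c : ℕ) : BddAbove (Set.range (B c)) := by
  refine ⟨1, ?_⟩
  rintro _ ⟨K, rfl⟩
  simpa using B_sum {c} K

lemma B_le_mu (c K : ℕ) : B c K ≤ mu c := le_ciSup (B_bdd c) K

lemma B_tendsto (c : ℕ) : Tendsto (B c) atTop (𝓝 (mu c)) :=
  tendsto_atTop_ciSup (B_mono c) (B_bdd c)

lemma mu_nonneg (c : ℕ) : 0 ≤ mu c := by
  have := B_le_mu c 0
  simpa [B] using this

lemma mu_sum (F : Finset ℕ) : ∑ c ∈ F, mu c ≤ 1 :=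
  le_of_tendsto' (tendsto_finsetSum F fun c _ => B_tendsto c) (B_sum F)

lemma B_lsc : LSC fun p : ℕ × ℕ => B p.1 p.2 := by
  -- innermost index: (((c, K), e), k)
  have h1 : LSC fun q : ((ℕ × ℕ) × ℕ) × ℕ => ind q.1.2 q.1.1.1 q.2 :=
    ind_lsc.comp (g := fun q : ((ℕ × ℕ) × ℕ) × ℕ => (q.1.2, q.1.1.1, q.2))
      (Computable.pair (Computable.snd.comp Computable.fst)
        (Computable.pair (Computable.fst.comp (Computable.fst.comp Computable.fst)) Computable.snd))
  have h2 : LSC fun q : (ℕ × ℕ) × ℕ => ∑ k ∈ Finset.range q.1.2, ind q.2 q.1.1 k :=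
    h1.sum.comp (g := fun q : (ℕ × ℕ) × ℕ => (q, q.1.2))
      (Computable.pair Computable.id (Computable.snd.comp Computable.fst))
  have h3 := h2.mulRat (g := fun q : (ℕ × ℕ) × ℕ => hp (q.2 + 1))
    (hp_comp (Computable.succ.comp Computable.snd)) (fun _ => (hp_pos _).le)
  exact h3.sum.comp (g := fun q : ℕ × ℕ => (q, q.2)) (Computable.pair Computable.id Computable.snd)

lemma mu_lsc : LSC mu :=
  B_lsc.sup (fun c K => B_le_mu c K) fun c _ hr =>
    ((B_tendsto c).eventually (lt_mem_nhds hr)).exists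

/-! ### Domination -/

lemma geom_bound (ρ : ℝ) (n : ℕ) :
    (∑ k ∈ Finset.range n, if 2 * (hp k : ℝ) < ρ then (hp k : ℝ) else 0) ≤ max 0 (ρ - 2 * hp n) := by
  induction n with
  | zero => simp
  | succ n ih =>
    rw [Finset.sum_range_succ]
    have h2 : (hp n : ℝ) = 2 * hp (n + 1) := by unfold hp; push_cast; ring
    split_ifs with h
    · rw [max_eq_right (by linarith)] at ih
      refine le_trans ?_ (le_max_right _ _)
      linarith
    · rw [max_eq_left (by linarith)] at ih
      refine le_trans ?_ (le_max_left _ _)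
      linarith

lemma geom_bound' {ρ : ℝ} (h : 0 ≤ ρ) (n : ℕ) :
    (∑ k ∈ Finset.range n, if 2 * (hp k : ℝ) < ρ then (hp k : ℝ) else 0) ≤ ρ := by
  refine (geom_bound ρ n).trans (max_le h ?_)
  have : (0 : ℝ) < (hp n : ℝ) := by exact_mod_cast hp_pos n
  linarith

/-- The weight of a code of a string, `0` for non-codes. -/
noncomputable def push (r : Str → ℝ) (c : ℕ) : ℝ := ((decode₂ Str c).map r).getD 0

lemma push_encode (r : Str → ℝ) (s : Str) : push r (encode s) = r s := by
  simp [push]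

lemma push_none (r : Str → ℝ) (c : ℕ) (h : c ∉ Set.range (encode : Str → ℕ)) : push r c = 0 := by
  have : decode₂ Str c = none := by
    by_contra hc
    exact h (decode₂_ne_none_iff.1 hc)
  simp [push, this]

lemma push_sum_range {r : Str → ℝ} (hr : SemiMeasure r) (n : ℕ) :
    ∑ c ∈ Finset.range n, push r c ≤ 1 := by
  classical
  have := Finset.sum_preimage (encode : Str → ℕ) (Finset.range n) encode_injective.injOn (push r)
    (fun c _ h => push_none r c h)
  rw [← this]
  simp only [push_encode]
  exact hr.2 _

lemma exists_index {r : Str → ℝ} (hr : LCSemiMeasure r) :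
    ∃ e : ℕ, ∀ c k, (∃ n, W e n c k) ↔ 2 * (hp k : ℝ) < push r c := by
  obtain ⟨hsm, f, hf, hfr⟩ := hr
  let D : ℕ → ℕ → Bool := fun p n =>
    Option.casesOn (decode₂ Str p.unpair.1) false (fun s => decide (2 * hp p.unpair.2 < f n s))
  have hD : Computable₂ D := by
    have hp1 : Computable fun q : ℕ × ℕ => q.1.unpair := Computable.unpair.comp Computable.fst
    refine Computable.option_casesOn (α := ℕ × ℕ) (o := fun q => decode₂ Str q.1.unpair.1)
      (f := fun _ => false) (g := fun q s => decide (2 * hp q.1.unpair.2 < f q.2 s))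
      (Primrec.decode₂.to_comp.comp (Computable.fst.comp hp1)) (Computable.const _) ?_
    refine qlt (qmul (Computable.const 2) (hp_comp ?_)) (hf.comp ?_ Computable.snd)
    · exact Computable.snd.comp (hp1.comp Computable.fst)
    · exact Computable.snd.comp Computable.fst
  have hg : Nat.Partrec fun p => Nat.rfind fun n => Part.some (D p n) :=
    Partrec.nat_iff.1 (Partrec.rfind (p := fun p n => Part.some (D p n)) hD.partrec₂)
  obtain ⟨code, hcode⟩ := exists_code.1 hg
  refine ⟨encode code, fun c k => ?_⟩
  have h1 : (∃ n, W (encode code) n c k) ↔ (eval code (Nat.pair c k)).Dom := by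
    rw [Part.dom_iff_mem]
    constructor
    · rintro ⟨n, hn⟩
      unfold W at hn
      rw [ofNat_encode] at hn
      obtain ⟨x, hx⟩ := Option.isSome_iff_exists.1 hn
      exact ⟨x, evaln_sound hx⟩
    · rintro ⟨x, hx⟩
      obtain ⟨n, hn⟩ := evaln_complete.1 hx
      refine ⟨n, ?_⟩
      unfold W
      rw [ofNat_encode]
      exact Option.isSome_iff_exists.2 ⟨x, hn⟩
  rw [h1, hcode]
  have h2 : (Nat.rfind fun n => Part.some (D (Nat.pair c k) n)).Dom ↔ ∃ n, D (Nat.pair c k) n = true := by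
    refine (Nat.rfind_dom (p := fun n => Part.some (D (Nat.pair c k) n))).trans ?_
    constructor
    · rintro ⟨n, hn, -⟩
      exact ⟨n, (Part.mem_some_iff.1 hn).symm⟩
    · rintro ⟨n, hn⟩
      exact ⟨n, Part.mem_some_iff.2 hn.symm, fun _ => trivial⟩
  refine h2.trans ?_
  by_cases hc : c ∈ Set.range (encode : Str → ℕ)
  · obtain ⟨s, rfl⟩ := hc
    rw [push_encode]
    have : ∀ n, D (Nat.pair (encode s) k) n = decide (2 * hp k < f n s) := by
      intro n; simp only [D, Nat.unpair_pair, encodek₂]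
    simp only [this, decide_eq_true_eq]
    constructor
    · rintro ⟨n, hn⟩
      have hn' : 2 * (hp k : ℝ) < (f n s : ℝ) := by exact_mod_cast hn
      exact hn'.trans_le ((hfr s).1 n).2
    · intro h
      obtain ⟨n, hn⟩ := ((hfr s).2.eventually (lt_mem_nhds h)).exists
      exact ⟨n, by exact_mod_cast hn⟩
  · have hd : decode₂ Str c = none := by
      by_contra h
      exact hc (decode₂_ne_none_iff.1 h)
    rw [push_none r c hc]
    have : ∀ n, D (Nat.pair c k) n = false := by
      intro n; simp only [D, Nat.unpair_pair, hd]
    simp only [this]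
    have h0 : (0 : ℝ) < (hp k : ℝ) := by exact_mod_cast hp_pos k
    constructor
    · rintro ⟨n, hn⟩; simp at hn
    · intro h; linarith

lemma dominate {r : Str → ℝ} (hr : LCSemiMeasure r) :
    ∃ c : ℝ, 0 < c ∧ ∀ s, c * r s ≤ mu (encode s) := by
  classical
  obtain ⟨e, he⟩ := exists_index hr
  have hnn : ∀ c, 0 ≤ push r c := by
    intro c
    by_cases hc : c ∈ Set.range (encode : Str → ℕ)
    · obtain ⟨s, rfl⟩ := hc
      rw [push_encode]; exact (hr.1.1 s).1
    · rw [push_none r c hc]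
  have hok : ∀ n, mass e n ≤ 1 := by
    intro n
    have : (mass e n : ℝ) ≤ 1 := by
      unfold mass
      push_cast
      refine le_trans (Finset.sum_le_sum fun c _ => ?_) (push_sum_range hr.1 n)
      refine le_trans (Finset.sum_le_sum fun k _ => ?_) (geom_bound' (hnn c) n)
      have h0 : (0 : ℝ) ≤ (hp k : ℝ) := by exact_mod_cast (hp_pos k).le
      split_ifs with h1 h2 h2
      · exact le_rfl
      · exact absurd ((he c k).1 ⟨n, h1⟩) h2
      · exact_mod_cast h0
      · simp
    exact_mod_cast this
  have hpe : (0 : ℝ) < (hp (e + 1) : ℝ) := by exact_mod_cast hp_pos _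
  refine ⟨hp (e + 1) / 4, by positivity, fun s => ?_⟩
  rcases (hr.1.1 s).1.eq_or_lt with h0 | h0
  · rw [← h0]; simpa using mu_nonneg _
  obtain ⟨k, hk1, hk2⟩ := exists_nat_pow_near_of_lt_one (x := r s / 2) (y := (1 / 2 : ℝ)) (by linarith)
    (by linarith [(hr.1.1 s).2]) (by norm_num) (by norm_num)
  have hh : ∀ j, (hp j : ℝ) = (1 / 2 : ℝ) ^ j := by intro j; unfold hp; push_cast; rfl
  rw [← hh] at hk1 hk2
  have h3 : (hp k : ℝ) = 2 * hp (k + 1) := by unfold hp; push_cast; ring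
  obtain ⟨n, hn⟩ := (he (encode s) (k + 1)).2 (by rw [push_encode]; linarith)
  have hind : ind e (encode s) (k + 1) = hp (k + 1) := by
    unfold ind; rw [if_pos ⟨n, hok n, hn⟩]
  refine le_trans ?_ (B_le_mu (encode s) (e + k + 2))
  unfold B
  have hB : (hp (e + 1) : ℝ) * ind e (encode s) (k + 1) ≤ ∑ e' ∈ Finset.range (e + k + 2), (hp (e' + 1) : ℝ) * ∑ k' ∈ Finset.range (e + k + 2), ind e' (encode s) k' := by
    refine le_trans ?_ (Finset.single_le_sum (f := fun e' => (hp (e' + 1) : ℝ) * ∑ k' ∈ Finset.range (e + k + 2), ind e' (encode s) k') (fun e' _ => ?_) (Finset.mem_range.2 (show e < e + k + 2 by omega)))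
    · refine mul_le_mul_of_nonneg_left ?_ hpe.le
      exact Finset.single_le_sum (f := fun k' => ind e (encode s) k') (fun _ _ => ind_nonneg _ _ _) (Finset.mem_range.2 (by omega))
    · refine mul_nonneg (by exact_mod_cast (hp_pos _).le) (Finset.sum_nonneg fun _ _ => ind_nonneg _ _ _)
  refine le_trans ?_ hB
  rw [hind]
  nlinarith

lemma mu_pos (s₀ : Str) : 0 < mu (encode s₀) := by
  have hr : LCSemiMeasure fun s => if s = s₀ then 1 else 0 := by
    refine ⟨⟨fun s => ?_, fun F => ?_⟩, fun _ s => if s = s₀ then 1 else 0, ?_, fun s => ⟨fun n => ?_, ?_⟩⟩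
    · dsimp only
      split_ifs <;> norm_num
    · rw [Finset.sum_ite_eq']; split_ifs <;> norm_num
    · exact cite (ceq Computable.snd (Computable.const s₀)) (Computable.const 1) (Computable.const 0)
    · dsimp only
      split_ifs <;> norm_num
    · dsimp only
      split_ifs <;> simp
  obtain ⟨c, hc, h⟩ := dominate hr
  have := h s₀
  simp at this
  linarith

lemma mu_str_sum (F : Finset Str) : ∑ s ∈ F, mu (encode s) ≤ 1 := by
  classical
  have := mu_sum (F.image encode)
  rwa [Finset.sum_image (fun _ _ _ _ h => encode_injective h)] at this

end TsRat

namespace TsRat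
open Encodable Denumerable
open Encodable Denumerable

lemma hp_real (k : ℕ) : (hp k : ℝ) = (2 : ℝ)⁻¹ ^ k := by unfold hp; push_cast; norm_num

lemma ofNat_surj (c : ℚ) : ∃ n, ofNat ℚ n = c :=
  ⟨Denumerable.eqv ℚ c, (Denumerable.eqv ℚ).symm_apply_apply c⟩

lemma pow_valid {q : ℝ} {t c : ℚ} {a b : ℕ} (ht0 : 0 < t) (ht1 : t < 1) (hb : 0 < b)
    (hc : 0 ≤ c) (hab : (a : ℝ) ≤ b * q) (h : t ^ a ≤ c ^ b) : (t : ℝ) ^ q ≤ c := by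
  have ht0' : (0 : ℝ) < t := by exact_mod_cast ht0
  have ht1' : (t : ℝ) < 1 := by exact_mod_cast ht1
  have hc' : (0 : ℝ) ≤ c := by exact_mod_cast hc
  refine le_of_pow_le_pow_left₀ hb.ne' hc' ?_
  have h1 : ((t : ℝ) ^ q) ^ b = (t : ℝ) ^ (b * q) := by
    rw [← Real.rpow_natCast, ← Real.rpow_mul ht0'.le, mul_comm]
  rw [h1]
  calc (t : ℝ) ^ (b * q) ≤ (t : ℝ) ^ (a : ℝ) := Real.rpow_le_rpow_of_exponent_ge ht0' ht1'.le hab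
    _ = (t : ℝ) ^ a := Real.rpow_natCast _ _
    _ ≤ (c : ℝ) ^ b := by exact_mod_cast h

lemma pow_reach {q : ℝ} (hq : 1 < q) {t c : ℚ} (ht0 : 0 < t) (h : (t : ℝ) ^ q < c) :
    ∃ a b : ℕ, 0 < b ∧ (a : ℝ) < b * q ∧ t ^ a ≤ c ^ b := by
  have ht0' : (0 : ℝ) < t := by exact_mod_cast ht0
  have hcont : Tendsto (fun z : ℝ => (t : ℝ) ^ z) (𝓝 q) (𝓝 ((t : ℝ) ^ q)) :=
    (Real.continuousAt_const_rpow ht0'.ne').tendsto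
  obtain ⟨δ, hδ, hball⟩ := Metric.eventually_nhds_iff.1 (hcont.eventually (gt_mem_nhds h))
  obtain ⟨z, hz1, hz2⟩ := exists_rat_btwn (show max 0 (q - δ) < q from max_lt (by linarith) (by linarith))
  have hz0 : (0 : ℝ) < z := (le_max_left _ _).trans_lt hz1
  have hzδ : q - δ < z := (le_max_right _ _).trans_lt hz1
  have hlt := hball (y := (z : ℝ)) (by rw [Real.dist_eq, abs_lt]; constructor <;> linarith)
  have hz0' : 0 < z := by exact_mod_cast hz0
  have hnum : (z.num.toNat : ℤ) = z.num := Int.toNat_of_nonneg (Rat.num_pos.2 hz0').le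
  have hzq : (z.num.toNat : ℚ) = z.den * z := by
    rw [mul_comm, Rat.mul_den_eq_num]; exact_mod_cast hnum
  have hzr : (z.num.toNat : ℝ) = z.den * z := by exact_mod_cast hzq
  have hden : (0 : ℝ) < z.den := by exact_mod_cast z.den_pos
  refine ⟨z.num.toNat, z.den, z.den_pos, ?_, ?_⟩
  · rw [hzr]; exact mul_lt_mul_of_pos_left hz2 hden
  · have h2 : (t : ℝ) ^ z.num.toNat ≤ (c : ℝ) ^ z.den := by
      rw [← Real.rpow_natCast, hzr, mul_comm, Real.rpow_mul ht0'.le, Real.rpow_natCast]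
      exact pow_le_pow_left₀ (Real.rpow_nonneg ht0'.le _) hlt.le _
    exact_mod_cast h2

lemma mid_lsc {q : ℝ} (hqc : ComputableReal q) (hq : 1 < q) :
    LSC fun t : ℚ => if 0 < t ∧ t < 1 then -((t : ℝ) ^ q) else -1 := by
  obtain ⟨g, hg, hgq⟩ := hqc
  have hgl : ∀ k, (g k : ℝ) - hp k < q ∧ q < g k + hp k := by
    intro k
    have := hgq k
    rw [← hp_real, abs_lt] at this
    constructor <;> linarith
  let A : ℕ → ℕ := fun i => i.unpair.1.unpair.1
  let Bb : ℕ → ℕ := fun i => i.unpair.1.unpair.2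
  let K : ℕ → ℕ := fun i => i.unpair.2.unpair.1
  let C : ℕ → ℚ := fun i => ofNat ℚ i.unpair.2.unpair.2
  have hA : Computable A := Computable.fst.comp (Computable.unpair.comp (Computable.fst.comp Computable.unpair))
  have hB : Computable Bb := Computable.snd.comp (Computable.unpair.comp (Computable.fst.comp Computable.unpair))
  have hK : Computable K := Computable.fst.comp (Computable.unpair.comp (Computable.snd.comp Computable.unpair))
  have hC : Computable C := (Computable.ofNat ℚ).comp (Computable.snd.comp (Computable.unpair.comp (Computable.snd.comp Computable.unpair)))
  refine ⟨fun t i => if (0 < t ∧ t < 1) ∧ (0 < Bb i ∧ (0 ≤ C i ∧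
    ((A i : ℚ) ≤ Bb i * (g (K i) - hp (K i)) ∧ t ^ A i ≤ C i ^ Bb i))) ∧ C i ≤ 1 then - C i else -1, ?_, ?_, ?_⟩
  · have t1 : Computable fun p : ℚ × ℕ => p.1 := Computable.fst
    have a1 : Computable fun p : ℚ × ℕ => A p.2 := hA.comp Computable.snd
    have b1 : Computable fun p : ℚ × ℕ => Bb p.2 := hB.comp Computable.snd
    have k1 : Computable fun p : ℚ × ℕ => K p.2 := hK.comp Computable.snd
    have c1 : Computable fun p : ℚ × ℕ => C p.2 := hC.comp Computable.snd
    refine cite (α := ℚ × ℕ) (cand (cand (qlt (Computable.const 0) t1) (qlt t1 (Computable.const 1)))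
      (cand (cand (nlt (Computable.const 0) b1) (cand (qle (Computable.const 0) c1)
        (cand (qle (qnat a1) (qmul (qnat b1) (qsub (hg.comp k1) (hp_comp k1)))) (qle (qpow t1 a1) (qpow c1 b1)))))
        (qle c1 (Computable.const 1)))) (qneg c1) (Computable.const (-1))
  · intro t i
    dsimp only
    split_ifs with h1 h2 h2
    · obtain ⟨-, ⟨hb, hc, hab, hp⟩, -⟩ := h1
      push_cast
      refine neg_le_neg (pow_valid h2.1 h2.2 hb hc ?_ hp)
      have hab' : (A i : ℝ) ≤ Bb i * (g (K i) - TsRat.hp (K i)) := by exact_mod_cast hab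
      refine hab'.trans (mul_le_mul_of_nonneg_left (hgl _).1.le (Nat.cast_nonneg _))
    · exact absurd h1.1 h2
    · push_cast
      refine neg_le_neg (Real.rpow_le_one ?_ ?_ (by linarith))
      · exact_mod_cast h2.1.le
      · exact_mod_cast h2.2.le
    · push_cast; exact le_rfl
  · intro t r hr
    dsimp only at hr ⊢
    split_ifs at hr with h
    · by_cases hr1 : r < -1
      · refine ⟨0, hr1.trans_le ?_⟩
        split_ifs with h'
        · have : -1 ≤ - C 0 := by linarith [h'.2.2]
          exact_mod_cast this
        · simp
      obtain ⟨c, hc1, hc2⟩ := exists_rat_btwn (show (t : ℝ) ^ q < -r by linarith)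
      have ht0 : (0 : ℝ) < t := by exact_mod_cast h.1
      have hc0 : 0 ≤ c := by
        have : (0 : ℝ) ≤ c := (Real.rpow_nonneg ht0.le q).trans hc1.le
        exact_mod_cast this
      have hcle : c ≤ 1 := by
        have : (c : ℝ) ≤ 1 := by linarith
        exact_mod_cast this
      obtain ⟨a, b, hb, hab, hp⟩ := pow_reach hq h.1 hc1
      have hb' : (0 : ℝ) < b := by exact_mod_cast hb
      obtain ⟨k, hk⟩ := exists_pow_lt_of_lt_one (show 0 < (q - a / b) / 2 by
        have : (a : ℝ) / b < q := by rw [div_lt_iff₀ hb']; linarith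
        linarith) (show (2 : ℝ)⁻¹ < 1 by norm_num)
      rw [← hp_real] at hk
      obtain ⟨n, hn⟩ := ofNat_surj c
      refine ⟨Nat.pair (Nat.pair a b) (Nat.pair k n), ?_⟩
      have hcond : (a : ℚ) ≤ b * (g k - TsRat.hp k) := by
        have : (a : ℝ) ≤ b * (g k - TsRat.hp k) := by
          have h1 : (a : ℝ) / b ≤ g k - TsRat.hp k := by linarith [(hgl k).2]
          rw [div_le_iff₀ hb'] at h1; linarith
        exact_mod_cast this
      simp only [A, Bb, K, C, Nat.unpair_pair, hn]
      rw [if_pos ⟨h, ⟨hb, hc0, hcond, hp⟩, hcle⟩]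
      push_cast; linarith
    · exact ⟨0, by rw [if_neg (fun h' => h h'.1)]; push_cast; exact hr⟩

/-- clip to `[0,1]` -/
def clip (t : ℚ) : ℚ := if 0 < t then (if t < 1 then t else 1) else 0

lemma clip_comp : Computable clip :=
  cite (qlt (Computable.const 0) Computable.id)
    (cite (qlt Computable.id (Computable.const 1)) Computable.id (Computable.const 1)) (Computable.const 0)

lemma clip_eq {t : ℚ} (h0 : 0 ≤ t) (h1 : t ≤ 1) : clip t = t := by
  unfold clip; split_ifs <;> linarith

noncomputable def G (q u : ℝ) : ℝ := u - u ^ q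

lemma G_clip_lsc {q : ℝ} (hqc : ComputableReal q) (hq : 1 < q) :
    LSC fun t : ℚ => G q (clip t) := by
  have h := (LSC.rat clip_comp).add
    (LSC.ite (qlt (Computable.const 0) Computable.id) (mid_lsc hqc hq) (LSC.rat (Computable.const 0)))
  refine h.of_eq fun t => ?_
  unfold G clip
  simp only [id]
  by_cases h0 : 0 < t
  · by_cases h1 : t < 1
    · simp [h0, h1]; ring
    · simp [h0, h1]
  · simp [h0, Real.zero_rpow (show q ≠ 0 by linarith)]

end TsRat

namespace TsRat
open Encodable Denumerable
open Encodable Denumerable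

section analysis
variable {q : ℝ}

lemma G_cont (hq : 1 < q) : Continuous (G q) :=
  continuous_id.sub (Real.continuous_rpow_const (by linarith))

lemma G_zero (hq : 1 < q) : G q 0 = 0 := by
  unfold G; rw [Real.zero_rpow (by linarith)]; ring

lemma G_one : G q 1 = 0 := by simp [G]

lemma G_nonneg (hq : 1 < q) {u : ℝ} (h0 : 0 ≤ u) (h1 : u ≤ 1) : 0 ≤ G q u := by
  unfold G
  have := Real.rpow_le_rpow_of_exponent_ge' h0 h1 zero_le_one hq.le
  rw [Real.rpow_one] at this
  linarith

lemma G_le {u : ℝ} (h0 : 0 ≤ u) : G q u ≤ u := by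
  unfold G; linarith [Real.rpow_nonneg h0 q]

lemma G_pos (hq : 1 < q) {u : ℝ} (h0 : 0 < u) (h1 : u < 1) : 0 < G q u := by
  unfold G
  have := Real.rpow_lt_rpow_of_exponent_gt h0 h1 hq
  rw [Real.rpow_one] at this
  linarith

lemma G_bern (hq : 1 < q) {u : ℝ} (h0 : 0 ≤ u) : G q u ≤ (q - 1) * (1 - u) := by
  have := one_add_mul_self_le_rpow_one_add (s := u - 1) (by linarith) hq.le
  rw [show 1 + (u - 1) = u by ring] at this
  unfold G; linarith

lemma G_deriv (hq : 1 < q) (u : ℝ) : HasDerivAt (G q) (1 - q * u ^ (q - 1)) u :=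
  (hasDerivAt_id u).sub (Real.hasDerivAt_rpow_const (Or.inr hq.le))

/-- maximiser -/
noncomputable def xs (q : ℝ) : ℝ := q ^ (1 / (1 - q))

lemma xs_pos (hq : 1 < q) : 0 < xs q := Real.rpow_pos_of_pos (by linarith) _

lemma xs_lt_one (hq : 1 < q) : xs q < 1 :=
  Real.rpow_lt_one_of_one_lt_of_neg hq (div_neg_of_pos_of_neg one_pos (by linarith))

lemma xs_pow (hq : 1 < q) : q * xs q ^ (q - 1) = 1 := by
  unfold xs
  have h : (1 - q) ≠ 0 := by linarith
  rw [← Real.rpow_mul (by linarith), show 1 / (1 - q) * (q - 1) = -1 by field_simp; ring,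
    Real.rpow_neg_one]
  exact mul_inv_cancel₀ (by linarith)

lemma G_xs (hq : 1 < q) : G q (xs q) = (q - 1) * q ^ (q / (1 - q)) := by
  have h : (1 - q) ≠ 0 := by linarith
  have hq0 : 0 < q := by linarith
  have e1 : q ^ (q / (1 - q)) = xs q / q := by
    unfold xs
    rw [show q / (1 - q) = 1 / (1 - q) - 1 by field_simp; ring, Real.rpow_sub_one hq0.ne']
  have e2 : xs q ^ q = xs q / q := by
    have := xs_pow hq
    have h3 : xs q ^ q = xs q ^ (q - 1) * xs q := by
      rw [Real.rpow_sub_one (xs_pos hq).ne', div_mul_cancel₀ _ (xs_pos hq).ne']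
    rw [h3, eq_div_iff hq0.ne']
    linear_combination xs q * this
  rw [e1]; unfold G; rw [e2]; field_simp

lemma G_mono (hq : 1 < q) : StrictMonoOn (G q) (Set.Icc 0 (xs q)) := by
  refine strictMonoOn_of_deriv_pos (convex_Icc _ _) (G_cont hq).continuousOn ?_
  intro u hu
  rw [interior_Icc] at hu
  rw [(G_deriv hq u).deriv]
  have := Real.rpow_lt_rpow hu.1.le hu.2 (show 0 < q - 1 by linarith)
  nlinarith [xs_pow hq]

lemma G_anti (hq : 1 < q) : StrictAntiOn (G q) (Set.Icc (xs q) 1) := by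
  refine strictAntiOn_of_deriv_neg (convex_Icc _ _) (G_cont hq).continuousOn ?_
  intro u hu
  rw [interior_Icc] at hu
  rw [(G_deriv hq u).deriv]
  have := Real.rpow_lt_rpow (xs_pos hq).le hu.1 (show 0 < q - 1 by linarith)
  nlinarith [xs_pow hq]

end analysis

lemma clip_cast (t : ℚ) : (clip t : ℝ) = max 0 (min (t : ℝ) 1) := by
  have : clip t = max 0 (min t 1) := by
    unfold clip
    split_ifs with h1 h2
    · rw [min_eq_left h2.le, max_eq_right h1.le]
    · rw [min_eq_right (by linarith)]; norm_num
    · rw [min_eq_left (by linarith), max_eq_left (by linarith)]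
  rw [this]; push_cast; rfl

lemma mu_le_one (c : ℕ) : mu c ≤ 1 := by simpa using mu_sum {c}

lemma Gmu_lsc {q : ℝ} (hqc : ComputableReal q) (hq : 1 < q) (j : ℕ) (hj : (hp j : ℝ) ≤ xs q) :
    LSC fun c : ℕ => G q (hp j * mu c) := by
  have hj0 : (0 : ℝ) < hp j := by exact_mod_cast hp_pos j
  obtain ⟨f, hf, -, hle, ht⟩ :=
    (mu_lsc.mulRat (g := fun _ => hp j) (Computable.const _) (fun _ => (hp_pos j).le)).mono
  have hu0 : ∀ c, 0 ≤ (hp j : ℝ) * mu c := fun c => mul_nonneg hj0.le (mu_nonneg c)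
  have hu1 : ∀ c, (hp j : ℝ) * mu c ≤ xs q := fun c => by nlinarith [mu_le_one c]
  have hx1 := xs_lt_one hq
  have h := (G_clip_lsc hqc hq).comp (g := fun p : ℕ × ℕ => f p.1 p.2) hf
  refine h.sup ?_ ?_
  · intro c n
    have hc : ((clip (f c n) : ℚ) : ℝ) ≤ hp j * mu c := by
      rw [clip_cast]
      exact max_le (hu0 c) ((min_le_left _ _).trans (hle c n))
    have hc0 : (0 : ℝ) ≤ (clip (f c n) : ℚ) := by rw [clip_cast]; exact le_max_left _ _
    exact (G_mono hq).monotoneOn ⟨hc0, hc.trans (hu1 c)⟩ ⟨hu0 c, hu1 c⟩ hc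
  · intro c r hr
    have : Tendsto (fun n => G q (clip (f c n) : ℚ)) atTop (𝓝 (G q (hp j * mu c))) := by
      refine ((G_cont hq).tendsto _).comp ?_
      simp only [clip_cast]
      have h2 := (tendsto_const_nhds (x := (0 : ℝ))).max ((ht c).min (tendsto_const_nhds (x := (1 : ℝ))))
      rwa [min_eq_left (by linarith [hu1 c]), max_eq_right (hu0 c)] at h2
    exact (this.eventually (lt_mem_nhds hr)).exists

open Classical in
noncomputable def hh (q ε : ℝ) (s : Str) : ℝ := if s = [] then 0 else G q (ε * mu (encode s))

section
variable {q : ℝ} {ε : ℝ}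

lemma hh_nonneg (hq : 1 < q) (h0 : 0 < ε) (h1 : ε < 1) (s : Str) : 0 ≤ hh q ε s := by
  unfold hh
  split_ifs
  · exact le_rfl
  · exact G_nonneg hq (mul_nonneg h0.le (mu_nonneg _)) (by nlinarith [mu_le_one (encode s), mu_nonneg (encode s)])

lemma hh_sum (h0 : 0 < ε) (F : Finset Str) : ∑ s ∈ F, hh q ε s ≤ ε := by
  calc _ ≤ ∑ s ∈ F, ε * mu (encode s) := by
        refine Finset.sum_le_sum fun s _ => ?_
        unfold hh
        split_ifs
        · exact mul_nonneg h0.le (mu_nonneg _)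
        · exact G_le (mul_nonneg h0.le (mu_nonneg _))
    _ = ε * ∑ s ∈ F, mu (encode s) := by rw [Finset.mul_sum]
    _ ≤ ε := by nlinarith [mu_str_sum F]

lemma hh_summable (hq : 1 < q) (h0 : 0 < ε) (h1 : ε < 1) : Summable (hh q ε) :=
  summable_of_sum_le (hh_nonneg hq h0 h1) (hh_sum h0)

lemma T_le (hq : 1 < q) (h0 : 0 < ε) (h1 : ε < 1) : ∑' s, hh q ε s ≤ ε :=
  (hh_summable hq h0 h1).tsum_le_of_sum_le (hh_sum h0)

lemma T_pos (hq : 1 < q) (h0 : 0 < ε) (h1 : ε < 1) : 0 < ∑' s, hh q ε s := by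
  refine (hh_summable hq h0 h1).tsum_pos (hh_nonneg hq h0 h1) [true] ?_
  unfold hh
  rw [if_neg (by simp)]
  exact G_pos hq (mul_pos h0 (mu_pos _)) (by nlinarith [mu_le_one (encode [true]), mu_nonneg (encode [true])])

end

lemma push_hh_lsc {q : ℝ} (hqc : ComputableReal q) (hq : 1 < q) (j : ℕ) (hj : (hp j : ℝ) ≤ xs q) :
    LSC (push (hh q (hp j))) := by
  have h := LSC.ite (c := fun c : ℕ => (decode₂ Str c).isSome = true ∧ ¬ (c = encode ([] : Str)))
    (cand ((Primrec.option_isSome.to_comp.comp (Primrec.decode₂ (α := Str)).to_comp).of_eq (fun c => by simp))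
      (cnot (ceq Computable.id (Computable.const (encode ([] : Str))))))
    (Gmu_lsc hqc hq j hj) (LSC.rat (Computable.const 0))
  refine h.of_eq fun c => ?_
  by_cases hc : c ∈ Set.range (encode : Str → ℕ)
  · obtain ⟨s, rfl⟩ := hc
    rw [push_encode]
    unfold hh
    by_cases hs : s = []
    · simp [hs]
    · have : ¬ (encode s = encode ([] : Str)) := fun h' => hs (encode_injective h')
      rw [if_pos ⟨by simp, this⟩, if_neg hs]
  · rw [push_none _ _ hc, if_neg]
    · simp
    · rintro ⟨h1, -⟩
      exact hc (decode₂_ne_none_iff.1 (Option.isSome_iff_ne_none.1 h1))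

lemma T_lsc {q : ℝ} (hqc : ComputableReal q) (hq : 1 < q) (j : ℕ) (hj : (hp j : ℝ) ≤ xs q) :
    LSC fun _ : Unit => ∑' s, hh q (hp j) s := by
  have h0 : (0 : ℝ) < hp j := by exact_mod_cast hp_pos j
  have h1 : (hp j : ℝ) < 1 := hj.trans_lt (xs_lt_one hq)
  have hsupp : ∀ c ∉ Set.range (encode : Str → ℕ), push (hh q (hp j)) c = 0 := push_none _
  have hsum : HasSum (push (hh q (hp j))) (∑' s, hh q (hp j) s) := by
    refine ((encode_injective (α := Str)).hasSum_iff hsupp).1 ?_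
    have hcomp : push (hh q (hp j)) ∘ encode = hh q (hp j) := funext fun s => push_encode _ _
    rw [hcomp]
    exact (hh_summable hq h0 h1).hasSum
  have hnn : ∀ c, 0 ≤ push (hh q (hp j)) c := by
    intro c
    by_cases hc : c ∈ Set.range (encode : Str → ℕ)
    · obtain ⟨s, rfl⟩ := hc
      rw [push_encode]; exact hh_nonneg hq h0 h1 s
    · rw [push_none _ _ hc]
  have h := ((push_hh_lsc hqc hq j hj).comp (g := fun p : Unit × ℕ => p.2) Computable.snd).sum
  refine h.sup ?_ ?_
  · intro _ n
    exact sum_le_hasSum _ (fun c _ => hnn c) hsum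
  · intro _ r hr
    exact (hsum.tendsto_sum_nat.eventually (lt_mem_nhds hr)).exists

lemma y_lsc {q y : ℝ} (hqc : ComputableReal q) (hq : 1 < q) (hy : 0 < y) (hyr : RightComputableReal y) :
    LSC fun _ : Unit => -((q - 1) * y) := by
  obtain ⟨f, hf, hfq⟩ := hqc
  obtain ⟨g, hg, hgy, hgt⟩ := hyr
  have hpt : Tendsto (fun n => (hp n : ℝ)) atTop (𝓝 0) := by
    simp only [hp_real]
    exact tendsto_pow_atTop_nhds_zero_of_lt_one (by norm_num) (by norm_num)
  have hft : Tendsto (fun n => (f n : ℝ)) atTop (𝓝 q) := by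
    rw [tendsto_iff_dist_tendsto_zero]
    refine squeeze_zero (fun _ => dist_nonneg) (fun n => ?_) hpt
    rw [hp_real, dist_comm, Real.dist_eq]; exact (hfq n).le
  have hn : Computable fun p : Unit × ℕ => p.2 := Computable.snd
  refine LSC.of_tendsto (fun _ n => -((f n + hp n - 1) * g n))
    (qneg (qmul (qsub (qadd (hf.comp hn) (hp_comp hn)) (Computable.const 1)) (hg.comp hn))) ?_ ?_
  · intro _ n
    push_cast
    have h1 := hfq n
    rw [← hp_real, abs_lt] at h1
    refine neg_le_neg (mul_le_mul (by linarith) (hgy n) hy.le (by linarith))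
  · intro _
    push_cast
    have := (((hft.add hpt).sub_const 1).mul hgt).neg
    simpa using this

end TsRat

/-- For computable `q > 1` and any right-computable `y ∈ (0, q^(q/(1-q))]`,
there is a universal probability `m` with Tsallis entropy `S_q(m) = y`. -/
theorem tsallis_entropy_realization (q : ℝ) (hqc : ComputableReal q) (hq : 1 < q)
    (y : ℝ) (hy0 : 0 < y) (hy1 : y ≤ q ^ (q / (1 - q)))
    (hyr : RightComputableReal y) :
    ∃ m : Str → ℝ, UniversalProb m ∧
      (1 / (q - 1)) * ∑' s, (m s - m s ^ q) = y := by
  classical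
  open TsRat in
  have hq1 : 0 < q - 1 := by linarith
  -- choice of the scale
  obtain ⟨j, hj⟩ : ∃ j, (hp j : ℝ) < min (xs q) ((q - 1) * y / q) := by
    obtain ⟨j, hj⟩ := exists_pow_lt_of_lt_one (show 0 < min (xs q) ((q - 1) * y / q) from
      lt_min (xs_pos hq) (by positivity)) (show (2 : ℝ)⁻¹ < 1 by norm_num)
    exact ⟨j, by rwa [hp_real]⟩
  have hjx : (hp j : ℝ) ≤ xs q := (hj.trans_le (min_le_left _ _)).le
  have hjy : (hp j : ℝ) * q ≤ (q - 1) * y := by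
    have := (hj.trans_le (min_le_right _ _)).le
    rwa [le_div_iff₀ (by linarith)] at this
  have hε0 : (0 : ℝ) < hp j := by exact_mod_cast hp_pos j
  have hε1 : (hp j : ℝ) < 1 := hjx.trans_lt (xs_lt_one hq)
  set T := ∑' s, hh q (hp j) s with hT
  have hTle : T ≤ hp j := T_le hq hε0 hε1
  have hTpos : 0 < T := T_pos hq hε0 hε1
  set ε : ℝ := (hp j : ℝ) with hε
  have hVpos : 0 < (q - 1) * y - T := by nlinarith
  have hVlt : (q - 1) * y - T < G q (xs q) := by
    rw [G_xs hq]; nlinarith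
  obtain ⟨x, ⟨hx1, hx2⟩, hGx⟩ := intermediate_value_Icc' (xs_lt_one hq).le (G_cont hq).continuousOn
    (show (q - 1) * y - T ∈ Set.Icc (G q 1) (G q (xs q)) from ⟨by rw [G_one]; exact hVpos.le, hVlt.le⟩)
  have hxs := xs_pos hq
  have hx0 : 0 < x := hxs.trans_le hx1
  have hx1' : xs q < x := by
    refine lt_of_le_of_ne hx1 fun h => ?_
    rw [← h] at hGx; linarith
  have hxε : x + ε ≤ 1 := by
    have := G_bern hq hx0.le
    rw [hGx] at this
    by_contra hcon
    push Not at hcon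
    nlinarith
  -- lower semicomputability of x
  have hΦ : LSC fun t : ℚ => G q (clip t) + (T + -((q - 1) * y)) :=
    (G_clip_lsc hqc hq).add (((T_lsc hqc hq j hjx).add (y_lsc hqc hq hy0 hyr)).comp
      (g := fun _ : ℚ => ()) (Computable.const ()))
  have hxl : LSC fun _ : Str => x := by
    obtain ⟨f, hf, hfle, hfex⟩ := hΦ
    have htn : Computable fun p : Str × ℕ => Denumerable.ofNat ℚ p.2.unpair.1 :=
      (Computable.ofNat ℚ).comp (Computable.fst.comp (Computable.unpair.comp Computable.snd))
    have hjn : Computable fun p : Str × ℕ => p.2.unpair.2 :=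
      Computable.snd.comp (Computable.unpair.comp Computable.snd)
    refine ⟨fun _ n => if (0 < Denumerable.ofNat ℚ n.unpair.1 ∧ Denumerable.ofNat ℚ n.unpair.1 < 1) ∧
      0 < f (Denumerable.ofNat ℚ n.unpair.1) n.unpair.2 then Denumerable.ofNat ℚ n.unpair.1 else 0, ?_, ?_, ?_⟩
    · exact cite (α := Str × ℕ) (cand (cand (qlt (Computable.const 0) htn) (qlt htn (Computable.const 1)))
        (qlt (Computable.const 0) (hf.comp htn hjn))) htn (Computable.const 0)
    · intro _ n
      dsimp only
      generalize Denumerable.ofNat ℚ n.unpair.1 = t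
      split_ifs with h
      · obtain ⟨⟨h0, h1⟩, h2⟩ := h
        have h3 := hfle t n.unpair.2
        have h2' : (0 : ℝ) < f t n.unpair.2 := by exact_mod_cast h2
        have h4 : 0 < G q (clip t) + (T + -((q - 1) * y)) := h2'.trans_le h3
        rw [clip_eq h0.le h1.le] at h4
        by_contra hcon
        push Not at hcon
        have := (G_anti hq).antitoneOn ⟨hx1, hx2⟩ ⟨hx1.trans hcon.le, by exact_mod_cast h1.le⟩ hcon.le
        linarith
      · simpa using hx0.le
    · intro _ r hr
      obtain ⟨t, ht1, ht2⟩ := exists_rat_btwn (show max r (xs q) < x from max_lt hr hx1')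
      have htx : xs q < t := (le_max_right _ _).trans_lt ht1
      have htr : r < t := (le_max_left _ _).trans_lt ht1
      have h0 : 0 < t := by
        have : (0 : ℝ) < t := by linarith
        exact_mod_cast this
      have h1 : t < 1 := by
        have : (t : ℝ) < 1 := by linarith
        exact_mod_cast this
      have hG := (G_anti hq) ⟨htx.le, by linarith⟩ ⟨hx1, hx2⟩ ht2
      obtain ⟨k, hk⟩ := hfex t 0 (by dsimp only; rw [clip_eq h0.le h1.le]; linarith)
      obtain ⟨i, hi⟩ := ofNat_surj t
      refine ⟨Nat.pair i k, ?_⟩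
      simp only [Nat.unpair_pair, hi]
      rw [if_pos ⟨⟨h0, h1⟩, by exact_mod_cast hk⟩]
      exact htr
  -- the universal probability
  let m : Str → ℝ := fun s => if s = [] then x else ε * mu (Encodable.encode s)
  have hm_nil : m [] = x := if_pos rfl
  have hm_ne : ∀ s, s ≠ [] → m s = ε * mu (Encodable.encode s) := fun s hs => if_neg hs
  have hmnn : ∀ s, 0 ≤ m s := by
    intro s
    by_cases hs : s = []
    · rw [hs, hm_nil]; exact hx0.le
    · rw [hm_ne s hs]; exact mul_nonneg hε0.le (mu_nonneg _)
  have hmsum : ∀ F : Finset Str, ∑ s ∈ F, m s ≤ 1 := by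
    intro F
    calc ∑ s ∈ F, m s ≤ ∑ s ∈ F, ((if s = [] then x else 0) + ε * mu (Encodable.encode s)) := by
          refine Finset.sum_le_sum fun s _ => ?_
          have := mul_nonneg hε0.le (mu_nonneg (Encodable.encode s))
          by_cases hs : s = []
          · rw [if_pos hs, hs, hm_nil]; rw [hs] at this; linarith
          · rw [if_neg hs, hm_ne s hs]; linarith
      _ = (∑ s ∈ F, if s = [] then x else 0) + ε * ∑ s ∈ F, mu (Encodable.encode s) := by
          rw [Finset.sum_add_distrib, Finset.mul_sum]
      _ ≤ x + ε * 1 := by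
          refine add_le_add ?_ (mul_le_mul_of_nonneg_left (mu_str_sum F) hε0.le)
          rw [Finset.sum_ite_eq']
          split_ifs
          · exact le_rfl
          · exact hx0.le
      _ ≤ 1 := by linarith
  have hmlsc : LSC m := by
    have h1 : LSC fun s : Str => (hp j : ℝ) * mu (Encodable.encode s) :=
      (mu_lsc.mulRat (g := fun _ => hp j) (Computable.const _) (fun _ => (hp_pos j).le)).comp
        Computable.encode
    refine (LSC.ite (c := fun s : Str => s = []) (ceq Computable.id (Computable.const [])) hxl h1).of_eq ?_
    intro s
    by_cases hs : s = []
    · rw [if_pos hs, hs, hm_nil]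
    · rw [if_neg hs, hm_ne s hs]
  refine ⟨m, ⟨⟨⟨fun s => ⟨hmnn s, by simpa using hmsum {s}⟩, hmsum⟩, ?_⟩, ?_⟩, ?_⟩
  · obtain ⟨f, hf, -, hle, ht⟩ := hmlsc.mono
    refine ⟨fun n s => max 0 (f s n), ?_, fun s => ⟨fun n => ⟨le_max_left _ _, ?_⟩, ?_⟩⟩
    · exact qmax (Computable.const 0) (hf.comp Computable.snd Computable.fst)
    · push_cast; exact max_le (hmnn s) (hle s n)
    · push_cast
      have := (tendsto_const_nhds (x := (0 : ℝ))).max (ht s)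
      rwa [max_eq_right (hmnn s)] at this
  · intro r hr
    obtain ⟨c, hc, h⟩ := dominate hr
    refine ⟨min (ε * c) x, lt_min (mul_pos hε0 hc) hx0, fun s => ?_⟩
    have hr0 := (hr.1.1 s).1
    have hr1 := (hr.1.1 s).2
    by_cases hs : s = []
    · rw [hs, hm_nil]
      rw [hs] at hr0 hr1
      calc min (ε * c) x * r [] ≤ x * r [] := mul_le_mul_of_nonneg_right (min_le_right _ _) hr0
        _ ≤ x := by nlinarith
    · rw [hm_ne s hs]
      calc min (ε * c) x * r s ≤ ε * c * r s := mul_le_mul_of_nonneg_right (min_le_left _ _) hr0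
        _ = ε * (c * r s) := by ring
        _ ≤ _ := mul_le_mul_of_nonneg_left (h s) hε0.le
  · have hdec : ∀ s, m s - m s ^ q = (if s = [] then G q x else 0) + hh q ε s := by
      intro s
      unfold hh
      by_cases hs : s = []
      · rw [if_pos hs, if_pos hs, hs, hm_nil, add_zero]; rfl
      · rw [if_neg hs, if_neg hs, hm_ne s hs, zero_add]; rfl
    have hs1 : HasSum (fun s : Str => if s = [] then G q x else 0) (G q x) := hasSum_ite_eq _ _
    have hs2 : HasSum (hh q ε) T := (hh_summable hq hε0 hε1).hasSum
    have hs3 := hs1.add hs2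
    rw [tsum_congr hdec, hs3.tsum_eq, hGx]
    field_simp
    ring

end Paper
end

section
/- Let q be a computable real with q > 1 and D ∈ [0,1] a computable real. Then there exists a universal probability m such that the Tsallis entropy S_q(m) is weakly Chaitin D-random and D-compressible; in particular lim_{n→∞} K((S_q(m))_n)/n = D. -/
open Filter Topology

namespace Paper

section
/-! ### Computability over the rationals -/

theorem computable_search {α : Type*} [Primcodable α] {p : α → ℕ → Bool} (hp : Computable₂ p)
    {f : α → ℕ} (hf : ∀ a, p a (f a) = true) (hmin : ∀ a j, p a j = true → f a ≤ j) :
    Computable f := by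
  have h : Partrec fun a => Nat.rfind (fun j => Part.some (p a j)) := Partrec.rfind hp.partrec₂
  refine h.of_eq_tot fun a => ?_
  refine Nat.mem_rfind.2 ⟨?_, ?_⟩
  · exact Part.mem_some_iff.2 (hf a).symm
  · intro m hm
    refine Part.mem_some_iff.2 ?_
    cases hpm : p a m with
    | false => rfl
    | true => exact absurd (hmin a m hpm) (by omega)

theorem c_rec {α σ : Type*} [Primcodable α] [Primcodable σ] {n : α → ℕ} {g : α → σ}
    {h : α → ℕ → σ → σ} (hn : Computable n) (hg : Computable g)
    (hh : Computable fun p : α × ℕ × σ => h p.1 p.2.1 p.2.2) :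
    Computable fun a => Nat.rec (motive := fun _ => σ) (g a) (h a) (n a) :=
  Computable.nat_rec (h := fun a p => h a p.1 p.2) hn hg hh

/-- the code of a rational used by `Computable` -/
def renc (q : ℚ) : ℕ := @Encodable.encode ℚ (Primcodable.ofDenumerable ℚ).toEncodable q

theorem computable_renc : Computable renc := Computable.encode

theorem computable_renc_iff {α : Type*} [Primcodable α] {f : α → ℚ} :
    (Computable fun a => renc (f a)) ↔ Computable f := Computable.encode_iff

def rdec (n : ℕ) : ℚ := Denumerable.ofNat ℚ n

theorem computable_rdec : Computable rdec := Computable.ofNat ℚ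

theorem rdec_renc (q : ℚ) : rdec (renc q) = q := Denumerable.ofNat_encode q

theorem renc_rdec (n : ℕ) : renc (rdec n) = n := Denumerable.encode_ofNat n

def icode (z : ℤ) : ℕ := Encodable.encode z

theorem icode_ofNat (n : ℕ) : icode (Int.ofNat n) = 2 * n := by
  show Equiv.intEquivNat (Int.ofNat n) = 2 * n
  rfl

theorem icode_negSucc (n : ℕ) : icode (Int.negSucc n) = 2 * n + 1 := by
  show Equiv.intEquivNat (Int.negSucc n) = 2 * n + 1
  rfl

theorem icode_abs (z : ℤ) : (icode z + 1) / 2 = z.natAbs := by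
  cases z with
  | ofNat n => rw [icode_ofNat]; simp; omega
  | negSucc n => rw [icode_negSucc]; simp; omega

def rc (q : ℚ) : ℕ := Nat.pair (icode q.num) q.den

theorem rc_inj {p q : ℚ} (h : rc p = rc q) : p = q := by
  unfold rc at h
  rw [Nat.pair_eq_pair] at h
  exact Rat.ext (Encodable.encode_injective h.1) h.2

def rgood (j : ℕ) : Prop :=
  0 < (Nat.unpair j).2 ∧ Nat.Coprime (((Nat.unpair j).1 + 1) / 2) (Nat.unpair j).2

instance : DecidablePred rgood := fun j => by unfold rgood; infer_instance

theorem rgood_rc (q : ℚ) : rgood (rc q) := by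
  unfold rgood rc
  simp only [Nat.unpair_pair, icode_abs]
  exact ⟨q.den_pos, q.reduced⟩

theorem rgood_iff (j : ℕ) : rgood j ↔ ∃ q, rc q = j := by
  constructor
  · intro h
    set z : ℤ := Denumerable.ofNat ℤ (Nat.unpair j).1 with hz
    have hz' : icode z = (Nat.unpair j).1 := Denumerable.encode_ofNat _
    refine ⟨⟨z, (Nat.unpair j).2, h.1.ne', ?_⟩, ?_⟩
    · rw [← icode_abs, hz']; exact h.2
    · unfold rc; simp [hz']
  · rintro ⟨q, rfl⟩; exact rgood_rc q

def rcount (j : ℕ) : ℕ := ((List.range j).filter (fun i => decide (rgood i))).length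

theorem encode_rat (q : ℚ) : renc q = rcount (rc q) := by
  have h1 : ∀ q : ℚ, @Encodable.encode ℚ Rat.instEncodable q = rc q := fun q => rfl
  have h2 : renc q = (List.range (@Encodable.encode ℚ Rat.instEncodable q)).countP
    (fun i => @decide (i ∈ Set.range (@Encodable.encode ℚ Rat.instEncodable))
      (@Encodable.decidableRangeEncode ℚ Rat.instEncodable i)) := rfl
  rw [h2, h1, rcount, List.countP_eq_length_filter]
  congr 2
  funext i
  simp only [decide_eq_decide]
  rw [rgood_iff]
  rfl

theorem primrec_dvd : PrimrecRel (fun a b : ℕ => a ∣ b) := by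
  have : PrimrecRel (fun a b : ℕ => b % a = 0) :=
    Primrec.eq.comp (Primrec.nat_mod.comp Primrec.snd Primrec.fst) (Primrec.const 0)
  exact this.of_eq fun a b => (Nat.dvd_iff_mod_eq_zero).symm

theorem primrec_coprime : PrimrecRel (fun a b : ℕ => Nat.Coprime a b) := by
  have h0 : PrimrecRel (fun (k : ℕ) (y : ℕ × ℕ) => k ∣ y.1 → k ∣ y.2 → k ≤ 1) := by
    have : PrimrecRel (fun (k : ℕ) (y : ℕ × ℕ) => ¬ (k ∣ y.1) ∨ (¬ (k ∣ y.2) ∨ k ≤ 1)) := by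
      refine PrimrecPred.or (PrimrecPred.not ?_) (PrimrecPred.or (PrimrecPred.not ?_) ?_)
      · exact primrec_dvd.comp Primrec.fst (Primrec.fst.comp Primrec.snd)
      · exact primrec_dvd.comp Primrec.fst (Primrec.snd.comp Primrec.snd)
      · exact Primrec.nat_le.comp Primrec.fst (Primrec.const 1)
    exact this.of_eq fun k y => by tauto
  have h1 : PrimrecRel (fun (a b : ℕ) => ∀ k < a + b + 1, (k ∣ a → k ∣ b → k ≤ 1)) := by
    have : PrimrecRel (fun (a b : ℕ) => ∀ k ∈ List.range (a + b + 1), (k ∣ a → k ∣ b → k ≤ 1)) :=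
      PrimrecRel.comp (R := fun (L : List ℕ) (y : ℕ × ℕ) => ∀ k ∈ L, (k ∣ y.1 → k ∣ y.2 → k ≤ 1))
        (PrimrecRel.forall_mem_list h0)
        (Primrec.list_range.comp (Primrec.succ.comp (Primrec.nat_add.comp Primrec.fst Primrec.snd)))
        (Primrec.fst.pair Primrec.snd)
    exact this.of_eq fun a b => by simp only [List.mem_range]
  have h2 : PrimrecRel (fun (a b : ℕ) => (∀ k < a + b + 1, (k ∣ a → k ∣ b → k ≤ 1)) ∧ 0 < a + b) :=
    PrimrecPred.and h1 (Primrec.nat_lt.comp (Primrec.const 0)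
      (Primrec.nat_add.comp Primrec.fst Primrec.snd))
  refine h2.of_eq fun a b => ?_
  constructor
  · rintro ⟨h, hp⟩
    have hg : 0 < Nat.gcd a b := Nat.gcd_pos_iff.2 (by omega)
    have hle : Nat.gcd a b ≤ a + b := by
      rcases Nat.eq_zero_or_pos a with rfl | ha
      · simp
      · exact (Nat.gcd_le_left b ha).trans (by omega)
    have := h (Nat.gcd a b) (by omega) (Nat.gcd_dvd_left _ _) (Nat.gcd_dvd_right _ _)
    unfold Nat.Coprime; omega
  · intro h
    refine ⟨fun k _ ha hb => Nat.le_of_dvd one_pos (h ▸ Nat.dvd_gcd ha hb), ?_⟩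
    rcases Nat.eq_zero_or_pos (a + b) with h0 | h0
    · have : a = 0 ∧ b = 0 := by omega
      rw [this.1, this.2] at h; simp at h
    · exact h0

theorem primrec_rgood : PrimrecPred rgood := by
  refine PrimrecPred.and ?_ ?_
  · exact Primrec.nat_lt.comp (Primrec.const 0) (Primrec.snd.comp Primrec.unpair)
  · exact primrec_coprime.comp (Primrec.nat_div.comp (Primrec.succ.comp
      (Primrec.fst.comp Primrec.unpair)) (Primrec.const 2)) (Primrec.snd.comp Primrec.unpair)

theorem primrec_rcount : Primrec rcount :=
  Primrec.list_length.comp ((Primrec.listFilter primrec_rgood).comp Primrec.list_range)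

theorem rcount_lt {i j : ℕ} (hi : rgood i) (h : i < j) : rcount i < rcount j := by
  have : ∀ n, rcount (i + 1 + n) ≥ rcount i + 1 := by
    intro n
    induction n with
    | zero => simp [rcount, List.range_succ, hi]
    | succ n ih =>
      refine ih.trans ?_
      rw [← add_assoc]
      unfold rcount
      rw [List.range_succ (n := i + 1 + n)]
      simp
  have := this (j - i - 1)
  rw [show i + 1 + (j - i - 1) = j by omega] at this
  omega

theorem computable_rc : Computable rc := by
  have hp : Computable₂ (fun (q : ℚ) (j : ℕ) => decide (rgood j) && decide (rcount j = renc q)) :=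
    Primrec.and.to_comp.comp (primrec_rgood.decide.to_comp.comp Computable.snd)
      (Primrec.eq.decide.to_comp.comp (primrec_rcount.to_comp.comp Computable.snd)
        (computable_renc.comp Computable.fst))
  refine computable_search hp (fun q => ?_) (fun q j h => ?_)
  · simp [rgood_rc, encode_rat]
  · simp only [Bool.and_eq_true, decide_eq_true_eq] at h
    by_contra hlt
    have := rcount_lt h.1 (not_le.1 hlt)
    rw [h.2, encode_rat] at this
    omega

theorem computable_of_rc {α : Type*} [Primcodable α] {f : α → ℚ}
    (h : Computable fun a => rc (f a)) : Computable f := by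
  rw [← computable_renc_iff]
  exact (primrec_rcount.to_comp.comp h).of_eq fun a => (encode_rat _).symm

/-- numerator positive part, numerator negative part, denominator -/
def rP (q : ℚ) : ℕ := q.num.toNat
def rN (q : ℚ) : ℕ := (-q.num).toNat

theorem computable_den : Computable (fun q : ℚ => q.den) :=
  (Computable.snd.comp (Computable.unpair.comp computable_rc)).of_eq fun q => by simp [rc]

theorem computable_icode : Computable (fun q : ℚ => icode q.num) :=
  (Computable.fst.comp (Computable.unpair.comp computable_rc)).of_eq fun q => by simp [rc]

theorem rP_eq (q : ℚ) : rP q = if icode q.num % 2 = 0 then icode q.num / 2 else 0 := by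
  unfold rP
  cases q.num with
  | ofNat n => rw [icode_ofNat]; simp
  | negSucc n => rw [icode_negSucc]; rw [if_neg (by omega)]; simp

theorem rN_eq (q : ℚ) : rN q = if icode q.num % 2 = 0 then 0 else (icode q.num + 1) / 2 := by
  unfold rN
  cases q.num with
  | ofNat n => rw [icode_ofNat]; simp
  | negSucc n => rw [icode_negSucc]; rw [if_neg (by omega)]; simp; omega

theorem computable_rP : Computable rP := by
  have : Primrec (fun n : ℕ => if n % 2 = 0 then n / 2 else 0) :=
    Primrec.ite (Primrec.eq.comp (Primrec.nat_mod.comp Primrec.id (Primrec.const 2)) (Primrec.const 0))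
      (Primrec.nat_div.comp Primrec.id (Primrec.const 2)) (Primrec.const 0)
  exact (this.to_comp.comp computable_icode).of_eq fun q => (rP_eq q).symm

theorem computable_rN : Computable rN := by
  have : Primrec (fun n : ℕ => if n % 2 = 0 then 0 else (n + 1) / 2) :=
    Primrec.ite (Primrec.eq.comp (Primrec.nat_mod.comp Primrec.id (Primrec.const 2)) (Primrec.const 0))
      (Primrec.const 0) (Primrec.nat_div.comp Primrec.succ (Primrec.const 2))
  exact (this.to_comp.comp computable_icode).of_eq fun q => (rN_eq q).symm

theorem rat_eq (q : ℚ) : q = ((rP q : ℚ) - rN q) / q.den := by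
  have h : (q.num : ℚ) = (rP q : ℚ) - rN q := by
    have : q.num = (rP q : ℤ) - rN q := by unfold rP rN; omega
    exact_mod_cast congrArg (Int.cast : ℤ → ℚ) this
  rw [← h, Rat.num_div_den]

variable {α β : Type*} [Primcodable α] [Primcodable β]

theorem cnat_add {f g : α → ℕ} (hf : Computable f) (hg : Computable g) :
    Computable fun a => f a + g a := Primrec.nat_add.to_comp.comp hf hg
theorem cnat_mul {f g : α → ℕ} (hf : Computable f) (hg : Computable g) :
    Computable fun a => f a * g a := Primrec.nat_mul.to_comp.comp hf hg
theorem cnat_sub {f g : α → ℕ} (hf : Computable f) (hg : Computable g) :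
    Computable fun a => f a - g a := Primrec.nat_sub.to_comp.comp hf hg
theorem cnat_div {f g : α → ℕ} (hf : Computable f) (hg : Computable g) :
    Computable fun a => f a / g a := Primrec.nat_div.to_comp.comp hf hg
theorem cnat_mod {f g : α → ℕ} (hf : Computable f) (hg : Computable g) :
    Computable fun a => f a % g a := Primrec.nat_mod.to_comp.comp hf hg
theorem cnat_le {f g : α → ℕ} (hf : Computable f) (hg : Computable g) :
    Computable fun a => decide (f a ≤ g a) := Primrec.nat_le.decide.to_comp.comp hf hg
theorem cnat_lt {f g : α → ℕ} (hf : Computable f) (hg : Computable g) :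
    Computable fun a => decide (f a < g a) := Primrec.nat_lt.decide.to_comp.comp hf hg
theorem c_eq [DecidableEq β] {f g : α → β} (hf : Computable f) (hg : Computable g) :
    Computable fun a => decide (f a = g a) := Primrec.eq.decide.to_comp.comp hf hg
theorem c_ite {p : α → Prop} [DecidablePred p] {f g : α → β} (hp : Computable fun a => decide (p a))
    (hf : Computable f) (hg : Computable g) : Computable fun a => if p a then f a else g a :=
  (Computable.cond hp hf hg).of_eq fun a => by by_cases h : p a <;> simp [h]
theorem c_and {p q : α → Bool} (hp : Computable p) (hq : Computable q) :
    Computable fun a => p a && q a := Primrec.and.to_comp.comp hp hq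
theorem c_dand {p q : α → Prop} [DecidablePred p] [DecidablePred q]
    (hp : Computable fun a => decide (p a)) (hq : Computable fun a => decide (q a)) :
    Computable fun a => decide (p a ∧ q a) := (c_and hp hq).of_eq fun a => by simp
theorem c_dnot {p : α → Prop} [DecidablePred p]
    (hp : Computable fun a => decide (p a)) :
    Computable fun a => decide (¬ p a) := (Primrec.not.to_comp.comp hp).of_eq fun a => by simp

theorem cnat_pow {f g : α → ℕ} (hf : Computable f) (hg : Computable g) :
    Computable fun a => f a ^ g a := by
  have : Computable fun a => Nat.rec (motive := fun _ => ℕ) 1 (fun _ r => r * f a) (g a) :=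
    c_rec (h := fun a _ r => r * f a) hg (Computable.const 1)
      (cnat_mul (Computable.snd.comp Computable.snd) (hf.comp Computable.fst))
  refine this.of_eq fun a => ?_
  induction g a with
  | zero => simp
  | succ n ih => rw [pow_succ, ← ih]

/-- building rationals -/
theorem computable_mk {a b d : α → ℕ} (ha : Computable a) (hb : Computable b) (hd : Computable d)
    (hpos : ∀ x, 0 < d x) : Computable fun x => ((a x : ℚ) - b x) / d x := by
  have key : ∀ x (r : ℚ), r = ((a x : ℚ) - b x) / d x ↔
      rP r * d x + b x * r.den = a x * r.den + rN r * d x := by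
    intro x r
    have h1 : (d x : ℚ) ≠ 0 := by exact_mod_cast (hpos x).ne'
    have h2 : (r.den : ℚ) ≠ 0 := by exact_mod_cast r.den_pos.ne'
    have e : ((rP r * d x + b x * r.den : ℕ) : ℚ) = (a x * r.den + rN r * d x : ℕ) ↔
      rP r * d x + b x * r.den = a x * r.den + rN r * d x := Nat.cast_inj
    rw [← e]
    conv_lhs => rw [rat_eq r]
    rw [div_eq_div_iff h2 h1]
    push_cast
    constructor <;> intro h <;> linarith
  have hp : Computable₂ (fun (x : α) (j : ℕ) =>
      decide (rP (rdec j) * d x + b x * (rdec j).den =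
        a x * (rdec j).den + rN (rdec j) * d x)) := by
    have h := computable_rdec.comp (Computable.snd (α := α) (β := ℕ))
    exact c_eq (cnat_add (cnat_mul (computable_rP.comp h) (hd.comp Computable.fst))
        (cnat_mul (hb.comp Computable.fst) (computable_den.comp h)))
      (cnat_add (cnat_mul (ha.comp Computable.fst) (computable_den.comp h))
        (cnat_mul (computable_rN.comp h) (hd.comp Computable.fst)))
  rw [← computable_renc_iff]
  refine computable_search hp (fun x => ?_) (fun x j h => ?_)
  · rw [decide_eq_true_iff, ← key, rdec_renc]
  · rw [decide_eq_true_iff, ← key] at h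
    rw [← h, renc_rdec]

theorem crat_add {f g : α → ℚ} (hf : Computable f) (hg : Computable g) :
    Computable fun a => f a + g a := by
  have hP := computable_rP.comp hf; have hN := computable_rN.comp hf
  have hP' := computable_rP.comp hg; have hN' := computable_rN.comp hg
  have hD := computable_den.comp hf; have hD' := computable_den.comp hg
  refine (computable_mk (cnat_add (cnat_mul hP hD') (cnat_mul hP' hD))
    (cnat_add (cnat_mul hN hD') (cnat_mul hN' hD)) (cnat_mul hD hD')
    (fun x => Nat.mul_pos (Rat.den_pos _) (Rat.den_pos _))).of_eq fun x => ?_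
  conv_rhs => rw [rat_eq (f x), rat_eq (g x)]
  have h1 : ((f x).den : ℚ) ≠ 0 := by exact_mod_cast (f x).den_pos.ne'
  have h2 : ((g x).den : ℚ) ≠ 0 := by exact_mod_cast (g x).den_pos.ne'
  push_cast
  field_simp
  ring

theorem crat_mul {f g : α → ℚ} (hf : Computable f) (hg : Computable g) :
    Computable fun a => f a * g a := by
  have hP := computable_rP.comp hf; have hN := computable_rN.comp hf
  have hP' := computable_rP.comp hg; have hN' := computable_rN.comp hg
  have hD := computable_den.comp hf; have hD' := computable_den.comp hg
  refine (computable_mk (cnat_add (cnat_mul hP hP') (cnat_mul hN hN'))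
    (cnat_add (cnat_mul hP hN') (cnat_mul hN hP')) (cnat_mul hD hD')
    (fun x => Nat.mul_pos (Rat.den_pos _) (Rat.den_pos _))).of_eq fun x => ?_
  conv_rhs => rw [rat_eq (f x), rat_eq (g x)]
  have h1 : ((f x).den : ℚ) ≠ 0 := by exact_mod_cast (f x).den_pos.ne'
  have h2 : ((g x).den : ℚ) ≠ 0 := by exact_mod_cast (g x).den_pos.ne'
  push_cast
  field_simp
  ring

theorem crat_sub {f g : α → ℚ} (hf : Computable f) (hg : Computable g) :
    Computable fun a => f a - g a :=
  (crat_add hf (crat_mul (Computable.const (-1)) hg)).of_eq fun a => by ring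

theorem crat_le {f g : α → ℚ} (hf : Computable f) (hg : Computable g) :
    Computable fun a => decide (f a ≤ g a) := by
  have hP := computable_rP.comp hf; have hN := computable_rN.comp hf
  have hP' := computable_rP.comp hg; have hN' := computable_rN.comp hg
  have hD := computable_den.comp hf; have hD' := computable_den.comp hg
  refine (cnat_le (cnat_add (cnat_mul hP hD') (cnat_mul hN' hD))
    (cnat_add (cnat_mul hP' hD) (cnat_mul hN hD'))).of_eq fun x => ?_
  rw [decide_eq_decide]
  conv_rhs => rw [rat_eq (f x), rat_eq (g x)]
  have h1 : (0 : ℚ) < ((f x).den : ℚ) := by exact_mod_cast (f x).den_pos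
  have h2 : (0 : ℚ) < ((g x).den : ℚ) := by exact_mod_cast (g x).den_pos
  rw [div_le_div_iff₀ h1 h2, ← Nat.cast_le (α := ℚ)]
  push_cast
  constructor <;> intro h <;> linarith

theorem crat_lt {f g : α → ℚ} (hf : Computable f) (hg : Computable g) :
    Computable fun a => decide (f a < g a) :=
  (Primrec.not.to_comp.comp (crat_le hg hf)).of_eq fun a => by
    rw [← decide_not, decide_eq_decide, not_le]

theorem crat_max {f g : α → ℚ} (hf : Computable f) (hg : Computable g) :
    Computable fun a => max (f a) (g a) :=
  (c_ite (crat_le hf hg) hg hf).of_eq fun a => by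
    split_ifs with h
    · rw [max_eq_right h]
    · rw [max_eq_left (le_of_not_ge h)]

theorem crat_natdiv {f g : α → ℕ} (hf : Computable f) (hg : Computable g) :
    Computable fun a => (f a : ℚ) / (g a : ℚ) := by
  refine (c_ite (p := fun a => g a = 0) (c_eq hg (Computable.const 0)) (Computable.const 0)
    (computable_mk hf (Computable.const 0) (d := fun a => if g a = 0 then 1 else g a)
      (c_ite (c_eq hg (Computable.const 0)) (Computable.const 1) hg) ?_)).of_eq fun a => ?_
  · intro x; split_ifs <;> omega
  · by_cases h : g a = 0 <;> simp [h]

theorem crat_nat {f : α → ℕ} (hf : Computable f) : Computable fun a => (f a : ℚ) :=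
  (crat_natdiv hf (Computable.const 1)).of_eq fun a => by simp

theorem crat_half {f : α → ℕ} (hf : Computable f) : Computable fun a => ((1:ℚ) / 2) ^ (f a) :=
  (crat_natdiv (Computable.const 1) (cnat_pow (Computable.const 2) hf)).of_eq fun a => by
    simp

theorem crat_sum {F : α → ℕ → ℚ} {n : α → ℕ} (hF : Computable₂ F) (hn : Computable n) :
    Computable fun a => ∑ i ∈ Finset.range (n a), F a i := by
  have : Computable fun a => Nat.rec (motive := fun _ => ℚ) 0 (fun i r => r + F a i) (n a) :=
    c_rec (h := fun a i r => r + F a i) hn (Computable.const 0)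
      (crat_add (Computable.snd.comp Computable.snd)
        (hF.comp Computable.fst (Computable.fst.comp Computable.snd)))
  refine this.of_eq fun a => ?_
  induction n a with
  | zero => simp
  | succ k ih => rw [Finset.sum_range_succ, ← ih]

theorem cnat_sum {F : α → ℕ → ℕ} {n : α → ℕ} (hF : Computable₂ F) (hn : Computable n) :
    Computable fun a => ∑ i ∈ Finset.range (n a), F a i := by
  have : Computable fun a => Nat.rec (motive := fun _ => ℕ) 0 (fun i r => r + F a i) (n a) :=
    c_rec (h := fun a i r => r + F a i) hn (Computable.const 0)
      (cnat_add (Computable.snd.comp Computable.snd)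
        (hF.comp Computable.fst (Computable.fst.comp Computable.snd)))
  refine this.of_eq fun a => ?_
  induction n a with
  | zero => simp
  | succ k ih => rw [Finset.sum_range_succ, ← ih]

/-- maximum of `0` and the first `n` values -/
def rmax (f : ℕ → ℚ) : ℕ → ℚ
  | 0 => 0
  | n + 1 => max (rmax f n) (f n)

theorem rmax_nonneg (f : ℕ → ℚ) (n : ℕ) : 0 ≤ rmax f n := by
  induction n with
  | zero => exact le_refl _
  | succ n ih => exact ih.trans (le_max_left _ _)

theorem le_rmax (f : ℕ → ℚ) {i n : ℕ} (h : i < n) : f i ≤ rmax f n := by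
  induction n with
  | zero => omega
  | succ n ih =>
    rcases Nat.lt_succ_iff_lt_or_eq.1 h with h | rfl
    · exact (ih h).trans (le_max_left _ _)
    · exact le_max_right _ _

theorem rmax_mono (f : ℕ → ℚ) : Monotone (rmax f) :=
  monotone_nat_of_le_succ fun _ => le_max_left _ _

theorem rmax_cases (f : ℕ → ℚ) (n : ℕ) : rmax f n = 0 ∨ ∃ i < n, rmax f n = f i := by
  induction n with
  | zero => left; rfl
  | succ n ih =>
    rcases max_choice (rmax f n) (f n) with h | h
    · rcases ih with h' | ⟨i, hi, h'⟩
      · left; exact h.trans h'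
      · right; exact ⟨i, by omega, h.trans h'⟩
    · right; exact ⟨n, by omega, h⟩

theorem crat_rmax {F : α → ℕ → ℚ} {n : α → ℕ} (hF : Computable₂ F) (hn : Computable n) :
    Computable fun a => rmax (F a) (n a) := by
  have : Computable fun a => Nat.rec (motive := fun _ => ℚ) 0 (fun i r => max r (F a i)) (n a) :=
    c_rec (h := fun a i r => max r (F a i)) hn (Computable.const 0)
      (crat_max (Computable.snd.comp Computable.snd)
        (hF.comp Computable.fst (Computable.fst.comp Computable.snd)))
  refine this.of_eq fun a => ?_
  induction n a with
  | zero => rfl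
  | succ k ih => simp only [rmax]; rw [← ih]

end

section
/-! ### Basic facts about computers -/

theorem kraft (C : Computer) (S : Finset Str) (hS : ∀ p ∈ S, (C.f p).Dom) :
    ∑ p ∈ S, ((1 : ℝ) / 2) ^ p.length ≤ 1 := by
  by_cases hnil : [] ∈ S
  · have : S = {[]} := by
      ext p
      simp only [Finset.mem_singleton]
      constructor
      · intro hp
        exact (C.prefixFree [] p (hS _ hnil) (hS _ hp) ⟨p, rfl⟩).symm
      · rintro rfl; exact hnil
    rw [this]; simp
  · have hu : InformationTheory.UniquelyDecodable (S : Set Str) := by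
      intro L₁
      induction L₁ with
      | nil =>
        intro L₂ _ h2 he
        cases L₂ with
        | nil => rfl
        | cons b L₂ =>
          have hb : b = [] := by
            simp only [List.flatten_nil, List.flatten_cons] at he
            exact (List.append_eq_nil_iff.1 he.symm).1
          exact absurd (by simpa [hb] using h2 b (by simp)) hnil
      | cons a L₁ ih =>
        intro L₂ h1 h2 he
        have ha : a ∈ S := by simpa using h1 a (by simp)
        cases L₂ with
        | nil =>
          have : a = [] := by
            simp only [List.flatten_nil, List.flatten_cons] at he
            exact (List.append_eq_nil_iff.1 he).1
          rw [this] at ha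
          exact absurd ha hnil
        | cons b L₂ =>
          have hb : b ∈ S := by simpa using h2 b (by simp)
          simp only [List.flatten_cons] at he
          have hab : a = b := by
            have p1 : a <+: a ++ L₁.flatten := List.prefix_append _ _
            have p2 : b <+: a ++ L₁.flatten := by rw [he]; exact List.prefix_append _ _
            rcases (le_total a.length b.length).imp (List.prefix_of_prefix_length_le p1 p2)
              (List.prefix_of_prefix_length_le p2 p1) with h | h
            · exact C.prefixFree _ _ (hS _ ha) (hS _ hb) h
            · exact (C.prefixFree _ _ (hS _ hb) (hS _ ha) h).symm
          subst hab
          rw [ih L₂ (fun w hw => h1 w (by simp [hw])) (fun w hw => h2 w (by simp [hw]))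
            (List.append_cancel_left he)]
    have := InformationTheory.kraft_mcmillan_inequality hu
    simpa using this

theorem Kc_le (U : OptimalComputer) {s p : Str} (h : s ∈ U.f p) : Kc U s ≤ p.length :=
  Nat.sInf_le ⟨p, rfl, h⟩

/-- self-delimiting header -/
def hdr (n : ℕ) : Str :=
  (List.replicate (Nat.unpair n).1 true ++ [false]) ++
    (List.replicate (Nat.unpair n).2 true ++ [false])

theorem ones_pref_eq {a b : ℕ} {u v w : Str} (h1 : (List.replicate a true ++ [false]) ++ u <+: w)
    (h2 : (List.replicate b true ++ [false]) ++ v <+: w) : a = b := by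
  obtain ⟨r, rfl⟩ := h1
  obtain ⟨t, ht⟩ := h2
  induction a generalizing b with
  | zero =>
    cases b with
    | zero => rfl
    | succ b => simp [List.replicate_succ] at ht
  | succ a ih =>
    cases b with
    | zero => simp [List.replicate_succ] at ht
    | succ b =>
      have : List.replicate b true ++ [false] ++ v ++ t = List.replicate a true ++ [false] ++ u ++ r := by
        simpa [List.replicate_succ] using ht
      rw [ih this]

theorem hdr_inj {n n' : ℕ} {x x' : Str} (h : hdr n ++ x <+: hdr n' ++ x') : n = n' ∧ x <+: x' := by
  unfold hdr at h
  rw [List.append_assoc (List.replicate (Nat.unpair n).1 true ++ [false]),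
    List.append_assoc (List.replicate (Nat.unpair n').1 true ++ [false])] at h
  have h1 := ones_pref_eq h (List.prefix_refl _)
  rw [h1] at h
  have h' := (List.prefix_append_right_inj _).1 h
  have h2 := ones_pref_eq h' (List.prefix_refl _)
  rw [h2] at h'
  have h'' := (List.prefix_append_right_inj _).1 h'
  refine ⟨?_, h''⟩
  rw [← Nat.pair_unpair n, ← Nat.pair_unpair n', h1, h2]

theorem hdr_length (n : ℕ) : (hdr n).length ≤ 2 * Nat.sqrt n + 2 := by
  have : (Nat.unpair n).1 ≤ Nat.sqrt n ∧ (Nat.unpair n).2 ≤ Nat.sqrt n := by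
    unfold Nat.unpair
    have h1 : n - n.sqrt * n.sqrt ≤ n.sqrt + n.sqrt := Nat.sqrt_le_add n |> fun h => by omega
    dsimp only
    split_ifs with h
    · simp; omega
    · simp; omega
  simp [hdr]; omega

theorem c_replicate {α : Type*} [Primcodable α] {f : α → ℕ} (hf : Computable f) (b : Bool) :
    Computable fun a => List.replicate (f a) b := by
  refine (c_rec (h := fun _ _ r => b :: r) hf (Computable.const [])
    (Computable.list_cons.comp (Computable.const b) (Computable.snd.comp Computable.snd))).of_eq ?_
  intro a
  induction f a with
  | zero => rfl
  | succ n ih => rw [List.replicate_succ, ← ih]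

theorem computable_hdr : Computable hdr := by
  unfold hdr
  have h1 := c_replicate (Computable.fst.comp Computable.unpair) true
  have h2 := c_replicate (Computable.snd.comp Computable.unpair) true
  exact Computable.list_append.comp
    (Computable.list_append.comp h1 (Computable.const _))
    (Computable.list_append.comp h2 (Computable.const _))

theorem coder (U : OptimalComputer) (k : ℕ → ℕ) (hk : Computable k) (H : ℕ → Str → Str)
    (hH : Computable₂ H) : ∃ c : ℕ, ∀ n x, x.length = k n →
      ∃ p, H n x ∈ U.f p ∧ p.length ≤ k n + 2 * Nat.sqrt n + c := by
  let F : Str → ℕ → Option Str := fun p j =>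
    (Encodable.decode (α := ℕ × Str) j).bind fun y =>
      if p = hdr y.1 ++ y.2 ∧ y.2.length = k y.1 then some (H y.1 y.2) else none
  have hF : Computable₂ F := by
    refine Computable.option_bind (Computable.decode.comp Computable.snd) ?_
    refine Computable.to₂ (f := fun z : (Str × ℕ) × (ℕ × Str) =>
      if z.1.1 = hdr z.2.1 ++ z.2.2 ∧ z.2.2.length = k z.2.1 then some (H z.2.1 z.2.2) else none) ?_
    have e1 : Computable fun z : (Str × ℕ) × (ℕ × Str) => z.2.1 :=
      Computable.fst.comp Computable.snd
    have e2 : Computable fun z : (Str × ℕ) × (ℕ × Str) => z.2.2 :=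
      Computable.snd.comp Computable.snd
    have e3 : Computable fun z : (Str × ℕ) × (ℕ × Str) => z.1.1 :=
      Computable.fst.comp Computable.fst
    refine c_ite (c_dand ?_ ?_) ?_ (Computable.const none)
    · exact c_eq e3 (Computable.list_append.comp (computable_hdr.comp e1) e2)
    · exact c_eq (Computable.list_length.comp e2) (hk.comp e1)
    · exact Computable.option_some.comp (hH.comp e1 e2)
  have hmem : ∀ p j s, s ∈ F p j → ∃ n x, p = hdr n ++ x ∧ x.length = k n ∧ s = H n x := by
    intro p j s hs
    simp only [F, Option.mem_def, Option.bind_eq_some_iff] at hs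
    obtain ⟨⟨n, x⟩, _, h⟩ := hs
    split_ifs at h with hc
    · exact ⟨n, x, hc.1, hc.2, (Option.some.inj h).symm⟩
  let C : Computer :=
    { f := fun p => Nat.rfindOpt (F p)
      partrec := Partrec.rfindOpt hF
      prefixFree := by
        intro p q hp hq hpq
        obtain ⟨j, s, hs⟩ := Nat.rfindOpt_dom.1 hp
        obtain ⟨j', s', hs'⟩ := Nat.rfindOpt_dom.1 hq
        obtain ⟨n, x, rfl, hx, _⟩ := hmem _ _ _ hs
        obtain ⟨n', x', rfl, hx', _⟩ := hmem _ _ _ hs'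
        obtain ⟨rfl, hxx⟩ := hdr_inj hpq
        rw [hxx.eq_of_length (hx.trans hx'.symm)] }
  obtain ⟨sim, hsim⟩ := U.optimal C
  refine ⟨sim + 2, fun n x hx => ?_⟩
  have hin : H n x ∈ C.f (hdr n ++ x) := by
    have hd : (Nat.rfindOpt (F (hdr n ++ x))).Dom := by
      refine Nat.rfindOpt_dom.2 ⟨Encodable.encode (n, x), H n x, ?_⟩
      simp [F, hx]
    obtain ⟨s, hs⟩ := Part.dom_iff_mem.1 hd
    obtain ⟨j, hj⟩ := Nat.rfindOpt_spec hs
    obtain ⟨n', x', h1, _, h3⟩ := hmem _ _ _ hj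
    obtain ⟨rfl, _⟩ := hdr_inj (h1 ▸ List.prefix_refl _ : hdr n ++ x <+: hdr n' ++ x')
    rw [List.append_cancel_left h1, ← h3]
    rw [List.append_cancel_left h1] at hs
    exact hs
  obtain ⟨p', hp', hl⟩ := hsim _ _ hin
  refine ⟨p', hp', hl.trans ?_⟩
  have := hdr_length n
  simp only [List.length_append]; omega

theorem Kc_spec (U : OptimalComputer) (s : Str) : ∃ p, p.length = Kc U s ∧ s ∈ U.f p := by
  obtain ⟨c, hc⟩ := coder U id Computable.id (fun _ x => x) Computable.snd
  obtain ⟨p, hp, _⟩ := hc s.length s rfl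
  exact Nat.sInf_mem (s := {n | ∃ p : Str, p.length = n ∧ s ∈ U.f p}) ⟨p.length, p, rfl, hp⟩

theorem Kc_comp (U : OptimalComputer) (g : Str →. Str) (hg : Partrec g) :
    ∃ c : ℕ, ∀ w z, z ∈ g w → Kc U z ≤ Kc U w + c := by
  let C : Computer :=
    { f := fun p => (U.f p).bind g
      partrec := U.partrec.bind (hg.comp Computable.snd)
      prefixFree := fun p q hp hq h =>
        U.prefixFree p q (Part.Dom.of_bind hp) (Part.Dom.of_bind hq) h }
  obtain ⟨sim, hsim⟩ := U.optimal C
  refine ⟨sim, fun w z hz => ?_⟩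
  obtain ⟨p, hp, hw⟩ := Kc_spec U w
  obtain ⟨p', hp', hl⟩ := hsim p z (Part.mem_bind hw hz)
  have := Kc_le U hp'
  omega

end

section
/-! ### A right-computable random real -/

/-- strings with code less than `t` -/
noncomputable def strFin (t : ℕ) : Finset Str :=
  (Finset.range t).preimage (Encodable.encode : Str → ℕ)
    (Encodable.encode_injective.injOn)

theorem mem_strFin {t : ℕ} {p : Str} : p ∈ strFin t ↔ Encodable.encode p < t := by
  simp [strFin]

theorem strFin_mono {t t' : ℕ} (h : t ≤ t') : strFin t ⊆ strFin t' := by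
  intro p hp
  rw [mem_strFin] at *
  omega

theorem sum_str {M : Type*} [AddCommMonoid M] (F : Str → M) (t : ℕ) :
    ∑ i ∈ Finset.range t, (Encodable.decode₂ Str i).elim 0 F = ∑ p ∈ strFin t, F p := by
  have := Finset.sum_preimage (Encodable.encode : Str → ℕ) (Finset.range t)
    (Encodable.encode_injective.injOn) (fun i => (Encodable.decode₂ Str i).elim 0 F) (by
      intro i _ hi
      cases h : Encodable.decode₂ Str i with
      | none => rfl
      | some p => exact absurd ⟨p, Encodable.mem_decode₂.1 h⟩ hi)
  rw [← this]
  refine Finset.sum_congr rfl fun p _ => ?_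
  simp

variable {α : Type*} [Primcodable α]

theorem c_elim {β : Type*} [Primcodable β] {F : α → Str → β} {o : α → Option Str} {b : β}
    (ho : Computable o) (hF : Computable₂ F) : Computable fun a => (o a).elim b (F a) :=
  (Computable.option_casesOn ho (Computable.const b) hF).of_eq fun a => by
    cases o a <;> rfl

theorem crat_sum_str {F : α → Str → ℚ} {n : α → ℕ} (hF : Computable₂ F) (hn : Computable n) :
    Computable fun a => ∑ p ∈ strFin (n a), F a p := by
  refine (crat_sum (F := fun a i => (Encodable.decode₂ Str i).elim 0 (F a)) ?_ hn).of_eq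
    fun a => sum_str _ _
  exact c_elim (α := α × ℕ) (F := fun a => F a.1) (Primrec.decode₂.to_comp.comp Computable.snd)
    (hF.comp (Computable.fst.comp Computable.fst) Computable.snd)

theorem cnat_sum_str {F : α → Str → ℕ} {n : α → ℕ} (hF : Computable₂ F) (hn : Computable n) :
    Computable fun a => ∑ p ∈ strFin (n a), F a p := by
  refine (cnat_sum (F := fun a i => (Encodable.decode₂ Str i).elim 0 (F a)) ?_ hn).of_eq
    fun a => sum_str _ _
  exact c_elim (α := α × ℕ) (F := fun a => F a.1) (Primrec.decode₂.to_comp.comp Computable.snd)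
    (hF.comp (Computable.fst.comp Computable.fst) Computable.snd)

theorem c_evaln (c : Nat.Partrec.Code) {t n : α → ℕ} (ht : Computable t) (hn : Computable n) :
    Computable fun a => Nat.Partrec.Code.evaln (t a) c (n a) :=
  Nat.Partrec.Code.primrec_evaln.to_comp.comp ((ht.pair (Computable.const c)).pair hn)

open Nat.Partrec (Code)
open Nat.Partrec.Code (evaln)

noncomputable def omW (c : Code) (t : ℕ) (p : Str) : ℚ :=
  if (evaln t c (Encodable.encode p)).isSome = true then (1 / 2 : ℚ) ^ p.length else 0

noncomputable def omS (c : Code) (t : ℕ) : ℚ := ∑ p ∈ strFin t, omW c t p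

def omL (c : Code) (t : ℕ) (p : Str) : ℕ :=
  ((evaln t c (Encodable.encode p)).bind (Encodable.decode (α := Str))).elim 0 List.length

theorem computable_omS (c : Code) : Computable (omS c) := by
  refine crat_sum_str (F := omW c) ?_ Computable.id
  refine c_ite (α := ℕ × Str) ?_ (crat_half (Computable.list_length.comp Computable.snd))
    (Computable.const 0)
  refine c_eq (Primrec.option_isSome.to_comp.comp ?_) (Computable.const true)
  exact c_evaln c Computable.fst (Computable.encode.comp Computable.snd)

theorem random_real (U : OptimalComputer) : ∃ (w : ℕ → ℚ) (z : ℕ → Str) (ω : ℝ),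
    Computable w ∧ Computable z ∧ Antitone w ∧ (∀ t, 0 ≤ w t ∧ w t ≤ 1 / 2) ∧
    Tendsto (fun t => (w t : ℝ)) atTop (𝓝 ω) ∧
    ∀ t n, (w t : ℝ) - ω < (1 / 2 : ℝ) ^ n → n ≤ Kc U (z t) := by
  obtain ⟨c, hc⟩ := Nat.Partrec.Code.exists_code.1 U.partrec
  have hev : ∀ p : Str, c.eval (Encodable.encode p) = (U.f p).map Encodable.encode := by
    intro p
    rw [hc]
    simp
  have hdom : ∀ (t : ℕ) (p : Str), (evaln t c (Encodable.encode p)).isSome = true → (U.f p).Dom := by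
    intro t p h
    obtain ⟨x, hx⟩ := Option.isSome_iff_exists.1 h
    have := Nat.Partrec.Code.evaln_sound hx
    rw [hev, Part.mem_map_iff] at this
    obtain ⟨s, hs, _⟩ := this
    exact Part.dom_iff_mem.2 ⟨s, hs⟩
  have hmono : ∀ {t t' : ℕ} (p : Str), t ≤ t' → (evaln t c (Encodable.encode p)).isSome = true →
      (evaln t' c (Encodable.encode p)).isSome = true := by
    intro t t' p htt h
    obtain ⟨x, hx⟩ := Option.isSome_iff_exists.1 h
    exact Option.isSome_iff_exists.2 ⟨x, Nat.Partrec.Code.evaln_mono htt hx⟩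
  have hW0 : ∀ t p, 0 ≤ omW c t p := by
    intro t p; unfold omW; split_ifs <;> positivity
  have hWm : ∀ {t t'} p, t ≤ t' → omW c t p ≤ omW c t' p := by
    intro t t' p htt
    unfold omW
    by_cases h : (evaln t c (Encodable.encode p)).isSome = true
    · rw [if_pos h, if_pos (hmono p htt h)]
    · rw [if_neg h]; split_ifs <;> positivity
  have hSm : Monotone (omS c) := by
    intro t t' htt
    unfold omS
    exact (Finset.sum_le_sum fun p _ => hWm p htt).trans
      (Finset.sum_le_sum_of_subset_of_nonneg (strFin_mono htt) fun p _ _ => hW0 _ _)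
  have hS0 : ∀ t, 0 ≤ omS c t := fun t => Finset.sum_nonneg fun p _ => hW0 _ _
  have hS1 : ∀ t, omS c t ≤ 1 := by
    intro t
    have h := kraft U.toComputer
      ((strFin t).filter fun p => (evaln t c (Encodable.encode p)).isSome = true) (by
        intro p hp
        exact hdom t p (Finset.mem_filter.1 hp).2)
    rw [Finset.sum_filter] at h
    have h2 : ((omS c t : ℚ) : ℝ) ≤ 1 := by
      unfold omS omW
      push_cast
      refine le_trans (le_of_eq ?_) h
      refine Finset.sum_congr rfl fun p _ => ?_
      split_ifs <;> simp
    exact_mod_cast h2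
  -- limit
  have hSmR : Monotone (fun t => (omS c t : ℝ)) := fun a b h => by
    dsimp only; exact_mod_cast hSm h
  have hbdd : BddAbove (Set.range fun t => (omS c t : ℝ)) :=
    ⟨1, by rintro _ ⟨t, rfl⟩; dsimp only; exact_mod_cast hS1 t⟩
  set Ω : ℝ := ⨆ t, (omS c t : ℝ) with hΩ
  have hlim : Tendsto (fun t => (omS c t : ℝ)) atTop (𝓝 Ω) := tendsto_atTop_ciSup hSmR hbdd
  have hleΩ : ∀ t, (omS c t : ℝ) ≤ Ω := fun t => le_ciSup hbdd t
  have hjump : ∀ (t : ℕ) (p : Str), (U.f p).Dom → ¬ (evaln t c (Encodable.encode p)).isSome = true →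
      (omS c t : ℝ) + (1 / 2 : ℝ) ^ p.length ≤ Ω := by
    intro t p hp hn
    obtain ⟨s, hs⟩ := Part.dom_iff_mem.1 hp
    have hx : Encodable.encode s ∈ c.eval (Encodable.encode p) := by
      rw [hev]; exact Part.mem_map _ hs
    obtain ⟨k, hk⟩ := Nat.Partrec.Code.evaln_complete.1 hx
    set t' := max t k
    have hk' : (evaln t' c (Encodable.encode p)).isSome = true :=
      Option.isSome_iff_exists.2 ⟨_, Nat.Partrec.Code.evaln_mono (le_max_right t k) hk⟩
    have hpt : p ∈ strFin t' := by
      rw [mem_strFin]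
      obtain ⟨x, hx⟩ := Option.isSome_iff_exists.1 hk'
      exact Nat.Partrec.Code.evaln_bound hx
    have h : omS c t + (1 / 2 : ℚ) ^ p.length ≤ omS c t' := by
      have h1 : omS c t ≤ ∑ p ∈ strFin t', omW c t p :=
        Finset.sum_le_sum_of_subset_of_nonneg (strFin_mono (le_max_left t k)) fun p _ _ => hW0 _ _
      have h2 : ∑ p ∈ strFin t', omW c t p + (1 / 2 : ℚ) ^ p.length ≤ omS c t' := by
        unfold omS
        rw [← Finset.add_sum_erase _ _ hpt, ← Finset.add_sum_erase _ (omW c t') hpt]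
        have h3 : omW c t p = 0 := by unfold omW; rw [if_neg hn]
        have h4 : omW c t' p = (1 / 2 : ℚ) ^ p.length := by unfold omW; rw [if_pos hk']
        have h5 : ∑ x ∈ (strFin t').erase p, omW c t x ≤ ∑ x ∈ (strFin t').erase p, omW c t' x :=
          Finset.sum_le_sum fun x _ => hWm x (le_max_left t k)
        rw [h3, h4]; linarith
      linarith
    have h' : (omS c t : ℝ) + (1 / 2 : ℝ) ^ p.length ≤ (omS c t' : ℝ) := by
      have := (Rat.cast_le (K := ℝ)).2 h
      push_cast at this
      exact this
    exact h'.trans (hleΩ _)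
  refine ⟨fun t => (1 / 2) * (1 - omS c t),
    fun t => List.replicate ((∑ p ∈ strFin t, omL c t p) + 1) true, (1 / 2) * (1 - Ω),
    ?_, ?_, ?_, ?_, ?_, ?_⟩
  · exact crat_mul (Computable.const _) (crat_sub (Computable.const 1) (computable_omS c))
  · refine c_replicate (Computable.succ.comp (cnat_sum_str (F := omL c) ?_ Computable.id)) true
    refine c_elim (α := ℕ × Str) (F := fun _ => List.length) ?_
      (Computable.list_length.comp Computable.snd)
    exact Computable.option_bind (c_evaln c Computable.fst (Computable.encode.comp Computable.snd))
      (Computable.decode.comp Computable.snd)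
  · intro a b h
    have := hSm h
    dsimp only
    linarith
  · intro t
    have := hS0 t; have := hS1 t
    constructor <;> dsimp only <;> linarith
  · push_cast
    exact (hlim.const_sub 1).const_mul (1 / 2)
  · intro t n hlt
    by_contra hK
    push Not at hK
    obtain ⟨p, hp, hz⟩ := Kc_spec U (List.replicate ((∑ p ∈ strFin t, omL c t p) + 1) true)
    by_cases hh : (evaln t c (Encodable.encode p)).isSome = true
    · obtain ⟨x, hx⟩ := Option.isSome_iff_exists.1 hh
      have h1 := Nat.Partrec.Code.evaln_sound hx
      rw [hev, Part.mem_map_iff] at h1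
      obtain ⟨s, hs, hsx⟩ := h1
      have hse := Part.mem_unique hs hz
      have hpt : p ∈ strFin t := mem_strFin.2 (Nat.Partrec.Code.evaln_bound hx)
      have h2 : omL c t p = s.length := by
        unfold omL
        rw [hx, ← hsx]
        simp
      have h3 : omL c t p ≤ ∑ p ∈ strFin t, omL c t p :=
        Finset.single_le_sum (f := omL c t) (fun _ _ => Nat.zero_le _) hpt
      rw [h2, hse, List.length_replicate] at h3
      omega
    · have h1 := hjump t p (Part.dom_iff_mem.2 ⟨_, hz⟩) hh
      rw [hp] at h1
      have h2 : (1 / 2 : ℝ) ^ n ≤ (1 / 2 : ℝ) ^ (Kc U (List.replicate ((∑ p ∈ strFin t, omL c t p) + 1) true) + 1) :=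
        pow_le_pow_of_le_one (by norm_num) (by norm_num) hK
      rw [pow_succ] at h2
      push_cast at hlt
      linarith

end

section
/-! ### Bits and naturals -/

def bitsOf (n a : ℕ) : Str := (List.range n).map fun i => decide (a / 2 ^ (n - 1 - i) % 2 = 1)

def valOf (l : Str) : ℕ := l.foldl (fun r b => 2 * r + cond b 1 0) 0

theorem bitsOf_length (n a : ℕ) : (bitsOf n a).length = n := by simp [bitsOf]

theorem bitsOf_succ (n a : ℕ) : bitsOf (n + 1) a = bitsOf n (a / 2) ++ [decide (a % 2 = 1)] := by
  unfold bitsOf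
  rw [List.range_succ, List.map_append]
  congr 1
  · refine List.map_congr_left fun i hi => ?_
    rw [List.mem_range] at hi
    rw [Nat.div_div_eq_div_mul, ← pow_succ']
    have : n + 1 - 1 - i = n - 1 - i + 1 := by omega
    rw [this]
  · simp

theorem valOf_bitsOf (n a : ℕ) (h : a < 2 ^ n) : valOf (bitsOf n a) = a := by
  induction n generalizing a with
  | zero => simp at h; subst h; rfl
  | succ n ih =>
    have h1 := ih (a / 2) (by rw [pow_succ] at h; omega)
    rw [bitsOf_succ]
    unfold valOf at *
    rw [List.foldl_append, h1]
    simp only [List.foldl_cons, List.foldl_nil]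
    rcases Nat.mod_two_eq_zero_or_one a with h2 | h2 <;> simp [h2] <;> omega

theorem c_bitsOf {α : Type*} [Primcodable α] {n a : α → ℕ} (hn : Computable n)
    (ha : Computable a) : Computable fun x => bitsOf (n x) (a x) := by
  refine (c_rec (h := fun x i r => r ++ [decide (a x / 2 ^ (n x - 1 - i) % 2 = 1)])
    hn (Computable.const []) ?_).of_eq ?_
  · refine Computable.list_append.comp (Computable.snd.comp Computable.snd)
      (Computable.list_cons.comp ?_ (Computable.const []))
    refine c_eq (cnat_mod (cnat_div (ha.comp Computable.fst) (cnat_pow (Computable.const 2)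
      (cnat_sub (cnat_sub (hn.comp Computable.fst) (Computable.const 1))
        (Computable.fst.comp Computable.snd)))) (Computable.const 2)) (Computable.const 1)
  · intro x
    unfold bitsOf
    have : ∀ m, Nat.rec (motive := fun _ => Str) []
        (fun i r => r ++ [decide (a x / 2 ^ (n x - 1 - i) % 2 = 1)]) m =
        (List.range m).map fun i => decide (a x / 2 ^ (n x - 1 - i) % 2 = 1) := by
      intro m
      induction m with
      | zero => rfl
      | succ m ih => rw [List.range_succ, List.map_append, ← ih]; rfl
    exact this _

theorem computable_valOf : Computable valOf := by
  unfold valOf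
  refine (Primrec.list_foldl (f := fun l : Str => l) (g := fun _ => 0)
    (h := fun _ p => 2 * p.1 + cond p.2 1 0) Primrec.id (Primrec.const 0) ?_).to_comp
  refine Primrec.nat_add.comp (Primrec.nat_mul.comp (Primrec.const 2)
    (Primrec.fst.comp Primrec.snd)) ?_
  exact Primrec.cond (Primrec.snd.comp Primrec.snd) (Primrec.const 1) (Primrec.const 0)

/-! ### Reals from digit sequences -/

theorem half_iter {A : ℕ → ℕ} (hA : ∀ n, A (n + 1) / 2 = A n) (n i : ℕ) :
    A (n + i) / 2 ^ i = A n := by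
  induction i with
  | zero => simp
  | succ i ih => rw [pow_succ', ← Nat.div_div_eq_div_mul, ← add_assoc, hA, ih]

theorem exists_real_of_digits (A : ℕ → ℕ) (h0 : A 0 = 0) (hA : ∀ n, A (n + 1) / 2 = A n)
    (hz : ∀ n, ∃ m ≥ n, A (m + 1) % 2 = 0) :
    ∃ y : ℝ, ∀ n, (A n : ℝ) / 2 ^ n ≤ y ∧ y < ((A n : ℝ) + 1) / 2 ^ n := by
  have hmono : ∀ n, (A n : ℝ) / 2 ^ n ≤ (A (n + 1) : ℝ) / 2 ^ (n + 1) := by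
    intro n
    have h : 2 * A n ≤ A (n + 1) := by have := hA n; omega
    have h' : 2 * (A n : ℝ) ≤ A (n + 1) := by exact_mod_cast h
    rw [div_le_div_iff₀ (by positivity) (by positivity), pow_succ]
    have : (0:ℝ) < 2 ^ n := by positivity
    nlinarith
  have hanti : ∀ n, ((A (n + 1) : ℝ) + 1) / 2 ^ (n + 1) ≤ ((A n : ℝ) + 1) / 2 ^ n := by
    intro n
    have h : A (n + 1) + 1 ≤ 2 * (A n + 1) := by have := hA n; omega
    have h' : (A (n + 1) : ℝ) + 1 ≤ 2 * (A n + 1) := by exact_mod_cast h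
    rw [div_le_div_iff₀ (by positivity) (by positivity), pow_succ]
    have : (0:ℝ) < 2 ^ n := by positivity
    nlinarith
  have hM : Monotone fun n => (A n : ℝ) / 2 ^ n := monotone_nat_of_le_succ hmono
  have hN : Antitone fun n => ((A n : ℝ) + 1) / 2 ^ n := antitone_nat_of_succ_le hanti
  have hlt : ∀ n m, (A n : ℝ) / 2 ^ n ≤ ((A m : ℝ) + 1) / 2 ^ m := by
    intro n m
    refine (hM (le_max_left n m)).trans (le_trans ?_ (hN (le_max_right n m)))
    dsimp only
    gcongr
    linarith
  have hbdd : BddAbove (Set.range fun n => (A n : ℝ) / 2 ^ n) :=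
    ⟨_, by rintro _ ⟨n, rfl⟩; exact hlt n 0⟩
  refine ⟨⨆ n, (A n : ℝ) / 2 ^ n, fun n => ⟨le_ciSup hbdd n, ?_⟩⟩
  obtain ⟨m, hm, he⟩ := hz n
  have h1 : (⨆ n, (A n : ℝ) / 2 ^ n) ≤ ((A (m + 1) : ℝ) + 1) / 2 ^ (m + 1) :=
    ciSup_le fun i => hlt i _
  refine h1.trans_lt (lt_of_lt_of_le ?_ (hN hm))
  have h : A (m + 1) = 2 * A m := by have := hA m; omega
  rw [h, div_lt_div_iff₀ (by positivity) (by positivity), pow_succ]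
  push_cast
  have : (0:ℝ) < 2 ^ m := by positivity
  nlinarith

theorem binPrefix_eq {A : ℕ → ℕ} (h0 : A 0 = 0) (hA : ∀ n, A (n + 1) / 2 = A n) {y : ℝ}
    (hy : ∀ n, (A n : ℝ) / 2 ^ n ≤ y ∧ y < ((A n : ℝ) + 1) / 2 ^ n) (n : ℕ) :
    binPrefix y n = bitsOf n (A n) := by
  have hfr : Int.fract y = y := by
    rw [Int.fract_eq_self]
    have := hy 0
    simpa [h0] using this
  unfold binPrefix bitsOf
  refine List.map_congr_left fun i hi => ?_
  rw [List.mem_range] at hi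
  have h1 : ⌊Int.fract y * 2 ^ (i + 1)⌋ = (A (i + 1) : ℤ) := by
    rw [hfr, Int.floor_eq_iff]
    have := hy (i + 1)
    rw [div_le_iff₀ (by positivity), lt_div_iff₀ (by positivity)] at this
    exact_mod_cast this
  have h2 : A n / 2 ^ (n - 1 - i) = A (i + 1) := by
    have := half_iter hA (i + 1) (n - 1 - i)
    rwa [show i + 1 + (n - 1 - i) = n by omega] at this
  rw [h1, h2, decide_eq_decide]
  omega

end

section
/-! ### Spreading digits -/

/-- number of jumps before `n` -/
def kJ (J : ℕ → Bool) : ℕ → ℕ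
  | 0 => 0
  | n + 1 => kJ J n + cond (J n) 1 0

def spJ (J : ℕ → Bool) (j : ℕ) : ℕ → ℕ → ℕ
  | 0, v => v
  | n + 1, v => cond (J n) (2 * spJ J j n (v / 2) + v % 2)
      (2 * spJ J j n v + cond (decide (n = j)) 1 0)

def unJ (J : ℕ → Bool) : ℕ → ℕ → ℕ
  | 0, a => a
  | n + 1, a => cond (J n) (2 * unJ J n (a / 2) + a % 2) (unJ J n (a / 2))

theorem unJ_spJ (J : ℕ → Bool) (j n v : ℕ) : unJ J n (spJ J j n v) = v := by
  induction n generalizing v with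
  | zero => rfl
  | succ n ih =>
    unfold unJ spJ
    cases J n with
    | true =>
      simp only [cond_true]
      rw [show (2 * spJ J j n (v / 2) + v % 2) / 2 = spJ J j n (v / 2) by omega, ih]
      omega
    | false =>
      simp only [cond_false]
      have : (2 * spJ J j n v + bif decide (n = j) then 1 else 0) / 2 = spJ J j n v := by
        cases decide (n = j) <;> simp <;> omega
      rw [this, ih]

theorem spJ_strictMono (J : ℕ → Bool) (j n : ℕ) : StrictMono (spJ J j n) := by
  induction n with
  | zero => exact fun a b h => h
  | succ n ih =>
    intro a b h
    unfold spJ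
    cases J n with
    | true =>
      simp only [cond_true]
      rcases Nat.lt_or_ge (a / 2) (b / 2) with h1 | h1
      · have := ih h1; omega
      · have : a / 2 = b / 2 := by omega
        rw [this]; omega
    | false =>
      simp only [cond_false]
      have := ih h; omega

theorem computable_kJ {J : ℕ → Bool} (hJ : Computable J) : Computable (kJ J) := by
  refine (c_rec (h := fun _ i r => r + cond (J i) 1 0) Computable.id (Computable.const 0)
    (cnat_add (Computable.snd.comp Computable.snd) (Computable.cond
      (hJ.comp (Computable.fst.comp Computable.snd)) (Computable.const 1)
        (Computable.const 0)))).of_eq fun n => ?_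
  show Nat.rec (motive := fun _ => ℕ) 0 (fun i r => r + cond (J i) 1 0) n = _
  induction n with
  | zero => rfl
  | succ n ih => simp only [kJ]; rw [← ih]

theorem kJ_mono (J : ℕ → Bool) : Monotone (kJ J) :=
  monotone_nat_of_le_succ fun _ => Nat.le_add_right _ _

theorem computable_spJ {J : ℕ → Bool} (hJ : Computable J) (j : ℕ) {α : Type*} [Primcodable α]
    {n v : α → ℕ} (hn : Computable n) (hv : Computable v) :
    Computable fun a => spJ J j (n a) (v a) := by
  have hk := computable_kJ hJ
  refine (c_rec (n := n) (g := fun a => v a / 2 ^ kJ J (n a))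
    (h := fun a i r => cond (J i) (2 * r + v a / 2 ^ (kJ J (n a) - kJ J (i + 1)) % 2)
      (2 * r + cond (decide (i = j)) 1 0)) hn
    (cnat_div hv (cnat_pow (Computable.const 2) (hk.comp hn))) ?_).of_eq fun a => ?_
  · have hi : Computable fun p : α × ℕ × ℕ => p.2.1 := Computable.fst.comp Computable.snd
    have hr : Computable fun p : α × ℕ × ℕ => p.2.2 := Computable.snd.comp Computable.snd
    refine Computable.cond (hJ.comp hi) (cnat_add (cnat_mul (Computable.const 2) hr)
      (cnat_mod (cnat_div (hv.comp Computable.fst) (cnat_pow (Computable.const 2)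
        (cnat_sub (hk.comp (hn.comp Computable.fst)) (hk.comp (Computable.succ.comp hi)))))
        (Computable.const 2))) (cnat_add (cnat_mul (Computable.const 2) hr)
        (Computable.cond (c_eq hi (Computable.const j)) (Computable.const 1)
          (Computable.const 0)))
  · have : ∀ i ≤ n a, Nat.rec (motive := fun _ => ℕ) (v a / 2 ^ kJ J (n a))
        (fun i r => cond (J i) (2 * r + v a / 2 ^ (kJ J (n a) - kJ J (i + 1)) % 2)
          (2 * r + cond (decide (i = j)) 1 0)) i = spJ J j i (v a / 2 ^ (kJ J (n a) - kJ J i)) := by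
      intro i
      induction i with
      | zero => intro _; rfl
      | succ i ih =>
        intro hi
        have h1 := ih (by omega)
        have hm := kJ_mono J hi
        dsimp only at h1 ⊢
        rw [h1]
        simp only [spJ]
        cases h : J i with
        | true =>
          simp only [cond_true]
          have hk1 : kJ J (i + 1) = kJ J i + 1 := by simp [kJ, h]
          rw [Nat.div_div_eq_div_mul, ← pow_succ,
            show kJ J (n a) - kJ J (i + 1) + 1 = kJ J (n a) - kJ J i by omega]
        | false =>
          have hk1 : kJ J (i + 1) = kJ J i := by simp [kJ, h]
          rw [hk1]
          rfl
    have h2 := this (n a) le_rfl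
    rw [h2]
    simp

theorem computable_unJ {J : ℕ → Bool} (hJ : Computable J) {α : Type*} [Primcodable α]
    {n v : α → ℕ} (hn : Computable n) (hv : Computable v) :
    Computable fun a => unJ J (n a) (v a) := by
  refine (c_rec (n := n) (g := fun a => v a / 2 ^ n a)
    (h := fun a i r => cond (J i) (2 * r + v a / 2 ^ (n a - (i + 1)) % 2) r) hn
    (cnat_div hv (cnat_pow (Computable.const 2) hn)) ?_).of_eq fun a => ?_
  · have hi : Computable fun p : α × ℕ × ℕ => p.2.1 := Computable.fst.comp Computable.snd
    have hr : Computable fun p : α × ℕ × ℕ => p.2.2 := Computable.snd.comp Computable.snd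
    exact Computable.cond (hJ.comp hi) (cnat_add (cnat_mul (Computable.const 2) hr)
      (cnat_mod (cnat_div (hv.comp Computable.fst) (cnat_pow (Computable.const 2)
        (cnat_sub (hn.comp Computable.fst) (Computable.succ.comp hi))))
        (Computable.const 2))) hr
  · have : ∀ i ≤ n a, Nat.rec (motive := fun _ => ℕ) (v a / 2 ^ n a)
        (fun i r => cond (J i) (2 * r + v a / 2 ^ (n a - (i + 1)) % 2) r) i
          = unJ J i (v a / 2 ^ (n a - i)) := by
      intro i
      induction i with
      | zero => intro _; rfl
      | succ i ih =>
        intro hi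
        have h1 := ih (by omega)
        dsimp only at h1 ⊢
        rw [h1]
        simp only [unJ]
        rw [Nat.div_div_eq_div_mul, ← pow_succ, show n a - (i + 1) + 1 = n a - i by omega]
    have h2 := this (n a) le_rfl
    rw [h2]
    simp

/-- digits of the spread of `x` -/
noncomputable def spA (J : ℕ → Bool) (j : ℕ) (x : ℝ) (n : ℕ) : ℕ := spJ J j n ⌊x * 2 ^ kJ J n⌋₊

theorem floor_half (x : ℝ) (k : ℕ) : ⌊x * 2 ^ (k + 1)⌋₊ / 2 = ⌊x * 2 ^ k⌋₊ := by
  rw [← Nat.floor_div_ofNat]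
  congr 1
  rw [pow_succ, ← mul_assoc]
  simp

theorem spA_zero {J : ℕ → Bool} {j : ℕ} {x : ℝ} (hx : x < 1) : spA J j x 0 = 0 := by
  unfold spA spJ kJ
  rw [Nat.floor_eq_zero]
  simpa using hx

theorem spA_true {J : ℕ → Bool} {j : ℕ} {x : ℝ} {n : ℕ} (h : J n = true) :
    spA J j x (n + 1) = 2 * spA J j x n + ⌊x * 2 ^ (kJ J n + 1)⌋₊ % 2 := by
  unfold spA
  simp only [spJ, kJ, h, cond_true]
  rw [floor_half]

theorem spA_false {J : ℕ → Bool} {j : ℕ} {x : ℝ} {n : ℕ} (h : J n = false) :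
    spA J j x (n + 1) = 2 * spA J j x n + cond (decide (n = j)) 1 0 := by
  unfold spA
  simp only [spJ, kJ, h, cond_false, add_zero]

theorem spA_half (J : ℕ → Bool) (j : ℕ) (x : ℝ) (n : ℕ) : spA J j x (n + 1) / 2 = spA J j x n := by
  cases h : J n with
  | true => rw [spA_true h]; omega
  | false => rw [spA_false h]; cases decide (n = j) <;> simp <;> omega

theorem spA_zeros {J : ℕ → Bool} {j : ℕ} {x : ℝ} (hx : 0 ≤ x) (n : ℕ) :
    ∃ m ≥ n, spA J j x (m + 1) % 2 = 0 := by
  by_contra hcon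
  push Not at hcon
  set n0 := max n (j + 1) with hn0
  have hJ : ∀ i, J (n0 + i) = true := by
    intro i
    cases h : J (n0 + i) with
    | true => rfl
    | false =>
      exfalso
      have h1 := hcon (n0 + i) (by omega)
      rw [spA_false h] at h1
      have : n0 + i ≠ j := by omega
      simp [this] at h1
  have hk : ∀ i, kJ J (n0 + i) = kJ J n0 + i := by
    intro i
    induction i with
    | zero => rfl
    | succ i ih => rw [← add_assoc]; simp only [kJ, hJ, cond_true, ih]; omega
  set N : ℕ → ℕ := fun i => ⌊x * 2 ^ (kJ J n0 + i)⌋₊ with hN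
  have hs : ∀ i, N (i + 1) = 2 * N i + 1 := by
    intro i
    have h1 := hcon (n0 + i) (by omega)
    rw [spA_true (hJ i), hk] at h1
    have h2 := floor_half x (kJ J n0 + i)
    simp only [hN]
    rw [← add_assoc]
    omega
  have hp : ∀ i, N i + 1 = 2 ^ i * (N 0 + 1) := by
    intro i
    induction i with
    | zero => simp
    | succ i ih => rw [hs, pow_succ]; linarith
  have hlt : x * 2 ^ kJ J n0 < N 0 + 1 := by
    have := Nat.lt_floor_add_one (x * 2 ^ (kJ J n0 + 0))
    simpa [hN] using this
  have hge : ∀ i, (N 0 + 1 : ℝ) - (1 / 2) ^ i ≤ x * 2 ^ kJ J n0 := by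
    intro i
    have h1 : (N i : ℝ) ≤ x * 2 ^ (kJ J n0 + i) := Nat.floor_le (by positivity)
    have h2 : (N i : ℝ) + 1 = 2 ^ i * (N 0 + 1) := by exact_mod_cast hp i
    have h3 : ((1:ℝ) / 2) ^ i * 2 ^ i = 1 := by rw [← mul_pow]; norm_num
    rw [pow_add] at h1
    have h4 : (0:ℝ) < (1 / 2) ^ i := by positivity
    have h5 := mul_le_mul_of_nonneg_left (show (2:ℝ) ^ i * (N 0 + 1) - 1 ≤ x * (2 ^ kJ J n0 * 2 ^ i) by linarith) h4.le
    have h6 : ((1:ℝ) / 2) ^ i * (2 ^ i * (N 0 + 1) - 1) = (N 0 + 1) - (1 / 2) ^ i := by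
      rw [mul_sub, ← mul_assoc, h3]; ring
    have h7 : ((1:ℝ) / 2) ^ i * (x * (2 ^ kJ J n0 * 2 ^ i)) = x * 2 ^ kJ J n0 := by
      calc _ = (((1:ℝ) / 2) ^ i * 2 ^ i) * (x * 2 ^ kJ J n0) := by ring
        _ = _ := by rw [h3, one_mul]
    linarith
  obtain ⟨i, hi⟩ := exists_pow_lt_of_lt_one (sub_pos.2 hlt) (show (1:ℝ) / 2 < 1 by norm_num)
  have := hge i
  linarith

theorem rat_floor {w : ℚ} (hw : 0 ≤ w) (k : ℕ) : ⌊(w : ℝ) * 2 ^ k⌋₊ = rP w * 2 ^ k / w.den := by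
  have h : (w : ℝ) * 2 ^ k = ((rP w * 2 ^ k : ℕ) : ℝ) / (w.den : ℝ) := by
    have h1 : rN w = 0 := by
      unfold rN
      have := Rat.num_nonneg.2 hw
      omega
    have h2 := rat_eq w
    rw [h1] at h2
    have h3 : (w : ℝ) = (rP w : ℝ) / w.den := by
      have := congrArg (Rat.cast : ℚ → ℝ) h2
      push_cast at this
      simpa using this
    conv_lhs => rw [h3]
    push_cast
    ring
  rw [h, Nat.floor_div_eq_div]

end

section
/-! ### The diluted real -/

theorem exists_jump (D : ℝ) (hD : ComputableReal D) (hD0 : 0 ≤ D) (hD1 : D ≤ 1) (j : ℕ) :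
    ∃ J : ℕ → Bool, Computable J ∧ (∀ i, J i = true → j < i) ∧
      (∀ n, (kJ J n : ℝ) ≤ D * n + 1) ∧ ∀ n, D * n - (j + 3) ≤ kJ J n := by
  obtain ⟨f, hf, hfD⟩ := hD
  let a : ℕ → ℚ := fun n => f n * (n + 1 : ℕ)
  have ha : Computable a := crat_mul hf (crat_nat Computable.succ)
  have haD : ∀ n, |(a n : ℝ) - D * (n + 1)| ≤ 1 := by
    intro n
    have h1 := hfD n
    have h2 : ((a n : ℚ) : ℝ) - D * (n + 1) = -(D - f n) * (n + 1) := by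
      simp only [a]; push_cast; ring
    rw [h2, abs_mul, abs_neg, abs_of_nonneg (show (0:ℝ) ≤ n + 1 by positivity)]
    have h3 : ((n : ℝ) + 1) ≤ 2 ^ n := by exact_mod_cast Nat.lt_two_pow_self (n := n)
    have h4 : ((2:ℝ)⁻¹) ^ n * 2 ^ n = 1 := by rw [← mul_pow]; norm_num
    calc |D - f n| * ((n:ℝ) + 1) ≤ (2:ℝ)⁻¹ ^ n * 2 ^ n := by gcongr
      _ = 1 := h4
  let K : ℕ → ℕ := fun n => Nat.rec (motive := fun _ => ℕ) 0
    (fun i r => if j < i ∧ ((r + 1 : ℕ) : ℚ) ≤ a i then r + 1 else r) n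
  have hKc : Computable K := by
    refine c_rec (h := fun _ i r => if j < i ∧ ((r + 1 : ℕ) : ℚ) ≤ a i then r + 1 else r)
      Computable.id (Computable.const 0) ?_
    have hi : Computable fun p : ℕ × ℕ × ℕ => p.2.1 := Computable.fst.comp Computable.snd
    have hr : Computable fun p : ℕ × ℕ × ℕ => p.2.2 := Computable.snd.comp Computable.snd
    exact c_ite (c_dand (cnat_lt (Computable.const j) hi)
      (crat_le (crat_nat (Computable.succ.comp hr)) (ha.comp hi))) (Computable.succ.comp hr) hr
  let J : ℕ → Bool := fun i => decide (j < i ∧ ((K i + 1 : ℕ) : ℚ) ≤ a i)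
  have hJ : Computable J := c_dand (cnat_lt (Computable.const j) Computable.id)
      (crat_le (crat_nat (Computable.succ.comp hKc)) ha)
  have hKJ : ∀ n, kJ J n = K n := by
    intro n
    induction n with
    | zero => rfl
    | succ n ih =>
      show kJ J n + cond (J n) 1 0 = if j < n ∧ ((K n + 1 : ℕ) : ℚ) ≤ a n then K n + 1 else K n
      rw [ih]
      by_cases h : j < n ∧ ((K n + 1 : ℕ) : ℚ) ≤ a n
      · have : J n = true := by simp only [J]; exact decide_eq_true h
        rw [this, if_pos h]; rfl
      · have : J n = false := by simp only [J]; exact decide_eq_false h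
        rw [this, if_neg h]; rfl
  have hstep : ∀ n, (j < n ∧ ((kJ J n : ℝ) + 1) ≤ a n ∧ kJ J (n + 1) = kJ J n + 1) ∨
      ((j < n → (a n : ℝ) < kJ J n + 1) ∧ kJ J (n + 1) = kJ J n) := by
    intro n
    by_cases h : j < n ∧ ((K n + 1 : ℕ) : ℚ) ≤ a n
    · left
      have : J n = true := by simp only [J]; exact decide_eq_true h
      refine ⟨h.1, ?_, by simp [kJ, this]⟩
      rw [hKJ]
      have := h.2
      have h' := (Rat.cast_le (K := ℝ)).2 this
      push_cast at h'
      exact h'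
    · right
      have : J n = false := by simp only [J]; exact decide_eq_false h
      refine ⟨fun hj => ?_, by simp [kJ, this]⟩
      rw [hKJ]
      have h1 : a n < ((K n + 1 : ℕ) : ℚ) := by
        by_contra hc
        exact h ⟨hj, not_lt.1 hc⟩
      have h' := (Rat.cast_lt (K := ℝ)).2 h1
      push_cast at h'
      exact h'
  refine ⟨J, hJ, fun i hi => ?_, fun n => ?_, fun n => ?_⟩
  · exact (of_decide_eq_true hi).1
  · induction n with
    | zero => simp [kJ]
    | succ n ih =>
      have h1 := abs_le.1 (haD n)
      push_cast
      rcases hstep n with ⟨_, h2, h3⟩ | ⟨_, h3⟩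
      · rw [h3]; push_cast; linarith
      · rw [h3]; linarith
  · induction n with
    | zero => simp [kJ]; linarith
    | succ n ih =>
      have h1 := abs_le.1 (haD n)
      push_cast
      rcases hstep n with ⟨_, h2, h3⟩ | ⟨h2, h3⟩
      · rw [h3]; push_cast; linarith
      · rw [h3]
        by_cases hj : j < n
        · have := h2 hj
          have : (0:ℝ) ≤ j := by positivity
          linarith
        · have h4 : (n:ℝ) ≤ j := by exact_mod_cast not_lt.1 hj
          have h5 : (0:ℝ) ≤ kJ J n := by positivity
          have h6 : D * (n + 1) ≤ 1 * (n + 1) := by gcongr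
          linarith

theorem dilute (U : OptimalComputer) (D : ℝ) (hD : ComputableReal D) (hD0 : 0 ≤ D) (hD1 : D ≤ 1)
    (j : ℕ) : ∃ y : ℝ, RightComputableReal y ∧ (1 / 2 : ℝ) ^ (j + 1) ≤ y ∧ y < (1 / 2 : ℝ) ^ j ∧
      WeaklyChaitinDRandom U D y ∧ DCompressible U D y ∧
      Tendsto (fun n : ℕ => (Kc U (binPrefix y n) : ℝ) / n) atTop (nhds D) := by
  obtain ⟨J, hJ, hJj, hk1, hk2⟩ := exists_jump D hD hD0 hD1 j
  obtain ⟨w, z, ω, hw, hz, hwa, hw01, hwt, hwz⟩ := random_real U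
  have hkc := computable_kJ hJ
  have hωw : ∀ t, ω ≤ w t := by
    intro t
    have hanti : Antitone fun t => (w t : ℝ) := fun a b h => by
      dsimp only; exact_mod_cast hwa h
    exact hanti.le_of_tendsto hwt t
  have hω0 : 0 ≤ ω := ge_of_tendsto' hwt fun t => by exact_mod_cast (hw01 t).1
  have hw1 : ∀ t, (w t : ℝ) < 1 := fun t => by
    have : w t < 1 := lt_of_le_of_lt (hw01 t).2 (by norm_num)
    exact_mod_cast this
  have hw0 : ∀ t, (0:ℝ) ≤ w t := fun t => by exact_mod_cast (hw01 t).1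
  have hω1 : ω < 1 := (hωw 0).trans_lt (hw1 0)
  set A := spA J j ω with hAdef
  have hA0 : A 0 = 0 := spA_zero hω1
  have hA : ∀ n, A (n + 1) / 2 = A n := spA_half J j ω
  obtain ⟨y, hy⟩ := exists_real_of_digits A hA0 hA (spA_zeros hω0)
  have hpre : ∀ n, binPrefix y n = bitsOf n (A n) := binPrefix_eq hA0 hA hy
  have hAlt : ∀ n, A n < 2 ^ n := by
    intro n
    have h1 := half_iter hA 0 n
    rw [hA0, zero_add] at h1
    exact (Nat.div_eq_zero_iff_lt (by positivity)).1 h1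
  -- weak randomness
  have hweak : ∃ c : ℕ, ∀ n, kJ J n ≤ Kc U (binPrefix y n) + c := by
    let g : Str →. Str := fun s => (Nat.rfind fun t => Part.some
      (decide (w t * (2 ^ kJ J s.length : ℕ) < (unJ J s.length (valOf s) + 1 : ℕ)))).map z
    have hg : Partrec g := by
      have hp : Computable₂ fun (s : Str) (t : ℕ) => decide (w t * (2 ^ kJ J s.length : ℕ) <
          (unJ J s.length (valOf s) + 1 : ℕ)) := ?_
      · exact Partrec.map (Partrec.rfind hp.partrec₂) (hz.comp Computable.snd)
      have hl : Computable fun p : Str × ℕ => p.1.length :=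
        Computable.list_length.comp Computable.fst
      exact crat_lt (crat_mul (hw.comp Computable.snd) (crat_nat (cnat_pow (Computable.const 2)
        (hkc.comp hl)))) (crat_nat (Computable.succ.comp (computable_unJ hJ hl
          (computable_valOf.comp Computable.fst))))
    obtain ⟨c, hc⟩ := Kc_comp U g hg
    refine ⟨c, fun n => ?_⟩
    have hval : unJ J (binPrefix y n).length (valOf (binPrefix y n)) = ⌊ω * 2 ^ kJ J n⌋₊ := by
      rw [hpre, bitsOf_length, valOf_bitsOf _ _ (hAlt n), hAdef]
      exact unJ_spJ _ _ _ _
    have hlen : (binPrefix y n).length = n := by rw [hpre, bitsOf_length]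
    have hiff : ∀ t, w t * (2 ^ kJ J (binPrefix y n).length : ℕ) <
        (unJ J (binPrefix y n).length (valOf (binPrefix y n)) + 1 : ℕ) ↔
        (w t : ℝ) * 2 ^ kJ J n < (⌊ω * 2 ^ kJ J n⌋₊ : ℝ) + 1 := by
      intro t
      rw [hval, hlen, ← Rat.cast_lt (K := ℝ)]
      push_cast
      rfl
    have hex : ∃ t, (w t : ℝ) * 2 ^ kJ J n < (⌊ω * 2 ^ kJ J n⌋₊ : ℝ) + 1 := by
      have h1 : Tendsto (fun t => (w t : ℝ) * 2 ^ kJ J n) atTop (𝓝 (ω * 2 ^ kJ J n)) :=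
        hwt.mul_const _
      exact (h1.eventually_lt_const (Nat.lt_floor_add_one _)).exists
    have hdom : (Nat.rfind fun t => Part.some
      (decide (w t * (2 ^ kJ J (binPrefix y n).length : ℕ) <
        (unJ J (binPrefix y n).length (valOf (binPrefix y n)) + 1 : ℕ)))).Dom := by
      obtain ⟨t, ht⟩ := hex
      refine Nat.rfind_dom.2 ⟨t, ?_, fun _ => trivial⟩
      rw [Part.mem_some_iff]
      exact (decide_eq_true ((hiff t).2 ht)).symm
    obtain ⟨t, ht⟩ := Part.dom_iff_mem.1 hdom
    have ht2 := Nat.rfind_spec ht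
    rw [Part.mem_some_iff] at ht2
    have ht3 := (hiff t).1 (of_decide_eq_true ht2.symm)
    have h1 := hc (binPrefix y n) (z t) (Part.mem_map z ht)
    refine le_trans (hwz t _ ?_) h1
    have h2 : (⌊ω * 2 ^ kJ J n⌋₊ : ℝ) ≤ ω * 2 ^ kJ J n := Nat.floor_le (by positivity)
    rw [div_pow, one_pow, lt_div_iff₀ (by positivity)]
    linarith
  -- upper bound
  have hup : ∃ c : ℕ, ∀ n, Kc U (binPrefix y n) ≤ kJ J n + 2 * Nat.sqrt n + c := by
    obtain ⟨c, hc⟩ := coder U (kJ J) hkc (fun n x => bitsOf n (spJ J j n (valOf x)))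
      (c_bitsOf Computable.fst (computable_spJ hJ j Computable.fst
        (computable_valOf.comp Computable.snd)))
    refine ⟨c, fun n => ?_⟩
    obtain ⟨p, hp, hl⟩ := hc n (bitsOf (kJ J n) ⌊ω * 2 ^ kJ J n⌋₊) (bitsOf_length _ _)
    rw [valOf_bitsOf] at hp
    · refine le_trans (Kc_le U ?_) hl
      rw [hpre]; exact hp
    · rw [Nat.floor_lt (by positivity)]
      push_cast
      have : (0:ℝ) < 2 ^ kJ J n := by positivity
      nlinarith
  obtain ⟨c1, hc1⟩ := hweak
  obtain ⟨c2, hc2⟩ := hup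
  have hlow : ∀ n : ℕ, D * n - ((j + 3 + c1 : ℕ) : ℝ) ≤ Kc U (binPrefix y n) := by
    intro n
    have h1 := hk2 n
    have h2 : (kJ J n : ℝ) ≤ Kc U (binPrefix y n) + c1 := by exact_mod_cast hc1 n
    push_cast
    linarith
  have htend : Tendsto (fun n : ℕ => (Kc U (binPrefix y n) : ℝ) / n) atTop (nhds D) := by
    have hl : Tendsto (fun n : ℕ => D - ((j + 3 + c1 : ℕ) : ℝ) / n) atTop (𝓝 D) := by
      simpa using (tendsto_const_div_atTop_nhds_zero_nat ((j + 3 + c1 : ℕ) : ℝ)).const_sub D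
    have hs : Tendsto (fun n : ℕ => (2:ℝ) / Real.sqrt n) atTop (𝓝 0) :=
      (Real.tendsto_sqrt_atTop.comp tendsto_natCast_atTop_atTop).const_div_atTop 2
    have hr : Tendsto (fun n : ℕ => D + ((1 + c2 : ℕ) : ℝ) / n + 2 / Real.sqrt n) atTop (𝓝 D) := by
      simpa using ((tendsto_const_div_atTop_nhds_zero_nat ((1 + c2 : ℕ) : ℝ)).const_add D).add hs
    refine tendsto_of_tendsto_of_tendsto_of_le_of_le' hl hr ?_ ?_
    · filter_upwards [eventually_gt_atTop 0] with n hn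
      have hn' : (0:ℝ) < n := by exact_mod_cast hn
      rw [le_div_iff₀ hn', sub_mul, div_mul_cancel₀ _ hn'.ne']
      exact hlow n
    · filter_upwards [eventually_gt_atTop 0] with n hn
      have hn' : (0:ℝ) < n := by exact_mod_cast hn
      have hsq : 0 < Real.sqrt n := Real.sqrt_pos.2 hn'
      rw [div_le_iff₀ hn', add_mul, add_mul, div_mul_cancel₀ _ hn'.ne']
      have h1 : (2 / Real.sqrt n) * n = 2 * Real.sqrt n := by
        have := Real.mul_self_sqrt hn'.le
        field_simp
        rw [sq]; linarith
      rw [h1]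
      have h2 : (Kc U (binPrefix y n) : ℝ) ≤ kJ J n + 2 * Nat.sqrt n + c2 := by exact_mod_cast hc2 n
      have h3 := hk1 n
      have h4 : (Nat.sqrt n : ℝ) ≤ Real.sqrt n := Real.nat_sqrt_le_real_sqrt
      push_cast
      linarith
  refine ⟨y, ?_, ?_, ?_, ⟨_, hlow⟩, le_of_eq htend.limsup_eq, htend⟩
  · -- right-computability
    have hle : ∀ t n, n ≤ t → (spA J j (w t) t : ℝ) / 2 ^ t ≤ (spA J j (w t) n + 1) / 2 ^ n := by
      intro t n hnt
      have h1 := half_iter (spA_half J j (w t)) n (t - n)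
      rw [show n + (t - n) = t by omega] at h1
      have h2 : spA J j (w t) t < 2 ^ (t - n) * (spA J j (w t) n + 1) := by
        rw [← h1]
        exact Nat.lt_mul_div_succ _ (by positivity)
      have h3 : (spA J j (w t) t : ℝ) < 2 ^ (t - n) * (spA J j (w t) n + 1) := by exact_mod_cast h2
      rw [div_le_div_iff₀ (by positivity) (by positivity)]
      have h4 : (2:ℝ) ^ t = 2 ^ (t - n) * 2 ^ n := by rw [← pow_add]; congr 1; omega
      rw [h4]
      have : (0:ℝ) < 2 ^ n := by positivity
      nlinarith
    have hge : ∀ t, A t ≤ spA J j (w t) t := by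
      intro t
      refine (spJ_strictMono J j t).monotone (Nat.floor_mono ?_)
      have := hωw t
      gcongr
    refine ⟨fun t => ((spJ J j t (rP (w t) * 2 ^ kJ J t / (w t).den) + 1 : ℕ) : ℚ) / (2 ^ t : ℕ),
      ?_, ?_, ?_⟩
    · exact crat_natdiv (Computable.succ.comp (computable_spJ hJ j Computable.id
        (cnat_div (cnat_mul (computable_rP.comp hw) (cnat_pow (Computable.const 2) hkc))
          (computable_den.comp hw)))) (cnat_pow (Computable.const 2) Computable.id)
    · intro t
      dsimp only
      rw [← rat_floor (hw01 t).1]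
      push_cast
      refine (hy t).2.le.trans ?_
      have : (A t : ℝ) ≤ spA J j (w t) t := by exact_mod_cast hge t
      show _ ≤ ((spA J j (w t) t : ℝ) + 1) / 2 ^ t
      gcongr
    · have hrw : ∀ t, (((((spJ J j t (rP (w t) * 2 ^ kJ J t / (w t).den) + 1 : ℕ) : ℚ) /
          (2 ^ t : ℕ)) : ℚ) : ℝ) = (spA J j (w t) t : ℝ) / 2 ^ t + (1 / 2) ^ t := by
        intro t
        rw [← rat_floor (hw01 t).1]
        push_cast
        show ((spA J j (w t) t : ℝ) + 1) / 2 ^ t = _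
        rw [add_div, one_div_pow]
      simp only [hrw]
      rw [Metric.tendsto_atTop]
      intro ε hε
      obtain ⟨n, hn⟩ := exists_pow_lt_of_lt_one (half_pos hε) (show (1:ℝ) / 2 < 1 by norm_num)
      have hfl : ∀ᶠ t in atTop, ⌊(w t : ℝ) * 2 ^ kJ J n⌋₊ = ⌊ω * 2 ^ kJ J n⌋₊ := by
        have h1 : Tendsto (fun t => (w t : ℝ) * 2 ^ kJ J n) atTop (𝓝 (ω * 2 ^ kJ J n)) :=
          hwt.mul_const _
        filter_upwards [h1.eventually_lt_const (Nat.lt_floor_add_one _)] with t ht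
        rw [Nat.floor_eq_iff (mul_nonneg (hw0 t) (by positivity))]
        refine ⟨(Nat.floor_le (by positivity)).trans ?_, ht⟩
        have := hωw t
        gcongr
      obtain ⟨T, hT⟩ := eventually_atTop.1 hfl
      refine ⟨max n T, fun t ht => ?_⟩
      have h1 := hle t n (le_trans (le_max_left _ _) ht)
      have h2 : spA J j (w t) n = A n := by
        rw [hAdef]; unfold spA; rw [hT t (le_trans (le_max_right _ _) ht)]
      rw [h2] at h1
      have h3 := (hy n).1
      have h4 : ((1:ℝ) / 2) ^ t ≤ (1 / 2) ^ n :=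
        pow_le_pow_of_le_one (by norm_num) (by norm_num) (le_trans (le_max_left _ _) ht)
      have h5 : ((A n : ℝ) + 1) / 2 ^ n = (A n : ℝ) / 2 ^ n + (1 / 2) ^ n := by
        rw [add_div, one_div_pow]
      have h6 := (hy t).2
      have h7 : ((A t : ℝ) + 1) / 2 ^ t ≤ ((spA J j (w t) t : ℝ) + 1) / 2 ^ t := by
        have : (A t : ℝ) ≤ spA J j (w t) t := by exact_mod_cast hge t
        gcongr
      have h8 : ((spA J j (w t) t : ℝ) + 1) / 2 ^ t = (spA J j (w t) t : ℝ) / 2 ^ t + (1 / 2) ^ t := by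
        rw [add_div, one_div_pow]
      rw [Real.dist_eq, abs_lt]
      constructor <;> linarith
  · have h1 := (hy (j + 1)).1
    have h2 : A (j + 1) = 2 * A j + 1 := by
      have : J j = false := by
        cases h : J j with
        | false => rfl
        | true => exact absurd (hJj j h) (lt_irrefl _)
      have := spA_false (j := j) (x := ω) this
      simpa using this
    rw [one_div_pow]
    refine le_trans ?_ h1
    have h3 : (1:ℝ) ≤ A (j + 1) := by rw [h2]; push_cast; linarith [show (0:ℝ) ≤ A j by positivity]
    gcongr
  · have hz : ∀ i ≤ j, A i = 0 := by
      intro i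
      induction i with
      | zero => intro _; exact hA0
      | succ i ih =>
        intro hi
        have : J i = false := by
          cases h : J i with
          | false => rfl
          | true => have := hJj i h; omega
        have h1 := spA_false (j := j) (x := ω) this
        rw [hAdef, h1, ← hAdef, ih (by omega)]
        have : i ≠ j := by omega
        simp [this]
    have := (hy j).2
    rw [hz j le_rfl] at this
    rw [one_div_pow]
    simpa using this

end

section
open Nat.Partrec (Code)
open Nat.Partrec.Code (evaln)

/-! ### A universal lower-computable semimeasure -/

def uG (e t : ℕ) (s : Str) (n : ℕ) : ℚ :=
  (evaln t (Denumerable.ofNat Code e) (Nat.pair n (Encodable.encode s))).elim 0 rdec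

def uV (e t : ℕ) (s : Str) : ℚ := if Encodable.encode s < t then rmax (uG e t s) t else 0

noncomputable def uT (e t : ℕ) : ℚ := ∑ s ∈ strFin t, uV e t s

noncomputable def uW (e t : ℕ) (s : Str) : ℚ := if uT e t ≤ 1 then uV e t s else 0

noncomputable def uU (e t : ℕ) (s : Str) : ℚ := rmax (fun t' => uW e t' s) t

noncomputable def uM (t : ℕ) (s : Str) : ℚ := ∑ e ∈ Finset.range t, (1 / 2 : ℚ) ^ (e + 1) * uU e t s

theorem uV_nonneg (e t : ℕ) (s : Str) : 0 ≤ uV e t s := by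
  unfold uV; split_ifs
  · exact rmax_nonneg _ _
  · exact le_rfl

theorem uV_mono (e : ℕ) (s : Str) : Monotone fun t => uV e t s := by
  intro t t' h
  dsimp only
  by_cases hs : Encodable.encode s < t
  · unfold uV
    rw [if_pos hs, if_pos (hs.trans_le h)]
    rcases rmax_cases (uG e t s) t with h0 | ⟨i, hi, h1⟩
    · rw [h0]; exact rmax_nonneg _ _
    · rw [h1]
      cases hev : evaln t (Denumerable.ofNat Code e) (Nat.pair i (Encodable.encode s)) with
      | none =>
        have : uG e t s i = 0 := by unfold uG; rw [hev]; rfl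
        rw [this]; exact rmax_nonneg _ _
      | some x =>
        have h2 : evaln t' (Denumerable.ofNat Code e) (Nat.pair i (Encodable.encode s)) = some x :=
          Nat.Partrec.Code.evaln_mono h hev
        have : uG e t s i = uG e t' s i := by unfold uG; rw [hev, h2]
        rw [this]; exact le_rmax _ (hi.trans_le h)
  · have : uV e t s = 0 := by unfold uV; rw [if_neg hs]
    rw [this]; exact uV_nonneg _ _ _

theorem uU_nonneg (e t : ℕ) (s : Str) : 0 ≤ uU e t s := rmax_nonneg _ _

theorem uU_mono (e : ℕ) (s : Str) : Monotone fun t => uU e t s := rmax_mono _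

theorem uW_le (e t : ℕ) (s : Str) : uW e t s ≤ uV e t s := by
  unfold uW; split_ifs
  · exact le_rfl
  · exact uV_nonneg _ _ _

theorem uU_bound (e t : ℕ) : ∃ t', uT e t' ≤ 1 ∧ ∀ s, uU e t s ≤ uV e t' s := by
  induction t with
  | zero =>
    refine ⟨0, ?_, fun s => ?_⟩
    · unfold uT
      rw [Finset.sum_eq_zero]
      · norm_num
      · intro s _; unfold uV; simp
    · exact uV_nonneg _ _ _
  | succ t ih =>
    by_cases h : uT e t ≤ 1
    · refine ⟨t, h, fun s => ?_⟩
      unfold uU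
      rcases rmax_cases (fun t' => uW e t' s) (t + 1) with h0 | ⟨i, hi, h1⟩
      · rw [h0]; exact uV_nonneg _ _ _
      · rw [h1]; exact (uW_le e i s).trans (uV_mono e s (Nat.lt_succ_iff.1 hi))
    · obtain ⟨t', h1, h2⟩ := ih
      refine ⟨t', h1, fun s => ?_⟩
      have : uU e (t + 1) s = max (uU e t s) (uW e t s) := rfl
      rw [this]
      refine max_le (h2 s) ?_
      unfold uW; rw [if_neg h]; exact uV_nonneg _ _ _

theorem uU_sum (e t : ℕ) (F : Finset Str) : ∑ s ∈ F, uU e t s ≤ 1 := by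
  obtain ⟨t', h1, h2⟩ := uU_bound e t
  refine (Finset.sum_le_sum fun s _ => h2 s).trans (le_trans ?_ h1)
  unfold uT
  have h3 : ∑ s ∈ F, uV e t' s = ∑ s ∈ F.filter (fun s => s ∈ strFin t'), uV e t' s := by
    rw [Finset.sum_filter_of_ne]
    intro s _ hs
    by_contra hc
    rw [mem_strFin] at hc
    exact hs (by unfold uV; rw [if_neg hc])
  rw [h3]
  exact Finset.sum_le_sum_of_subset_of_nonneg (fun s hs => (Finset.mem_filter.1 hs).2)
    fun s _ _ => uV_nonneg _ _ _

theorem uM_nonneg (t : ℕ) (s : Str) : 0 ≤ uM t s :=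
  Finset.sum_nonneg fun e _ => mul_nonneg (by positivity) (uU_nonneg _ _ _)

theorem uM_mono (s : Str) : Monotone fun t => uM t s := by
  intro t t' h
  unfold uM
  dsimp only
  refine (Finset.sum_le_sum fun e _ => mul_le_mul_of_nonneg_left (uU_mono e s h)
    (by positivity)).trans (Finset.sum_le_sum_of_subset_of_nonneg ?_ fun e _ _ =>
      mul_nonneg (by positivity) (uU_nonneg _ _ _))
  exact Finset.range_mono h

theorem uM_sum (t : ℕ) (F : Finset Str) : ∑ s ∈ F, uM t s ≤ 1 := by
  unfold uM
  rw [Finset.sum_comm]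
  have h1 : ∀ e ∈ Finset.range t, ∑ s ∈ F, (1 / 2 : ℚ) ^ (e + 1) * uU e t s ≤ (1 / 2) ^ (e + 1) := by
    intro e _
    rw [← Finset.mul_sum]
    have := uU_sum e t F
    have h2 : (0:ℚ) < (1 / 2) ^ (e + 1) := by positivity
    nlinarith
  refine (Finset.sum_le_sum h1).trans ?_
  have h3 : ∀ t, ∑ e ∈ Finset.range t, (1 / 2 : ℚ) ^ (e + 1) = 1 - (1 / 2) ^ t := by
    intro t
    induction t with
    | zero => simp
    | succ t ih => rw [Finset.sum_range_succ, ih, pow_succ]; ring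
  rw [h3]
  have : (0:ℚ) < (1 / 2) ^ t := by positivity
  linarith

theorem c_evaln2 {α : Type*} [Primcodable α] {t e n : α → ℕ} (ht : Computable t)
    (he : Computable e) (hn : Computable n) :
    Computable fun a => evaln (t a) (Denumerable.ofNat Code (e a)) (n a) :=
  Nat.Partrec.Code.primrec_evaln.to_comp.comp
    ((ht.pair ((Computable.ofNat Code).comp he)).pair hn)

theorem c_uG {α : Type*} [Primcodable α] {t e n : α → ℕ} {s : α → Str} (he : Computable e)
    (ht : Computable t) (hs : Computable s) (hn : Computable n) :
    Computable fun a => uG (e a) (t a) (s a) (n a) := by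
  have h1 := c_evaln2 ht he (Primrec₂.natPair.to_comp.comp hn (Computable.encode.comp hs))
  refine (Computable.option_casesOn (f := fun _ => (0:ℚ)) (g := fun _ x => rdec x) h1
    (Computable.const 0) (computable_rdec.comp Computable.snd)).of_eq fun p => ?_
  unfold uG
  cases evaln (t p) (Denumerable.ofNat Code (e p)) (Nat.pair (n p) (Encodable.encode (s p))) <;> rfl

theorem c_uV {α : Type*} [Primcodable α] {t e : α → ℕ} {s : α → Str} (he : Computable e)
    (ht : Computable t) (hs : Computable s) : Computable fun a => uV (e a) (t a) (s a) := by
  simp only [uV]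
  exact c_ite (cnat_lt (Computable.encode.comp hs) ht)
    (crat_rmax (F := fun a => uG (e a) (t a) (s a)) (c_uG (he.comp Computable.fst)
      (ht.comp Computable.fst) (hs.comp Computable.fst) Computable.snd) ht) (Computable.const 0)

theorem c_uT {α : Type*} [Primcodable α] {t e : α → ℕ} (he : Computable e)
    (ht : Computable t) : Computable fun a => uT (e a) (t a) := by
  simp only [uT]
  exact crat_sum_str (F := fun a => uV (e a) (t a)) (c_uV (he.comp Computable.fst)
    (ht.comp Computable.fst) Computable.snd) ht

theorem c_uW {α : Type*} [Primcodable α] {t e : α → ℕ} {s : α → Str} (he : Computable e)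
    (ht : Computable t) (hs : Computable s) : Computable fun a => uW (e a) (t a) (s a) := by
  have h1 : Computable fun a => uT (e a) (t a) := c_uT he ht
  have h2 : Computable fun a => uV (e a) (t a) (s a) := c_uV he ht hs
  simp only [uW]
  exact c_ite (crat_le h1 (Computable.const 1)) h2 (Computable.const 0)

theorem c_uU {α : Type*} [Primcodable α] {t e : α → ℕ} {s : α → Str} (he : Computable e)
    (ht : Computable t) (hs : Computable s) : Computable fun a => uU (e a) (t a) (s a) := by
  unfold uU
  exact crat_rmax (F := fun a t' => uW (e a) t' (s a)) (c_uW (he.comp Computable.fst)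
    Computable.snd (hs.comp Computable.fst)) ht

theorem computable_uM : Computable₂ uM := by
  have : Computable fun p : ℕ × Str => uM p.1 p.2 := by
    unfold uM
    refine crat_sum (F := fun (p : ℕ × Str) e => (1 / 2 : ℚ) ^ (e + 1) * uU e p.1 p.2) ?_
      Computable.fst
    exact crat_mul (crat_half (Computable.succ.comp Computable.snd)) (c_uU Computable.snd
      (Computable.fst.comp Computable.fst) (Computable.snd.comp Computable.fst))
  exact this

noncomputable def uInf (s : Str) : ℝ := ⨆ t, (uM t s : ℝ)

theorem uM_le_one (t : ℕ) (s : Str) : uM t s ≤ 1 := by simpa using uM_sum t {s}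

theorem uM_bdd (s : Str) : BddAbove (Set.range fun t => (uM t s : ℝ)) :=
  ⟨1, by rintro _ ⟨t, rfl⟩; dsimp only; exact_mod_cast uM_le_one t s⟩

theorem uM_tendsto (s : Str) : Tendsto (fun t => (uM t s : ℝ)) atTop (𝓝 (uInf s)) :=
  tendsto_atTop_ciSup (fun a b h => by
    have := uM_mono s h
    exact_mod_cast this) (uM_bdd s)

theorem uM_le (t : ℕ) (s : Str) : (uM t s : ℝ) ≤ uInf s := le_ciSup (uM_bdd s) t

theorem uInf_nonneg (s : Str) : 0 ≤ uInf s :=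
  le_trans (by exact_mod_cast uM_nonneg 0 s) (uM_le 0 s)

theorem uInf_sum (F : Finset Str) : ∑ s ∈ F, uInf s ≤ 1 := by
  have h := tendsto_finsetSum F fun s _ => uM_tendsto s
  refine le_of_tendsto' h fun t => ?_
  have := uM_sum t F
  exact_mod_cast this

theorem uInf_dom (r : Str → ℝ) (hr : LCSemiMeasure r) :
    ∃ c : ℝ, 0 < c ∧ ∀ s, c * r s ≤ uInf s := by
  obtain ⟨⟨hr0, hr1⟩, f, hf, hfr⟩ := hr
  obtain ⟨c, hc⟩ := Nat.Partrec.Code.exists_code.1 (Computable.partrec hf)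
  have hev : ∀ n (s : Str), c.eval (Nat.pair n (Encodable.encode s)) = Part.some (renc (f n s)) := by
    intro n s
    rw [hc]
    have : Nat.pair n (Encodable.encode s) = Encodable.encode (n, s) := rfl
    simp only [this, Encodable.encodek]
    simp
    rfl
  set e := Encodable.encode c with he
  have hoc : Denumerable.ofNat Code e = c := Denumerable.ofNat_encode c
  have hG : ∀ t s n, uG e t s n = 0 ∨ uG e t s n = f n s := by
    intro t s n
    unfold uG
    rw [hoc]
    cases h : evaln t c (Nat.pair n (Encodable.encode s)) with
    | none => left; rfl
    | some x =>
      right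
      have h1 := Nat.Partrec.Code.evaln_sound h
      rw [hev, Part.mem_some_iff] at h1
      rw [h1]
      exact rdec_renc _
  have hV : ∀ t s, (uV e t s : ℝ) ≤ r s := by
    intro t s
    unfold uV
    split_ifs
    · rcases rmax_cases (uG e t s) t with h0 | ⟨i, hi, h1⟩
      · rw [h0]; simpa using (hr0 s).1
      · rw [h1]
        rcases hG t s i with h2 | h2
        · rw [h2]; simpa using (hr0 s).1
        · rw [h2]; exact ((hfr s).1 i).2
    · simpa using (hr0 s).1
  have hT : ∀ t, uT e t ≤ 1 := by
    intro t
    have : (uT e t : ℝ) ≤ 1 := by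
      unfold uT
      push_cast
      exact (Finset.sum_le_sum fun s _ => hV t s).trans (hr1 _)
    exact_mod_cast this
  refine ⟨(1 / 2 : ℝ) ^ (e + 1), by positivity, fun s => ?_⟩
  have hlim : Tendsto (fun n => (1 / 2 : ℝ) ^ (e + 1) * (f n s : ℝ)) atTop
      (𝓝 ((1 / 2 : ℝ) ^ (e + 1) * r s)) := (hfr s).2.const_mul _
  refine le_of_tendsto' hlim fun n => ?_
  have hx : renc (f n s) ∈ c.eval (Nat.pair n (Encodable.encode s)) := by rw [hev]; exact Part.mem_some _
  obtain ⟨k, hk⟩ := Nat.Partrec.Code.evaln_complete.1 hx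
  set t := max k (max (n + 1) (max (e + 1) (Encodable.encode s + 1))) with ht
  have hk' : evaln t c (Nat.pair n (Encodable.encode s)) = some (renc (f n s)) :=
    Nat.Partrec.Code.evaln_mono (le_max_left _ _) hk
  have h1 : f n s ≤ uV e t s := by
    unfold uV
    rw [if_pos (by omega)]
    refine le_trans (le_of_eq ?_) (le_rmax _ (show n < t by omega))
    unfold uG
    rw [hoc, hk']
    exact (rdec_renc _).symm
  have h2 : uV e t s ≤ uU e (t + 1) s := by
    refine le_trans (le_of_eq ?_) (le_rmax (fun t' => uW e t' s) (Nat.lt_succ_self t))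
    simp only [uW]
    rw [if_pos (hT t)]
  have h3 : (1 / 2 : ℚ) ^ (e + 1) * uU e (t + 1) s ≤ uM (t + 1) s := by
    unfold uM
    exact Finset.single_le_sum (f := fun e => (1 / 2 : ℚ) ^ (e + 1) * uU e (t + 1) s)
      (fun e _ => mul_nonneg (by positivity) (uU_nonneg _ _ _)) (Finset.mem_range.2 (by omega))
  have h4 : (1 / 2 : ℚ) ^ (e + 1) * f n s ≤ uM (t + 1) s := by
    refine le_trans ?_ h3
    exact mul_le_mul_of_nonneg_left (h1.trans h2) (by positivity)
  refine le_trans ?_ (uM_le (t + 1) s)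
  have := (Rat.cast_le (K := ℝ)).2 h4
  push_cast at this
  exact this

end

section
/-! ### Computable upper approximations of powers -/

theorem exists_pow_approx (q : ℝ) (hqc : ComputableReal q) (hq : 1 < q) :
    ∃ (P : ℚ → ℕ → ℚ) (e : ℕ → ℝ), Computable₂ P ∧ (∀ t, 0 ≤ e t) ∧ Tendsto e atTop (𝓝 q) ∧
      ∀ (a : ℚ) (t : ℕ), 0 ≤ a → a ≤ 1 → (a : ℝ) ^ q ≤ P a t ∧
        (P a t : ℝ) ≤ (a : ℝ) ^ e t + 1 / ((t : ℝ) + 1) := by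
  obtain ⟨f, hf, hfq⟩ := hqc
  let r : ℕ → ℚ := fun t => f t - (1 / 2) ^ t
  have hr : Computable r := crat_sub hf (crat_half Computable.id)
  let u : ℕ → ℕ := fun t => rP (r t)
  let v : ℕ → ℕ := fun t => (r t).den
  have hu : Computable u := computable_rP.comp hr
  have hv : Computable v := computable_den.comp hr
  have hrq : ∀ t, (r t : ℝ) ≤ q ∧ q - 2 * (1 / 2) ^ t ≤ r t := by
    intro t
    have h1 := abs_lt.1 (hfq t)
    have h2 : ((r t : ℚ) : ℝ) = f t - (1 / 2) ^ t := by simp only [r]; push_cast; rfl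
    have h3 : ((2:ℝ)⁻¹) ^ t = (1 / 2) ^ t := by norm_num
    rw [h3] at h1
    rw [h2]
    constructor <;> linarith [h1.1, h1.2]
  let e : ℕ → ℝ := fun t => (u t : ℝ) / v t
  have he : ∀ t, e t = max (r t : ℝ) 0 := by
    intro t
    have h1 : (max (r t) 0 : ℚ) = (u t : ℚ) / v t := by
      have h2 := rat_eq (r t)
      simp only [u, v]
      rcases le_total 0 (r t) with h | h
      · rw [max_eq_left h]
        have h3 : rN (r t) = 0 := by
          unfold rN; have := Rat.num_nonneg.2 h; omega
        rw [h3] at h2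
        simpa using h2
      · rw [max_eq_right h]
        have h3 : rP (r t) = 0 := by
          unfold rP; have := Rat.num_nonpos.2 h; omega
        rw [h3]; simp
    have h4 := congrArg (Rat.cast : ℚ → ℝ) h1
    push_cast at h4
    exact h4.symm
  have he0 : ∀ t, 0 ≤ e t := fun t => by positivity
  have heq : ∀ t, e t ≤ q := fun t => by rw [he]; exact max_le (hrq t).1 (by linarith)
  have helim : Tendsto e atTop (𝓝 q) := by
    have h1 : Tendsto (fun t : ℕ => q - 2 * (1 / 2 : ℝ) ^ t) atTop (𝓝 q) := by
      have := (tendsto_pow_atTop_nhds_zero_of_lt_one (show (0:ℝ) ≤ 1 / 2 by norm_num)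
        (by norm_num)).const_mul 2
      simpa using this.const_sub q
    refine tendsto_of_tendsto_of_tendsto_of_le_of_le h1 tendsto_const_nhds (fun t => ?_) heq
    rw [he]
    exact (hrq t).2.trans (le_max_left _ _)
  let C : ℚ → ℕ → ℕ → Prop := fun a t j =>
    ¬ (j < t + 1 ∧ j ^ v t * a.den ^ u t < rP a ^ u t * (t + 1) ^ v t)
  have hCdec : ∀ a t j, Decidable (C a t j) := fun a t j => by simp only [C]; infer_instance
  have hex : ∀ a t, ∃ j, C a t j := fun a t => ⟨t + 1, by simp only [C]; omega⟩
  let S : ℚ × ℕ → ℕ := fun p => @Nat.find _ (hCdec p.1 p.2) (hex p.1 p.2)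
  have hS1 : ∀ a t, C a t (S (a, t)) := fun a t => @Nat.find_spec _ (hCdec a t) (hex a t)
  have hS2 : ∀ a t j, C a t j → S (a, t) ≤ j := fun a t j h =>
    @Nat.find_min' _ (hCdec a t) (hex a t) j h
  have hSc : Computable S := by
    let p : ℚ × ℕ → ℕ → Bool := fun x j => decide (¬ (j < x.2 + 1 ∧
      j ^ v x.2 * x.1.den ^ u x.2 < rP x.1 ^ u x.2 * (x.2 + 1) ^ v x.2))
    have hp : Computable₂ p := by
      have ha : Computable fun x : (ℚ × ℕ) × ℕ => x.1.1 := Computable.fst.comp Computable.fst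
      have ht : Computable fun x : (ℚ × ℕ) × ℕ => x.1.2 := Computable.snd.comp Computable.fst
      have hj : Computable fun x : (ℚ × ℕ) × ℕ => x.2 := Computable.snd
      have ht1 : Computable fun x : (ℚ × ℕ) × ℕ => x.1.2 + 1 := Computable.succ.comp ht
      refine Computable.of_eq (c_dnot (c_dand (cnat_lt hj ht1) (cnat_lt (cnat_mul (cnat_pow hj (hv.comp ht))
        (cnat_pow (computable_den.comp ha) (hu.comp ht))) (cnat_mul
          (cnat_pow (computable_rP.comp ha) (hu.comp ht)) (cnat_pow ht1 (hv.comp ht)))))) fun x => ?_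
      exact decide_eq_decide.2 Iff.rfl
    refine computable_search hp (fun x => ?_) (fun x j hj => ?_)
    · exact decide_eq_true (hS1 x.1 x.2)
    · exact hS2 x.1 x.2 j (of_decide_eq_true hj)
  refine ⟨fun a t => (S (a, t) : ℚ) / ((t + 1 : ℕ) : ℚ), e, ?_, he0, helim, ?_⟩
  · exact crat_natdiv hSc (Computable.succ.comp Computable.snd)
  intro a t ha0 ha1
  have ha0' : (0:ℝ) ≤ a := by exact_mod_cast ha0
  have ha1' : (a:ℝ) ≤ 1 := by exact_mod_cast ha1
  have hvpos : 0 < v t := (r t).den_pos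
  have haeq : (a : ℝ) = (rP a : ℝ) / a.den := by
    have h2 := rat_eq a
    have h3 : rN a = 0 := by
      unfold rN; have := Rat.num_nonneg.2 ha0; omega
    rw [h3] at h2
    have := congrArg (Rat.cast : ℚ → ℝ) h2
    push_cast at this
    simpa using this
  have hden : (0:ℝ) < a.den := by exact_mod_cast a.den_pos
  have hpow : ((a : ℝ) ^ e t) ^ v t = (a : ℝ) ^ u t := by
    rw [← Real.rpow_natCast, ← Real.rpow_mul ha0', ← Real.rpow_natCast]
    congr 1
    simp only [e]
    have : (v t : ℝ) ≠ 0 := by exact_mod_cast hvpos.ne'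
    field_simp
  have ht1 : (0:ℝ) < (t:ℝ) + 1 := by positivity
  have hkey : ∀ j : ℕ, j ^ v t * a.den ^ u t < rP a ^ u t * (t + 1) ^ v t ↔
      (j : ℝ) / (t + 1) < (a : ℝ) ^ e t := by
    intro j
    rw [← pow_lt_pow_iff_left₀ (by positivity) (Real.rpow_nonneg ha0' _) hvpos.ne', hpow, div_pow,
      haeq, div_pow, div_lt_div_iff₀ (by positivity) (by positivity)]
    exact_mod_cast Iff.rfl
  have hcast : (((S (a, t) : ℚ) / ((t + 1 : ℕ) : ℚ) : ℚ) : ℝ) = (S (a, t) : ℝ) / (t + 1) := by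
    push_cast; rfl
  rw [hcast]
  constructor
  · have h1 : (a:ℝ) ^ q ≤ (a:ℝ) ^ e t := by
      rcases ha0'.eq_or_lt with h | h
      · rw [← h, Real.zero_rpow (by linarith)]
        exact Real.rpow_nonneg le_rfl _
      · exact Real.rpow_le_rpow_of_exponent_ge h ha1' (heq t)
    refine h1.trans ?_
    by_contra hc
    push Not at hc
    refine hS1 a t ⟨?_, (hkey _).2 hc⟩
    have h2 : (a:ℝ) ^ e t ≤ 1 := Real.rpow_le_one ha0' ha1' (he0 t)
    have h3 := hc.trans_le h2
    rw [div_lt_one ht1] at h3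
    exact_mod_cast h3
  · rcases Nat.eq_zero_or_pos (S (a, t)) with h0 | h0
    · rw [h0]
      have := Real.rpow_nonneg ha0' (e t)
      have : 0 < 1 / ((t:ℝ) + 1) := by positivity
      simp only [Nat.cast_zero, zero_div]
      linarith
    · have h1 : ¬ C a t (S (a, t) - 1) := fun h => by
        have := hS2 a t _ h; omega
      have h2 := (hkey _).1 (not_not.1 h1).2
      have h3 : ((S (a, t) - 1 : ℕ) : ℝ) = (S (a, t) : ℝ) - 1 := by
        rw [Nat.cast_sub h0]; simp
      rw [h3, sub_div] at h2
      linarith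

/-! ### The function `x - x ^ q` -/

section hfun
variable {q : ℝ}

theorem h_cont (hq : 1 < q) : Continuous fun x : ℝ => x - x ^ q :=
  continuous_id.sub (Real.continuous_rpow_const (by linarith))

theorem h_deriv (hq : 1 < q) (x : ℝ) : deriv (fun x : ℝ => x - x ^ q) x = 1 - q * x ^ (q - 1) :=
  ((hasDerivAt_id x).sub (Real.hasDerivAt_rpow_const (Or.inr hq.le))).deriv

theorem h_nonneg (hq : 1 < q) {x : ℝ} (h0 : 0 ≤ x) (h1 : x ≤ 1) : 0 ≤ x - x ^ q := by
  rcases h0.eq_or_lt with h | h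
  · rw [← h, Real.zero_rpow (by linarith)]; simp
  · have := Real.rpow_le_rpow_of_exponent_ge h h1 hq.le
    rw [Real.rpow_one] at this
    linarith

theorem h_le {x : ℝ} (h0 : 0 ≤ x) : x - x ^ q ≤ x := by
  have := Real.rpow_nonneg h0 q
  linarith

theorem exists_peak (hq : 1 < q) : ∃ X : ℝ, 0 < X ∧ X < 1 ∧ 0 < X - X ^ q ∧
    StrictMonoOn (fun x : ℝ => x - x ^ q) (Set.Icc 0 X) ∧
    StrictAntiOn (fun x : ℝ => x - x ^ q) (Set.Icc X 1) := by
  have hq0 : 0 < q := by linarith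
  have hq1 : 0 < q - 1 := by linarith
  set X : ℝ := (1 / q) ^ (1 / (q - 1)) with hX
  have hX0 : 0 < X := Real.rpow_pos_of_pos (by positivity) _
  have hX1 : X < 1 := Real.rpow_lt_one (by positivity) (by rw [div_lt_one hq0]; exact hq) (by positivity)
  have hXp : X ^ (q - 1) = 1 / q := by
    rw [hX, ← Real.rpow_mul (by positivity), one_div_mul_cancel hq1.ne', Real.rpow_one]
  have hmono : StrictMonoOn (fun x : ℝ => x - x ^ q) (Set.Icc 0 X) := by
    refine strictMonoOn_of_deriv_pos (convex_Icc _ _) (h_cont hq).continuousOn fun x hx => ?_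
    rw [interior_Icc] at hx
    rw [h_deriv hq]
    have h1 : x ^ (q - 1) < X ^ (q - 1) := Real.rpow_lt_rpow hx.1.le hx.2 hq1
    rw [hXp, lt_div_iff₀ hq0] at h1
    linarith
  have hanti : StrictAntiOn (fun x : ℝ => x - x ^ q) (Set.Icc X 1) := by
    refine strictAntiOn_of_deriv_neg (convex_Icc _ _) (h_cont hq).continuousOn fun x hx => ?_
    rw [interior_Icc] at hx
    rw [h_deriv hq]
    have h1 : X ^ (q - 1) < x ^ (q - 1) := Real.rpow_lt_rpow hX0.le hx.1 hq1
    rw [hXp, div_lt_iff₀ hq0] at h1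
    linarith
  refine ⟨X, hX0, hX1, ?_, hmono, hanti⟩
  have := hmono (Set.left_mem_Icc.2 hX0.le) (Set.right_mem_Icc.2 hX0.le) hX0
  simpa [Real.zero_rpow hq0.ne'] using this

end hfun

end

section
/-! ### Realization -/

theorem realize (q : ℝ) (hqc : ComputableReal q) (hq : 1 < q) (X : ℝ) (hX0 : 0 < X) (hX1 : X < 1)
    (hmono : StrictMonoOn (fun x : ℝ => x - x ^ q) (Set.Icc 0 X))
    (hanti : StrictAntiOn (fun x : ℝ => x - x ^ q) (Set.Icc X 1))
    (y : ℝ) (hy : RightComputableReal y) (hy0 : 0 < y) (hyX : (q - 1) * y < X - X ^ q) :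
    ∃ m : Str → ℝ, UniversalProb m ∧ (1 / (q - 1)) * ∑' s, (m s - m s ^ q) = y := by
  have hq1 : 0 < q - 1 := by linarith
  obtain ⟨P, e, hP, he0, he, hPa⟩ := exists_pow_approx q hqc hq
  obtain ⟨f, hf, hfq⟩ := hqc
  obtain ⟨g, hg, hgy, hgl⟩ := hy
  -- joint convergence of the power approximation
  have hPlim : ∀ (a : ℕ → ℚ) (b : ℝ), (∀ t, 0 ≤ a t ∧ a t ≤ 1) →
      Tendsto (fun t => (a t : ℝ)) atTop (𝓝 b) →
      Tendsto (fun t => (P (a t) t : ℝ)) atTop (𝓝 (b ^ q)) := by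
    intro a b ha hab
    have h1 : Tendsto (fun t => (a t : ℝ) ^ e t) atTop (𝓝 (b ^ q)) :=
      hab.rpow he (Or.inr (by linarith))
    have h2 : Tendsto (fun t => (a t : ℝ) ^ q) atTop (𝓝 (b ^ q)) :=
      hab.rpow_const (Or.inr (by linarith))
    have h3 : Tendsto (fun t : ℕ => (a t : ℝ) ^ e t + 1 / ((t:ℝ) + 1)) atTop (𝓝 (b ^ q)) := by
      simpa using h1.add tendsto_one_div_add_atTop_nhds_zero_nat
    exact tendsto_of_tendsto_of_tendsto_of_le_of_le h2 h3
      (fun t => (hPa _ t (ha t).1 (ha t).2).1) (fun t => (hPa _ t (ha t).1 (ha t).2).2)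
  -- choice of ε
  obtain ⟨ε, hε0, hεX, hε1, hεy⟩ : ∃ ε : ℚ, 0 < ε ∧ (ε : ℝ) ≤ X ∧ X ≤ 1 - (ε : ℝ) ∧
      ((1 - ε : ℝ) - (1 - ε : ℝ) ^ q) + ε ≤ (q - 1) * y := by
    have h0 : Tendsto (fun k : ℕ => ((1:ℝ) / 2) ^ k) atTop (𝓝 0) :=
      tendsto_pow_atTop_nhds_zero_of_lt_one (by norm_num) (by norm_num)
    have h1 : Tendsto (fun k : ℕ => ((1 - (1 / 2) ^ k : ℝ) - (1 - (1 / 2) ^ k : ℝ) ^ q)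
        + (1 / 2) ^ k) atTop (𝓝 0) := by
      have h2 := ((h_cont hq).tendsto 1).comp
        (show Tendsto (fun k : ℕ => (1 - (1 / 2) ^ k : ℝ)) atTop (𝓝 1) by simpa using h0.const_sub 1)
      simpa using h2.add h0
    obtain ⟨k, hk1, hk2, hk3⟩ := ((h0.eventually_lt_const hX0).and
      ((h0.eventually_lt_const (sub_pos.2 hX1)).and
        (h1.eventually_lt_const (mul_pos hq1 hy0)))).exists
    refine ⟨(1 / 2) ^ k, by positivity, ?_, ?_, ?_⟩ <;> push_cast <;> linarith
  have hε0' : (0:ℝ) < ε := by exact_mod_cast hε0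
  have hεle1 : (ε:ℝ) ≤ 1 := hεX.trans hX1.le
  have hεle1' : ε ≤ 1 := by exact_mod_cast hεle1
  -- basic bounds on scaled values
  have hinf1 : ∀ s, uInf s ≤ 1 := fun s => by simpa using uInf_sum {s}
  have hb0 : ∀ s, 0 ≤ (ε:ℝ) * uInf s := fun s => mul_nonneg hε0'.le (uInf_nonneg s)
  have hbε : ∀ s, (ε:ℝ) * uInf s ≤ ε := fun s => by
    have := hinf1 s; nlinarith
  have hbX : ∀ s, (ε:ℝ) * uInf s ≤ X := fun s => (hbε s).trans hεX
  have hb1 : ∀ s, (ε:ℝ) * uInf s ≤ 1 := fun s => (hbX s).trans hX1.le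
  have ha0 : ∀ t s, 0 ≤ ε * uM t s := fun t s => mul_nonneg hε0.le (uM_nonneg t s)
  have ha1 : ∀ t s, ε * uM t s ≤ 1 := fun t s => by
    have := uM_le_one t s; have := uM_nonneg t s; nlinarith
  have hab : ∀ t s, ((ε * uM t s : ℚ) : ℝ) ≤ (ε:ℝ) * uInf s := fun t s => by
    push_cast
    exact mul_le_mul_of_nonneg_left (uM_le t s) hε0'.le
  have hablim : ∀ s, Tendsto (fun t => ((ε * uM t s : ℚ) : ℝ)) atTop (𝓝 ((ε:ℝ) * uInf s)) := by
    intro s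
    push_cast
    exact (uM_tendsto s).const_mul _
  have hsumm : Summable fun s => (ε:ℝ) * uInf s :=
    (summable_of_sum_le uInf_nonneg uInf_sum).mul_left _
  have htsum : ∑' s, (ε:ℝ) * uInf s ≤ ε := by
    rw [tsum_mul_left]
    have : ∑' s, uInf s ≤ 1 := Real.tsum_le_of_sum_le uInf_nonneg uInf_sum
    nlinarith
  -- the entropy away from the empty string
  set hE : Str → ℝ := fun s => if s = [] then 0 else (ε:ℝ) * uInf s - ((ε:ℝ) * uInf s) ^ q with hhE
  have hE0 : ∀ s, 0 ≤ hE s := by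
    intro s
    simp only [hhE]; split_ifs
    · exact le_rfl
    · exact h_nonneg hq (hb0 s) (hb1 s)
  have hEle : ∀ s, hE s ≤ (ε:ℝ) * uInf s := by
    intro s
    simp only [hhE]; split_ifs
    · exact hb0 s
    · exact h_le (hb0 s)
  have hEs : Summable hE := Summable.of_nonneg_of_le hE0 hEle hsumm
  set E : ℝ := ∑' s, hE s with hEdef
  have hE_nonneg : 0 ≤ E := tsum_nonneg hE0
  have hE_le : E ≤ ε := (hEs.tsum_le_tsum hEle hsumm).trans htsum
  -- approximations
  let G : ℕ → Str → ℚ := fun t s =>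
    if s = [] then 0 else max 0 (ε * uM t s - P (ε * uM t s) t)
  have hG0 : ∀ t s, 0 ≤ G t s := by
    intro t s
    simp only [G]; split_ifs
    · exact le_rfl
    · exact le_max_left _ _
  have hGle : ∀ t s, (G t s : ℝ) ≤ hE s := by
    intro t s
    simp only [G, hhE]
    split_ifs
    · simp
    · push_cast
      refine max_le (h_nonneg hq (hb0 s) (hb1 s)) ?_
      have h1 := (hPa (ε * uM t s) t (ha0 t s) (ha1 t s)).1
      have h2 := hmono.monotoneOn (show ((ε * uM t s : ℚ) : ℝ) ∈ Set.Icc 0 X from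
        ⟨by exact_mod_cast ha0 t s, (hab t s).trans (hbX s)⟩) ⟨hb0 s, hbX s⟩ (hab t s)
      push_cast at h1 h2 ⊢
      linarith
  have hGlim : ∀ s, Tendsto (fun t => (G t s : ℝ)) atTop (𝓝 (hE s)) := by
    intro s
    simp only [G, hhE]
    split_ifs
    · simp
    · have h1 := (hablim s).sub (hPlim (fun t => ε * uM t s) _ (fun t => ⟨ha0 t s, ha1 t s⟩) (hablim s))
      have h2 := (tendsto_const_nhds (x := (0:ℝ))).max h1
      rw [max_eq_right (h_nonneg hq (hb0 s) (hb1 s))] at h2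
      refine h2.congr fun t => ?_
      push_cast
      rfl
  let Et : ℕ → ℚ := fun t => ∑ s ∈ strFin t, G t s
  have hEtc : Computable Et := by
    refine crat_sum_str (F := G) ?_ Computable.id
    have hM : Computable fun p : ℕ × Str => ε * uM p.1 p.2 :=
      crat_mul (Computable.const ε) computable_uM
    exact c_ite (α := ℕ × Str) (c_eq Computable.snd (Computable.const []))
      (Computable.const 0) (crat_max (Computable.const 0)
        (crat_sub hM (hP.comp hM Computable.fst)))
  have hEtle : ∀ t, (Et t : ℝ) ≤ E := by
    intro t
    simp only [Et]
    push_cast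
    exact (Finset.sum_le_sum fun s _ => hGle t s).trans (hEs.sum_le_tsum _ fun s _ => hE0 s)
  have hEtlim : Tendsto (fun t => (Et t : ℝ)) atTop (𝓝 E) := by
    have h1 : ∀ t, (Et t : ℝ) = ∑' s, if s ∈ strFin t then (G t s : ℝ) else 0 := by
      intro t
      rw [tsum_eq_sum (s := strFin t) (fun s hs => if_neg hs)]
      simp only [Et]
      push_cast
      exact Finset.sum_congr rfl fun s hs => (if_pos hs).symm
    simp only [h1]
    refine tendsto_tsum_of_dominated_convergence hEs (fun s => ?_) (Eventually.of_forall fun t s => ?_)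
    · refine (hGlim s).congr' ?_
      filter_upwards [eventually_gt_atTop (Encodable.encode s)] with t ht
      rw [if_pos (mem_strFin.2 ht)]
    · have h2 : (0:ℝ) ≤ G t s := by exact_mod_cast hG0 t s
      split_ifs
      · rw [Real.norm_of_nonneg h2]; exact hGle t s
      · simpa using hE0 s
  set R : ℝ := (q - 1) * y - E with hR
  let Rt : ℕ → ℚ := fun t => (f t + (1 / 2) ^ t - 1) * g t - Et t
  have hRtc : Computable Rt := crat_sub (crat_mul (crat_sub (crat_add hf (crat_half Computable.id))
    (Computable.const 1)) hg) hEtc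
  have hfq1 : ∀ t, q - 1 ≤ (f t : ℝ) + (1 / 2) ^ t - 1 := by
    intro t
    have h1 := abs_lt.1 (hfq t)
    have h3 : ((2:ℝ)⁻¹) ^ t = (1 / 2) ^ t := by norm_num
    rw [h3] at h1
    linarith [h1.2]
  have hflim : Tendsto (fun t => (f t : ℝ) + (1 / 2) ^ t - 1) atTop (𝓝 (q - 1)) := by
    have h0 : Tendsto (fun k : ℕ => ((1:ℝ) / 2) ^ k) atTop (𝓝 0) :=
      tendsto_pow_atTop_nhds_zero_of_lt_one (by norm_num) (by norm_num)
    have h1 : Tendsto (fun k : ℕ => q - 1 + 2 * ((1:ℝ) / 2) ^ k) atTop (𝓝 (q - 1)) := by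
      simpa using (h0.const_mul 2).const_add (q - 1)
    refine tendsto_of_tendsto_of_tendsto_of_le_of_le tendsto_const_nhds h1 hfq1 fun t => ?_
    have h1 := abs_lt.1 (hfq t)
    have h3 : ((2:ℝ)⁻¹) ^ t = (1 / 2) ^ t := by norm_num
    rw [h3] at h1
    dsimp only
    linarith [h1.1]
  have hRt : ∀ t, (Rt t : ℝ) = ((f t : ℝ) + (1 / 2) ^ t - 1) * g t - Et t := by
    intro t; simp only [Rt]; push_cast; rfl
  have hRle : ∀ t, R ≤ Rt t := by
    intro t
    rw [hRt]
    have h1 := hfq1 t; have h2 := hgy t; have h3 := hEtle t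
    have : (q - 1) * y ≤ ((f t : ℝ) + (1 / 2) ^ t - 1) * g t := by gcongr; linarith
    linarith
  have hRlim : Tendsto (fun t => (Rt t : ℝ)) atTop (𝓝 R) := by
    simp only [hRt]
    exact (hflim.mul hgl).sub hEtlim
  -- the special value
  have hRlow : (1 - ε : ℝ) - (1 - ε : ℝ) ^ q ≤ R := by linarith
  have hR0 : 0 ≤ R := le_trans (h_nonneg hq (by linarith) (by linarith)) hRlow
  have hRX : R < X - X ^ q := by linarith
  obtain ⟨x, hxm, hxR⟩ : ∃ x ∈ Set.Icc X 1, x - x ^ q = R := by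
    have h1 := intermediate_value_Icc' hX1.le ((h_cont hq).continuousOn (s := Set.Icc X 1))
    have h2 : R ∈ Set.Icc ((fun x : ℝ => x - x ^ q) 1) ((fun x : ℝ => x - x ^ q) X) :=
      ⟨by simpa using hR0, hRX.le⟩
    exact h1 h2
  have hxX : X < x := by
    rcases hxm.1.eq_or_lt with h | h
    · rw [← h] at hxR; linarith
    · exact h
  have hx0 : 0 < x := hX0.trans hxX
  have hxε : x ≤ 1 - ε := by
    by_contra hc
    push Not at hc
    have := hanti (show (1 - ε : ℝ) ∈ Set.Icc X 1 from ⟨hε1, by linarith⟩) hxm hc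
    dsimp only at this
    linarith
  let a : ℕ → ℚ := fun n => ((Nat.unpair n).1 : ℚ) / ((Nat.unpair n).2 : ℚ)
  have hac : Computable a := crat_natdiv (Computable.fst.comp Computable.unpair)
    (Computable.snd.comp Computable.unpair)
  have haR : ∀ n, 0 ≤ a n := fun n => by simp only [a]; positivity
  let b : ℕ → ℕ → ℚ := fun t n => if a n ≤ 1 ∧ Rt t ≤ a n - P (a n) t then a n else 0
  let xt : ℕ → ℚ := fun t => rmax (b t) t
  have hxtc : Computable xt := by
    refine crat_rmax (F := b) ?_ Computable.id
    have han : Computable fun p : ℕ × ℕ => a p.2 := hac.comp Computable.snd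
    exact c_ite (α := ℕ × ℕ) (c_dand (crat_le han (Computable.const 1)) (crat_le (hRtc.comp Computable.fst)
      (crat_sub han (hP.comp han Computable.fst)))) han (Computable.const 0)
  have hxt0 : ∀ t, 0 ≤ xt t := fun t => rmax_nonneg _ _
  have hxtle : ∀ t, (xt t : ℝ) ≤ x := by
    intro t
    simp only [xt]
    rcases rmax_cases (b t) t with h | ⟨i, hi, h⟩
    · rw [h]; simpa using hx0.le
    · rw [h]
      simp only [b]
      split_ifs with hc
      · by_contra hlt
        push Not at hlt
        have h1 := (hPa (a i) t (haR i) hc.1).1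
        have h2 := (Rat.cast_le (K := ℝ)).2 hc.2
        push_cast at h2
        have h3 : (a i : ℝ) ≤ 1 := by exact_mod_cast hc.1
        have h4 := hanti hxm (show (a i : ℝ) ∈ Set.Icc X 1 from ⟨by linarith, h3⟩) hlt
        dsimp only at h4
        have h5 := hRle t
        linarith
      · simpa using hx0.le
  have hxtlim : Tendsto (fun t => (xt t : ℝ)) atTop (𝓝 x) := by
    rw [Metric.tendsto_atTop]
    intro η hη
    obtain ⟨ra, hra1, hra2⟩ := exists_rat_btwn (show max X (x - η) < x from max_lt hxX (by linarith))
    have hraX : X < ra := (le_max_left _ _).trans_lt hra1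
    have hraη : x - η < ra := (le_max_right _ _).trans_lt hra1
    have hra0 : 0 ≤ ra := by
      have : (0:ℝ) ≤ ra := by linarith
      exact_mod_cast this
    have hra1' : ra ≤ 1 := by
      have : (ra:ℝ) ≤ 1 := by linarith [hxm.2]
      exact_mod_cast this
    have hn : ∃ n, a n = ra := by
      refine ⟨Nat.pair (rP ra) ra.den, ?_⟩
      simp only [a, Nat.unpair_pair]
      have h2 := rat_eq ra
      have h3 : rN ra = 0 := by
        unfold rN; have := Rat.num_nonneg.2 hra0; omega
      rw [h3] at h2
      simpa using h2.symm
    obtain ⟨n, hn⟩ := hn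
    have h1 : Tendsto (fun t => (ra:ℝ) - P ra t - Rt t) atTop (𝓝 ((ra:ℝ) - (ra:ℝ) ^ q - R)) :=
      ((hPlim (fun _ => ra) ra (fun _ => ⟨hra0, hra1'⟩) tendsto_const_nhds).const_sub _).sub hRlim
    have h2 : 0 < (ra:ℝ) - (ra:ℝ) ^ q - R := by
      have := hanti (show (ra:ℝ) ∈ Set.Icc X 1 from ⟨hraX.le, by exact_mod_cast hra1'⟩) hxm hra2
      dsimp only at this
      linarith
    obtain ⟨T, hT⟩ := eventually_atTop.1 (h1.eventually_const_lt h2)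
    refine ⟨max T (n + 1), fun t ht => ?_⟩
    have h3 := hT t ((le_max_left _ _).trans ht)
    have h4 : n < t := lt_of_lt_of_le (Nat.lt_succ_self n) ((le_max_right _ _).trans ht)
    have h5 : b t n = ra := by
      simp only [b]
      rw [hn, if_pos]
      refine ⟨hra1', ?_⟩
      have h6 : (Rt t : ℝ) ≤ ((ra - P ra t : ℚ) : ℝ) := by push_cast; linarith
      exact_mod_cast h6
    have h6 : ra ≤ xt t := by
      rw [← h5]; exact le_rmax _ h4
    have h7 : (ra:ℝ) ≤ xt t := by exact_mod_cast h6
    have h8 := hxtle t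
    rw [Real.dist_eq, abs_lt]
    constructor <;> linarith
  -- the universal probability
  let m : Str → ℝ := fun s => if s = [] then x else (ε:ℝ) * uInf s
  have hm0 : ∀ s, 0 ≤ m s := by
    intro s; simp only [m]; split_ifs
    · exact hx0.le
    · exact hb0 s
  have hm1 : ∀ s, m s ≤ 1 := by
    intro s; simp only [m]; split_ifs
    · exact hxm.2
    · exact hb1 s
  have hmle : ∀ s, m s ≤ (if s = [] then x else 0) + (ε:ℝ) * uInf s := by
    intro s; simp only [m]; have := hb0 s; split_ifs <;> linarith
  refine ⟨m, ⟨⟨⟨fun s => ⟨hm0 s, hm1 s⟩, fun F => ?_⟩,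
    fun t s => if s = [] then xt t else ε * uM t s, ?_, ?_⟩, ?_⟩, ?_⟩
  · refine (Finset.sum_le_sum fun s _ => hmle s).trans ?_
    rw [Finset.sum_add_distrib, Finset.sum_ite_eq', ← Finset.mul_sum]
    have h1 := uInf_sum F
    have h2 : (if [] ∈ F then x else 0) ≤ x := by split_ifs <;> linarith
    nlinarith
  · have hM : Computable fun p : ℕ × Str => ε * uM p.1 p.2 :=
      crat_mul (Computable.const ε) computable_uM
    exact c_ite (α := ℕ × Str) (c_eq Computable.snd (Computable.const []))
      (hxtc.comp Computable.fst) hM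
  · intro s
    by_cases hs : s = []
    · simp only [m, if_pos hs]
      exact ⟨fun n => ⟨hxt0 n, hxtle n⟩, hxtlim⟩
    · simp only [m, if_neg hs]
      exact ⟨fun n => ⟨ha0 n s, hab n s⟩, hablim s⟩
  · intro r hr
    obtain ⟨c, hc0, hc⟩ := uInf_dom r hr
    refine ⟨min (ε * c) x, lt_min (by positivity) hx0, fun s => ?_⟩
    have hr0 := (hr.1.1 s).1
    have hr1 := (hr.1.1 s).2
    by_cases hs : s = []
    · simp only [m, if_pos hs]
      calc min (ε * c) x * r s ≤ x * 1 := by gcongr; exact min_le_right _ _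
        _ = x := mul_one x
    · simp only [m, if_neg hs]
      calc min (ε * c) x * r s ≤ (ε * c) * r s := by gcongr; exact min_le_left _ _
        _ = ε * (c * r s) := by ring
        _ ≤ ε * uInf s := by gcongr; exact hc s
  · have hms : Summable fun s => m s - m s ^ q := by
      refine Summable.of_nonneg_of_le (fun s => h_nonneg hq (hm0 s) (hm1 s))
        (fun s => (h_le (hm0 s)).trans (hmle s)) (Summable.add ?_ hsumm)
      exact summable_of_ne_finset_zero (s := {[]}) fun s hs => if_neg (by simpa using hs)
    rw [hms.tsum_eq_add_tsum_ite []]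
    have h1 : (∑' s, if s = [] then 0 else m s - m s ^ q) = E := by
      rw [hEdef]
      refine tsum_congr fun s => ?_
      simp only [hhE, m]
      split_ifs <;> rfl
    have h2 : m [] - m [] ^ q = R := by simp only [m, if_true]; exact hxR
    rw [h1, h2, hR]
    field_simp
    ring

end

/-- For computable `q > 1` and computable `D ∈ [0,1]`, there is a universal
probability `m` whose Tsallis entropy `S_q(m)` is weakly Chaitin `D`-random and
`D`-compressible; in particular `K((S_q(m))_n)/n → D`. -/
theorem tsallis_entropy_any_degree (U : OptimalComputer)
    (q : ℝ) (hqc : ComputableReal q) (hq : 1 < q)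
    (D : ℝ) (hD : ComputableReal D) (hD0 : 0 ≤ D) (hD1 : D ≤ 1) :
    ∃ m : Str → ℝ, UniversalProb m ∧
      WeaklyChaitinDRandom U D ((1 / (q - 1)) * ∑' s, (m s - m s ^ q)) ∧
      DCompressible U D ((1 / (q - 1)) * ∑' s, (m s - m s ^ q)) ∧
      Tendsto (fun n : ℕ =>
          (Kc U (binPrefix ((1 / (q - 1)) * ∑' s, (m s - m s ^ q)) n) : ℝ) / n)
        atTop (nhds D) := by
  obtain ⟨X, hX0, hX1, hXp, hmono, hanti⟩ := exists_peak hq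
  have hq' : 0 < q - 1 := by linarith
  obtain ⟨j, hj⟩ := exists_pow_lt_of_lt_one (div_pos hXp hq')
    (by norm_num : (1 / 2 : ℝ) < 1)
  obtain ⟨y, hy, hy1, hy2, h1, h2, h3⟩ := dilute U D hD hD0 hD1 j
  have hy0 : 0 < y := lt_of_lt_of_le (by positivity) hy1
  have hyX : (q - 1) * y < X - X ^ q := by
    have h := (lt_div_iff₀ hq').1 (hy2.trans hj)
    linarith
  obtain ⟨m, hm, hmy⟩ := realize q hqc hq X hX0 hX1 hmono hanti y hy hy0 hyX
  refine ⟨m, hm, ?_⟩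
  rw [hmy]
  exact ⟨h1, h2, h3⟩

end Paper
end
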